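/- For Lebesgue-almost every parameter (x₁, x₂, y₁, y₂) in the set D = {(x₁, x₂, y₁, y₂) ∈ ℝ⁴ : 0 ≤ x₁ < x₂ < 1 and y₁ < y₂ < y₁ + 1} (with respect to the 4-dimensional Lebesgue measure on D), the piecewise affine circle homeomorphism f_{x₁,x₂,y₁,y₂} with break points x₁, x₂ and images y₁, y₂ is Morse–Smale. -/

import Mathlib

open MeasureTheory Filter

/-- The circle `ℝ/ℤ`. -/
abbrev Circle1 : Type := AddCircle (1 : ℝ)

/-- `F : ℝ → ℝ` is a lift of an orientation-preserving circle homeomorphism: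
continuous, strictly increasing, commuting with the unit translation. -/
def IsLift (F : ℝ → ℝ) : Prop :=
  Continuous F ∧ StrictMono F ∧ ∀ x : ℝ, F (x + 1) = F x + 1

/-- The circle map `f` is induced by the lift `F`. -/
def Induces (F : ℝ → ℝ) (f : Circle1 → Circle1) : Prop :=
  ∀ x : ℝ, f ((x : ℝ) : Circle1) = ((F x : ℝ) : Circle1)

/-- `F` is the lift of the piecewise affine circle homeomorphism with break points
`x₁, x₂` and images `y₁, y₂`: it satisfies `F x₁ = y₁`, `F x₂ = y₂` and is affine
on `[x₁, x₂]` and on `[x₂, x₁ + 1]`. -/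
def IsPiecewiseAffineTwoBreakLift (x₁ x₂ y₁ y₂ : ℝ) (F : ℝ → ℝ) : Prop :=
  IsLift F ∧ F x₁ = y₁ ∧ F x₂ = y₂ ∧
    (∃ a b : ℝ, ∀ x ∈ Set.Icc x₁ x₂, F x = a * x + b) ∧
    (∃ a b : ℝ, ∀ x ∈ Set.Icc x₂ (x₁ + 1), F x = a * x + b)

/-- `p` is a topologically attracting periodic point of `f` (of some period `q ≥ 1`):
there is an open neighbourhood `U` of `p` such that the iterates `f^[q*n]` of every
point of `U` converge to `p`. -/
def TopAttracting (f : Circle1 → Circle1) (p : Circle1) : Prop :=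
  ∃ q : ℕ, 1 ≤ q ∧ f^[q] p = p ∧
    ∃ U : Set Circle1, IsOpen U ∧ p ∈ U ∧
      ∀ x ∈ U, Tendsto (fun n : ℕ => f^[q * n] x) atTop (nhds p)

/-- `p` is a topologically repelling periodic point of `f`: it is topologically
attracting for the inverse of `f`. -/
def TopRepelling (f : Circle1 → Circle1) (p : Circle1) : Prop :=
  ∃ g : Circle1 → Circle1, Function.LeftInverse g f ∧ Function.RightInverse g f ∧
    TopAttracting g p

/-- A circle map is Morse–Smale if its set of periodic points is nonempty and finite, and
every periodic point is topologically attracting or topologically repelling. -/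
def MorseSmale (f : Circle1 → Circle1) : Prop :=
  {p : Circle1 | ∃ q : ℕ, 1 ≤ q ∧ f^[q] p = p}.Nonempty ∧
  {p : Circle1 | ∃ q : ℕ, 1 ≤ q ∧ f^[q] p = p}.Finite ∧
  ∀ p : Circle1, (∃ q : ℕ, 1 ≤ q ∧ f^[q] p = p) → TopAttracting f p ∨ TopRepelling f p

/-- The metric data of a pair of first-return branches of a two-break circle map: the branch
displacements `l`, `r = c + z`, the position `c` of the break, the slopes `a`, `b`, `g`, and the
rates `L`, `C`, `R` at which `l`, `c`, `r` vary with the translation parameter. -/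
@[ext]
structure Cell where
  l : ℝ
  c : ℝ
  z : ℝ
  a : ℝ
  b : ℝ
  g : ℝ
  L : ℝ
  C : ℝ
  R : ℝ

namespace Cell

variable (X : Cell)

def y : ℝ := X.l - X.b * X.c
def Y : ℝ := X.L - X.b * X.C
def r : ℝ := X.c + X.z
def Z : ℝ := X.R + X.C
def Δ : ℝ := X.c * X.Y - X.C * X.y
def Q : ℝ := X.L * X.z + X.l * X.Z
def W : ℝ := X.c * X.R + X.C * X.r
def P : ℝ := X.y * X.R + X.Y * X.r
def A : ℝ := X.l * X.R + X.L * X.r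

/-- The branch on the right of the break absorbs the left branch. -/
def moveOne : Cell :=
  ⟨X.l, X.c, X.z - X.a * X.l, X.a * X.g, X.b, X.g, X.L, X.C, X.R + X.a * X.L⟩

/-- The left branch absorbs the right branch. -/
def moveTwo : Cell :=
  ⟨X.a * X.l - X.r, X.c, X.z, X.a, X.a * X.b, X.a * X.g, X.a * X.L + X.R, X.C, X.R⟩

/-- The composite branch changes the side of the break, so the orientation is reversed. -/
noncomputable def moveThree : Cell :=
  ⟨X.r - X.a * X.l, X.z / X.a, X.l - X.z / X.a, X.b, X.a * X.g, X.a * X.b,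
    X.R + X.a * X.L, X.Z / X.a, X.L⟩

open Classical in
/-- One step of the renormalization. -/
noncomputable def step : Cell :=
  if X.r < X.a * X.l then X.moveTwo
  else if X.a * X.l < X.z then X.moveOne else X.moveThree

/-- Positivity and the two linear relations satisfied by every cell. -/
structure Alg (σ : ℝ) : Prop where
  l_pos : 0 < X.l
  c_pos : 0 < X.c
  z_pos : 0 < X.z
  a_pos : 0 < X.a
  b_pos : 0 < X.b
  g_pos : 0 < X.g
  L_pos : 0 < X.L
  C_nonneg : 0 ≤ X.C
  Y_pos : 0 < X.Y
  R_nonneg : 0 ≤ X.R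
  rel : X.a * X.l = X.c + X.y + (1 - X.g) * X.z
  rel_rate : X.a * X.L = X.C + X.Y - (1 - X.g) * X.Z
  slope : X.g = σ * X.b ∨ X.b = σ * X.g
  rate_pos : 0 < X.R → 0 < X.R + (1 - X.a * X.b / X.g) * X.C

/-- The strict inequalities excluding coincidences. -/
structure Gen : Prop where
  y_ne : X.y ≠ 0
  y_add_c_pos : 0 < X.y + X.c
  ne_r : X.a * X.l ≠ X.r
  ne_z : X.a * X.l ≠ X.z

/-- Neither of the two branches opens a mode-locking interval of relative size `η`. -/
def Bad (η : ℝ) : Prop :=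
  (0 ≤ X.Δ → |X.b - 1| * X.Δ < η * (X.Y + X.C) * X.l) ∧
  (0 ≤ X.P → |1 - X.a * X.b / X.g| * X.W <
    η * X.r * (X.R + (1 - X.a * X.b / X.g) * X.C))

variable {X} {σ : ℝ}

theorem r_pos (h : X.Alg σ) : 0 < X.r := add_pos h.c_pos h.z_pos

theorem Z_nonneg (h : X.Alg σ) : 0 ≤ X.Z := add_nonneg h.R_nonneg h.C_nonneg

theorem lt_r_of_lt_z (h : X.Alg σ) (hz : X.a * X.l < X.z) : X.a * X.l < X.r := by
  have := h.c_pos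
  simp only [r]; linarith

theorem step_eq_moveTwo (h : X.r < X.a * X.l) : X.step = X.moveTwo := if_pos h

theorem step_eq_moveOne (h : X.Alg σ) (hz : X.a * X.l < X.z) : X.step = X.moveOne := by
  rw [step, if_neg (lt_r_of_lt_z h hz).not_gt, if_pos hz]

theorem step_eq_moveThree (hz : X.z < X.a * X.l) (hr : X.a * X.l < X.r) :
    X.step = X.moveThree := by
  rw [step, if_neg hr.not_gt, if_neg hz.not_gt]

theorem step_cases (h : X.Alg σ) (hg : X.Gen) :
    (X.a * X.l < X.z ∧ X.step = X.moveOne) ∨ (X.r < X.a * X.l ∧ X.step = X.moveTwo) ∨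
      (X.z < X.a * X.l ∧ X.a * X.l < X.r ∧ X.step = X.moveThree) := by
  rcases lt_or_gt_of_ne hg.ne_z with h1 | h1
  · exact Or.inl ⟨h1, step_eq_moveOne h h1⟩
  rcases lt_or_gt_of_ne hg.ne_r with h2 | h2
  · exact Or.inr (Or.inr ⟨h1, h2, step_eq_moveThree h1 h2⟩)
  · exact Or.inr (Or.inl ⟨h2, step_eq_moveTwo h2⟩)

theorem moveOne_y : X.moveOne.y = X.y := rfl
theorem moveOne_Y : X.moveOne.Y = X.Y := rfl
theorem moveOne_r : X.moveOne.r = X.r - X.a * X.l := by simp only [r, moveOne]; ring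
theorem moveOne_Z : X.moveOne.Z = X.Z + X.a * X.L := by simp only [Z, moveOne]; ring
theorem moveTwo_y : X.moveTwo.y = X.a * X.y - X.r := by simp only [y, moveTwo]; ring
theorem moveTwo_Y : X.moveTwo.Y = X.a * X.Y + X.R := by simp only [Y, moveTwo]; ring
theorem moveTwo_r : X.moveTwo.r = X.r := rfl
theorem moveTwo_Z : X.moveTwo.Z = X.Z := rfl

theorem moveThree_y (ha : X.a ≠ 0) (h : X.a * X.l = X.c + X.y + (1 - X.g) * X.z) :
    X.moveThree.y = -X.y := by
  simp only [y, moveThree, r] at h ⊢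
  field_simp
  linear_combination -h

theorem moveThree_Y (ha : X.a ≠ 0) (h : X.a * X.L = X.C + X.Y - (1 - X.g) * X.Z) :
    X.moveThree.Y = X.Y := by
  simp only [Y, moveThree, Z] at h ⊢
  field_simp
  linear_combination h

theorem moveThree_r : X.moveThree.r = X.l := by simp only [r, moveThree]; ring
theorem moveThree_Z : X.moveThree.Z = X.L + X.Z / X.a := by simp only [Z, moveThree]

theorem moveTwo_cut (h : X.a * X.l = X.c + X.y + (1 - X.g) * X.z) :
    X.l - X.moveTwo.l = X.b * X.c + X.g * X.z := by
  simp only [y, moveTwo, r] at h ⊢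
  linear_combination -h

theorem moveOne_alg (h : X.Alg σ) (hz : X.a * X.l < X.z) : X.moveOne.Alg σ where
  l_pos := h.l_pos
  c_pos := h.c_pos
  z_pos := sub_pos.2 hz
  a_pos := mul_pos h.a_pos h.g_pos
  b_pos := h.b_pos
  g_pos := h.g_pos
  L_pos := h.L_pos
  C_nonneg := h.C_nonneg
  Y_pos := h.Y_pos
  R_nonneg := add_nonneg h.R_nonneg (mul_pos h.a_pos h.L_pos).le
  rel := by
    have := h.rel
    rw [moveOne_y]; simp only [moveOne]
    linear_combination this
  rel_rate := by
    have := h.rel_rate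
    rw [moveOne_Y, moveOne_Z]; simp only [moveOne]
    linear_combination this
  slope := h.slope
  rate_pos := fun _ => by
    have h1 : X.moveOne.R + (1 - X.moveOne.a * X.moveOne.b / X.moveOne.g) * X.moveOne.C
        = X.Z + X.a * X.Y := by
      have := h.g_pos.ne'
      simp only [moveOne, Y, Z]; field_simp; ring
    rw [h1]
    exact add_pos_of_nonneg_of_pos (Z_nonneg h) (mul_pos h.a_pos h.Y_pos)

theorem moveTwo_alg (h : X.Alg σ) (hr : X.r < X.a * X.l) : X.moveTwo.Alg σ where
  l_pos := sub_pos.2 hr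
  c_pos := h.c_pos
  z_pos := h.z_pos
  a_pos := h.a_pos
  b_pos := mul_pos h.a_pos h.b_pos
  g_pos := mul_pos h.a_pos h.g_pos
  L_pos := add_pos_of_pos_of_nonneg (mul_pos h.a_pos h.L_pos) h.R_nonneg
  C_nonneg := h.C_nonneg
  Y_pos := by
    rw [moveTwo_Y]
    exact add_pos_of_pos_of_nonneg (mul_pos h.a_pos h.Y_pos) h.R_nonneg
  R_nonneg := h.R_nonneg
  rel := by
    have := h.rel
    rw [moveTwo_y]; simp only [moveTwo, r]
    linear_combination X.a * this
  rel_rate := by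
    have := h.rel_rate
    rw [moveTwo_Y, moveTwo_Z]; simp only [moveTwo, Z] at this ⊢
    linear_combination X.a * this
  slope := by
    simp only [moveTwo]
    rcases h.slope with h | h
    · left; linear_combination X.a * h
    · right; linear_combination X.a * h
  rate_pos := fun hR => by
    have h1 : X.a * (X.a * X.b) / (X.a * X.g) = X.a * X.b / X.g := by
      have := h.g_pos.ne'
      have := h.a_pos.ne'
      field_simp
    have := h.rate_pos hR
    simp only [moveTwo, h1]
    exact this

theorem moveThree_alg (h : X.Alg σ) (hz : X.z < X.a * X.l) (hr : X.a * X.l < X.r) :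
    X.moveThree.Alg σ where
  l_pos := sub_pos.2 hr
  c_pos := div_pos h.z_pos h.a_pos
  z_pos := by
    have : X.z / X.a < X.l := by rw [div_lt_iff₀ h.a_pos]; linarith
    exact sub_pos.2 this
  a_pos := h.b_pos
  b_pos := mul_pos h.a_pos h.g_pos
  g_pos := mul_pos h.a_pos h.b_pos
  L_pos := add_pos_of_nonneg_of_pos h.R_nonneg (mul_pos h.a_pos h.L_pos)
  C_nonneg := div_nonneg (Z_nonneg h) h.a_pos.le
  Y_pos := by rw [moveThree_Y h.a_pos.ne' h.rel_rate]; exact h.Y_pos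
  R_nonneg := h.L_pos.le
  rel := by
    have := h.rel
    have ha := h.a_pos.ne'
    rw [moveThree_y ha this]; simp only [moveThree, r, y]
    field_simp
    ring
  rel_rate := by
    have := h.rel_rate
    have ha := h.a_pos.ne'
    rw [moveThree_Y ha this, moveThree_Z]; simp only [moveThree, Z, Y]
    field_simp
    ring
  slope := by
    simp only [moveThree]
    rcases h.slope with h | h
    · right; linear_combination X.a * h
    · left; linear_combination X.a * h
  rate_pos := fun _ => by
    have h1 : X.moveThree.R + (1 - X.moveThree.a * X.moveThree.b / X.moveThree.g) *
        X.moveThree.C = (X.C + X.Y) / X.a := by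
      have h2 := h.b_pos.ne'
      have h3 := h.a_pos.ne'
      have h4 := h.rel_rate
      simp only [moveThree]; field_simp
      linear_combination h4
    rw [h1]
    exact div_pos (add_pos_of_nonneg_of_pos h.C_nonneg h.Y_pos) h.a_pos

/-! ### Quadratic identities -/

theorem b_sub_one_mul_Δ (h : X.Alg σ) : (X.b - 1) * X.Δ = (1 - X.g) * X.Q := by
  have h1 := h.rel
  have h2 := h.rel_rate
  simp only [Δ, Q, Z, Y, y] at *
  linear_combination X.L * h1 - X.l * h2

theorem A_eq_Q_add_Δ : X.A = X.Q + X.Δ := by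
  simp only [A, Q, Δ, Y, y, Z, r]; ring

theorem A_eq_P_add : X.A = X.P + X.b * X.W := by
  simp only [A, P, W, Y, y, r]; ring

theorem a_mul_A (h : X.Alg σ) : X.a * X.A = X.P + X.g * X.W := by
  have h1 := h.rel
  have h2 := h.rel_rate
  simp only [A, P, W, Y, y, r, Z] at *
  linear_combination X.R * h1 + (X.c + X.z) * h2

theorem b_mul_Δ : X.b * X.Δ = X.l * X.Y - X.L * X.y := by
  simp only [Δ, Y, y]; ring

theorem Y_mul_A : X.Y * X.A = X.P * X.L + X.b * X.Δ * X.R := by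
  rw [b_mul_Δ]; simp only [A, P]; ring

theorem y_mul_A : X.y * X.A = X.P * X.l - X.b * X.Δ * X.r := by
  rw [b_mul_Δ]; simp only [A, P]; ring

theorem W_eq : X.W = X.r * X.Z - X.z * X.R := by
  simp only [W, r, Z]; ring

theorem one_sub_ratio (h : X.Alg σ) (hA : X.A ≠ 0) :
    1 - X.a * X.b / X.g = (1 - X.b / X.g) * X.P / X.A := by
  have h1 := a_mul_A h
  have h2 := X.A_eq_P_add
  have := h.g_pos.ne'
  field_simp
  linear_combination X.g * h2 - X.b * h1

end Cell

namespace Cell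

variable {X : Cell} {σ : ℝ}

theorem A_pos (h : X.Alg σ) : 0 < X.A :=
  add_pos_of_nonneg_of_pos (mul_nonneg h.l_pos.le h.R_nonneg) (mul_pos h.L_pos (r_pos h))

theorem Q_pos (h : X.Alg σ) : 0 < X.Q :=
  add_pos_of_pos_of_nonneg (mul_pos h.L_pos h.z_pos) (mul_nonneg h.l_pos.le (Z_nonneg h))

theorem W_nonneg (h : X.Alg σ) : 0 ≤ X.W :=
  add_nonneg (mul_nonneg h.c_pos.le h.R_nonneg) (mul_nonneg h.C_nonneg (r_pos h).le)

theorem y_pos_of_Δ_neg (h : X.Alg σ) (hΔ : X.Δ < 0) : 0 < X.y := by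
  by_contra! hy
  have h1 := mul_pos h.c_pos h.Y_pos
  have h2 := mul_nonneg h.C_nonneg (neg_nonneg.2 hy)
  simp only [Δ] at hΔ
  linarith

theorem P_pos_of_y_pos (h : X.Alg σ) (hy : 0 < X.y) : 0 < X.P :=
  add_pos_of_nonneg_of_pos (mul_nonneg hy.le h.R_nonneg) (mul_pos h.Y_pos (r_pos h))

theorem y_neg_of_P_neg (h : X.Alg σ) (hP : X.P < 0) : X.y < 0 := by
  by_contra! hy
  have h1 := mul_nonneg hy h.R_nonneg
  have h2 := mul_pos h.Y_pos (r_pos h)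
  simp only [P] at hP
  linarith

theorem Δ_pos_of_y_neg (h : X.Alg σ) (hy : X.y < 0) : 0 < X.Δ := by
  have h1 := mul_pos h.c_pos h.Y_pos
  have h2 := mul_nonneg h.C_nonneg (neg_pos.2 hy).le
  simp only [Δ]
  linarith

theorem slopes_of_Δ_nonneg (h : X.Alg σ) (hΔ : 0 ≤ X.Δ) :
    (1 ≤ X.b ∧ X.g ≤ 1) ∨ (X.b ≤ 1 ∧ 1 ≤ X.g) := by
  have h1 := b_sub_one_mul_Δ h
  have hQ := Q_pos h
  rcases le_total 1 X.b with hb | hb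
  · have h2 : 0 ≤ (1 - X.g) * X.Q := h1 ▸ mul_nonneg (sub_nonneg.2 hb) hΔ
    exact Or.inl ⟨hb, by linarith [nonneg_of_mul_nonneg_left h2 hQ]⟩
  · have h2 : 0 ≤ (X.g - 1) * X.Q := by
      have := mul_nonneg (sub_nonneg.2 hb) hΔ
      linarith
    exact Or.inr ⟨hb, by linarith [nonneg_of_mul_nonneg_left h2 hQ]⟩

theorem slopes_of_Δ_neg (h : X.Alg σ) (hne : X.b ≠ X.g) (hΔ : X.Δ < 0) :
    (1 < X.g ∧ X.g < X.b) ∨ (X.b < X.g ∧ X.g < 1) := by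
  have h1 := b_sub_one_mul_Δ h
  have hA := A_pos h
  rw [A_eq_Q_add_Δ] at hA
  rcases lt_trichotomy X.g 1 with hg | hg | hg
  · refine Or.inr ⟨?_, hg⟩
    by_contra! hb
    nlinarith [mul_pos (sub_pos.2 hg) hA, mul_nonneg (sub_nonneg.2 hb) (neg_pos.2 hΔ).le]
  · exfalso
    rw [hg, sub_self, zero_mul] at h1
    rcases mul_eq_zero.1 h1 with h2 | h2
    · exact hne (by linarith)
    · exact hΔ.ne h2
  · refine Or.inl ⟨hg, ?_⟩
    by_contra! hb
    nlinarith [mul_pos (sub_pos.2 hg) hA, mul_nonneg (sub_nonneg.2 hb) (neg_pos.2 hΔ).le]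

/-- Quantitative consequences of badness, together with the standing assumptions. -/
structure Tight (σ K ε : ℝ) (X : Cell) : Prop where
  alg : X.Alg σ
  gen : X.Gen
  R_pos : 0 < X.R
  g_le : X.g ≤ K * X.b
  b_le : X.b ≤ K * X.g
  ne : X.b ≠ X.g
  small_Δ : 0 ≤ X.Δ → X.Δ ≤ ε * (X.l * X.L) ∨ X.Q ≤ ε * (X.l * X.L)
  small_PW : 0 ≤ X.P → X.P * X.W ≤ ε * (X.r * X.R) * X.A

variable {K ε : ℝ}

namespace Tight

theorem W_pos (h : X.Tight σ K ε) : 0 < X.W :=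
  add_pos_of_pos_of_nonneg (mul_pos h.alg.c_pos h.R_pos)
    (mul_nonneg h.alg.C_nonneg (r_pos h.alg).le)

theorem g_bounds_of_Δ_nonneg (h : X.Tight σ K ε) (hK : 1 ≤ K) (hΔ : 0 ≤ X.Δ) :
    X.g ≤ K ∧ 1 ≤ K * X.g := by
  have hg := h.alg.g_pos
  rcases slopes_of_Δ_nonneg h.alg hΔ with ⟨h1, h2⟩ | ⟨h1, h2⟩
  · exact ⟨h2.trans hK, h1.trans h.b_le⟩
  · refine ⟨h.g_le.trans ?_, ?_⟩ <;> nlinarith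

theorem b_bounds_of_Δ_nonneg (h : X.Tight σ K ε) (hK : 1 ≤ K) (hΔ : 0 ≤ X.Δ) :
    X.b ≤ K ∧ 1 ≤ K * X.b := by
  have hg := h.alg.b_pos
  rcases slopes_of_Δ_nonneg h.alg hΔ with ⟨h1, h2⟩ | ⟨h1, h2⟩
  · refine ⟨h.b_le.trans ?_, ?_⟩ <;> nlinarith
  · exact ⟨h1.trans hK, h2.trans h.g_le⟩

theorem a_bounds_of_P_nonneg (h : X.Tight σ K ε) (hK : 1 ≤ K) (hP : 0 ≤ X.P) :
    X.a ≤ K ∧ 1 ≤ K * X.a := by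
  have hA := A_pos h.alg
  have h1 := a_mul_A h.alg
  have h2 := X.A_eq_P_add
  have hW := h.W_pos
  have h3 := mul_le_mul_of_nonneg_right h.g_le hW.le
  have h4 := mul_le_mul_of_nonneg_right h.b_le hW.le
  have h5 : 0 ≤ (K - 1) * X.P := mul_nonneg (by linarith) hP
  constructor
  · have : X.a * X.A ≤ K * X.A := by rw [h1, h2]; linarith
    exact le_of_mul_le_mul_right this hA
  · have : 1 * X.A ≤ K * X.a * X.A := by
      rw [mul_assoc, h1]; rw [h2]; linarith
    exact le_of_mul_le_mul_right this hA

/-- If `P < 0` then the left branch is almost tangent to the break. -/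
theorem small_of_P_neg (h : X.Tight σ K ε) (hK : 1 ≤ K) (hε : 0 < ε) (hε' : 2 * K * ε ≤ 1)
    (hP : X.P < 0) :
    X.y < 0 ∧ -X.y ≤ K * ε * X.l ∧ X.Y ≤ K * ε * X.L := by
  have ha := h.alg
  have hy := y_neg_of_P_neg ha hP
  have hΔ := Δ_pos_of_y_neg ha hy
  have hr := r_pos ha
  have hl := ha.l_pos
  have hL := ha.L_pos
  have hY := ha.Y_pos
  have hb := h.b_bounds_of_Δ_nonneg hK hΔ.le
  refine ⟨hy, ?_⟩
  rcases h.small_Δ hΔ.le with h1 | h1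
  · have h2 := X.b_mul_Δ
    have h3 : X.b * X.Δ ≤ K * (ε * (X.l * X.L)) :=
      mul_le_mul hb.1 h1 hΔ.le (by linarith)
    have h4 := mul_pos hl hY
    have h5 := mul_pos hL (neg_pos.2 hy)
    constructor
    · have : X.L * -X.y ≤ X.L * (K * ε * X.l) := by linarith
      exact le_of_mul_le_mul_left this hL
    · have : X.l * X.Y ≤ X.l * (K * ε * X.L) := by linarith
      exact le_of_mul_le_mul_left this hl
  · exfalso
    have h2 : X.Z ≤ ε * X.L := by
      have : X.l * X.Z ≤ X.l * (ε * X.L) := by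
        have := mul_pos hL ha.z_pos
        simp only [Q] at h1; linarith
      exact le_of_mul_le_mul_left this hl
    have hC : X.C ≤ ε * X.L := by have := h.R_pos; simp only [Z] at h2; linarith
    have hR : X.R ≤ ε * X.L := by have := ha.C_nonneg; simp only [Z] at h2; linarith
    have hY2 : X.L ≤ 2 * X.Y := by
      have h3 : X.b * X.C ≤ K * (ε * X.L) := mul_le_mul hb.1 hC ha.C_nonneg (by linarith)
      have h4 := mul_le_mul_of_nonneg_right hε' hL.le
      simp only [Y]; linarith
    have h5 : -X.y < X.r := by
      have h6 := ha.rel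
      have h7 := mul_pos ha.a_pos hl
      have h8 := mul_pos ha.g_pos ha.z_pos
      simp only [r]; linarith
    have h6 : -X.y * X.R ≤ X.r * (ε * X.L) :=
      mul_le_mul h5.le hR h.R_pos.le hr.le
    have h7 : X.r * (2 * ε * X.L) ≤ X.r * X.L := by
      have : 2 * ε ≤ 1 := by nlinarith
      exact mul_le_mul_of_nonneg_left (by nlinarith) hr.le
    have h8 := mul_le_mul_of_nonneg_left hY2 hr.le
    simp only [P] at hP
    linarith

theorem a_bounds (h : X.Tight σ K ε) (hK : 1 ≤ K) (hε : 0 < ε) (hε' : 2 * K ^ 2 * ε ≤ 1) :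
    X.a ≤ 2 * K ∧ 1 ≤ 2 * K * X.a := by
  have hapos := h.alg.a_pos
  rcases le_or_gt 0 X.P with hP | hP
  · have := h.a_bounds_of_P_nonneg hK hP
    constructor <;> nlinarith
  have h1 : 2 * K * ε ≤ 1 := by
    nlinarith [mul_le_mul_of_nonneg_right hK (mul_pos (by linarith : 0 < K) hε).le]
  obtain ⟨h2, h3, -⟩ := h.small_of_P_neg hK hε h1 hP
  have hA := A_pos h.alg
  have e1 := a_mul_A h.alg
  have e2 := X.A_eq_P_add
  have hW := h.W_pos
  have hb := h.alg.b_pos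
  have hPA : -X.P ≤ K * ε * X.A := by
    have h4 := mul_le_mul_of_nonneg_right h3 h.R_pos.le
    have h5 := mul_pos h.alg.Y_pos (r_pos h.alg)
    have h6 : 0 ≤ K * ε * (X.L * X.r) := by
      have := h.alg.L_pos; have := r_pos h.alg; positivity
    simp only [P, A]; linarith
  have h3' := mul_le_mul_of_nonneg_right h.g_le hW.le
  have h4' := mul_le_mul_of_nonneg_right h.b_le hW.le
  have hKA : 0 ≤ (K - 1) * X.A := mul_nonneg (by linarith) hA.le
  have hKP : K * -X.P ≤ K ^ 2 * ε * X.A := by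
    have := mul_le_mul_of_nonneg_left hPA (by linarith : 0 ≤ K)
    linarith
  have h2A := mul_le_mul_of_nonneg_right hε' hA.le
  have hPP : 0 ≤ (K - 1) * -X.P := mul_nonneg (by linarith) (by linarith)
  constructor
  · have : X.a * X.A ≤ 2 * K * X.A := by
      have e3 : K * X.b * X.W = K * X.A + K * -X.P := by linear_combination -K * e2
      rw [e1]; linarith
    exact le_of_mul_le_mul_right this hA
  · have : 1 * X.A ≤ 2 * K * X.a * X.A := by
      rw [mul_assoc (2 * K), e1]; linarith
    exact le_of_mul_le_mul_right this hA

end Tight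

theorem moveTwo_Δ : X.moveTwo.Δ = X.a * X.Δ + X.W := by
  simp only [Δ, moveTwo_y, moveTwo_Y, W]; simp only [moveTwo]; ring

/-- Bounds on the slope `g` persist along the renormalization. -/
theorem Tight.g_bounds_step {G : ℝ} (h : X.Tight σ K ε) (h' : X.step.Tight σ K ε) (hK : 1 ≤ K)
    (hε : 0 < ε) (hε' : 2 * K ^ 2 * ε ≤ 1) (hG : 2 * K ^ 2 ≤ G)
    (hg : (X.a * X.l < X.z ∨ X.r < X.a * X.l) → X.g ≤ G ∧ 1 ≤ G * X.g) :
    X.step.g ≤ G ∧ 1 ≤ G * X.step.g := by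
  have hKG : K ≤ G := by nlinarith
  have hG1 : 1 ≤ G := hK.trans hKG
  rcases le_or_gt 0 X.step.Δ with hΔ | hΔ
  · have := h'.g_bounds_of_Δ_nonneg hK hΔ
    have := h'.alg.g_pos
    constructor <;> nlinarith
  rcases step_cases h.alg h.gen with ⟨h1, h2⟩ | ⟨h1, h2⟩ | ⟨h1, h3, h2⟩
  · rw [h2]; exact hg (Or.inl h1)
  · have hg := hg (Or.inr h1)
    have hs := slopes_of_Δ_neg h'.alg h'.ne hΔ
    rw [h2] at hΔ hs ⊢
    rw [moveTwo_Δ] at hΔ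
    have hW := h.W_pos
    have hapos := h.alg.a_pos
    have hgpos := h.alg.g_pos
    have hΔ' : X.Δ < 0 := by
      by_contra! h0
      have := mul_nonneg hapos.le h0
      linarith
    have hP := P_pos_of_y_pos h.alg (y_pos_of_Δ_neg h.alg hΔ')
    have hA := A_pos h.alg
    have e1 := a_mul_A h.alg
    have e2 := X.A_eq_P_add
    simp only [moveTwo] at hs ⊢
    rcases hs with ⟨s1, s2⟩ | ⟨s1, s2⟩
    · have hbg : X.g < X.b := lt_of_mul_lt_mul_left s2 hapos.le
      have ha1 : X.a ≤ 1 := by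
        have : X.a * X.A ≤ 1 * X.A := by
          have := mul_lt_mul_of_pos_right hbg hW
          linarith
        exact le_of_mul_le_mul_right this hA
      constructor <;> nlinarith
    · have hbg : X.b < X.g := lt_of_mul_lt_mul_left s1 hapos.le
      have ha1 : 1 ≤ X.a := by
        have : 1 * X.A ≤ X.a * X.A := by
          have := mul_lt_mul_of_pos_right hbg hW
          linarith
        exact le_of_mul_le_mul_right this hA
      constructor
      · linarith
      · have : X.g ≤ X.a * X.g := by nlinarith
        nlinarith
  · have hΔ0 : 0 ≤ X.Δ := by
      by_contra! h0
      have hy := y_pos_of_Δ_neg h.alg h0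
      have hy' : X.step.y < 0 := by
        rw [h2, moveThree_y h.alg.a_pos.ne' h.alg.rel]; linarith
      exact (Δ_pos_of_y_neg h'.alg hy').not_gt hΔ
    rw [h2]
    simp only [moveThree]
    obtain ⟨a1, a2⟩ := h.a_bounds hK hε hε'
    obtain ⟨b1, b2⟩ := h.b_bounds_of_Δ_nonneg hK hΔ0
    have ha := h.alg.a_pos
    have hb := h.alg.b_pos
    constructor
    · have := mul_le_mul a1 b1 hb.le (by linarith)
      nlinarith
    · have h5 : 1 * 1 ≤ (2 * K * X.a) * (K * X.b) :=
        mul_le_mul a2 b2 (by norm_num) (by positivity)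
      have h6 := mul_le_mul_of_nonneg_right hG (mul_pos ha hb).le
      nlinarith

/-- Dichotomy for a cell whose next move is not the first one. -/
theorem Tight.dichotomy {G : ℝ} (h : X.Tight σ K ε) (hK : 1 ≤ K) (hKG : K ≤ G)
    (hε : 0 < ε) (hε' : 4 * G * ε ≤ 1) (ha : X.a ≤ G)
    (hb : X.b ≤ G) (hb' : 1 ≤ G * X.b) (hz : X.z < X.a * X.l) :
    (X.c ≤ 2 * ε * X.r ∧ X.C ≤ 2 * ε * X.R) ∨
      (|X.y| ≤ 5 * G ^ 2 * ε * X.l ∧ X.Y ≤ 5 * G ^ 2 * ε * X.L ∧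
        X.y ≤ 5 * G ^ 2 * ε * X.r) := by
  have hG : 1 ≤ G := hK.trans hKG
  have hr := r_pos h.alg
  have hl := h.alg.l_pos
  have hL := h.alg.L_pos
  have hY := h.alg.Y_pos
  have hR := h.R_pos
  have hW := h.W_pos
  have hA := A_pos h.alg
  have hC := h.alg.C_nonneg
  have hc := h.alg.c_pos
  have e2 := X.A_eq_P_add
  have hG2 : G ≤ G ^ 2 := by nlinarith
  have hGε : G * ε ≤ G ^ 2 * ε := mul_le_mul_of_nonneg_right hG2 hε.le
  have hlR := mul_pos hl hR
  have hLr := mul_pos hL hr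
  rcases lt_or_ge X.P 0 with hP | hP
  · right
    obtain ⟨h1, h2, h3⟩ := h.small_of_P_neg hK hε (by nlinarith) hP
    have hk : K * ε ≤ 5 * G ^ 2 * ε := by
      have := mul_le_mul_of_nonneg_right hKG hε.le
      nlinarith [mul_pos hε hε]
    rw [abs_of_neg h1]
    refine ⟨h2.trans ?_, h3.trans ?_, ?_⟩
    · exact mul_le_mul_of_nonneg_right hk hl.le
    · exact mul_le_mul_of_nonneg_right hk hL.le
    · have : 0 ≤ 5 * G ^ 2 * ε * X.r := by positivity
      linarith
  have hPW := h.small_PW hP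
  have hrR : X.r * X.R ≤ 2 * G * X.A := by
    have h1 : X.W ≤ G * X.A := by
      have h2 := mul_le_mul_of_nonneg_right hb' hW.le
      have h3 : G * (X.b * X.W) ≤ G * X.A := mul_le_mul_of_nonneg_left (by linarith) (by linarith)
      linarith
    have h2 : X.a * X.l * X.R ≤ G * X.A := by
      have h3 : X.a * (X.l * X.R) ≤ G * X.A :=
        mul_le_mul ha (by simp only [A]; linarith) hlR.le (by linarith)
      linarith
    have h3 : X.r * X.R ≤ X.W + X.a * X.l * X.R := by
      have h4 := mul_le_mul_of_nonneg_right hz.le hR.le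
      have h5 := mul_nonneg hC hr.le
      simp only [W]; simp only [r] at h5 ⊢; linarith
    linarith
  rcases le_or_gt (X.A / 2) X.P with hPA | hPA
  · left
    have h1 : X.W ≤ 2 * ε * (X.r * X.R) := by
      have h2 := mul_le_mul_of_nonneg_right hPA hW.le
      have : X.A * X.W ≤ X.A * (2 * ε * (X.r * X.R)) := by linarith
      exact le_of_mul_le_mul_left this hA
    constructor
    · have : X.c * X.R ≤ 2 * ε * X.r * X.R := by
        have := mul_nonneg hC hr.le
        simp only [W] at h1; linarith
      exact le_of_mul_le_mul_right this hR
    · have : X.C * X.r ≤ 2 * ε * X.R * X.r := by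
        have := mul_pos hc hR
        simp only [W] at h1; linarith
      exact le_of_mul_le_mul_right this hr
  right
  have hAW : X.A ≤ 2 * G * X.W := by
    have := mul_le_mul_of_nonneg_right hb hW.le
    linarith
  have hP1 : X.P ≤ 2 * G * ε * (X.r * X.R) := by
    have h1 : X.P * X.W ≤ 2 * G * ε * (X.r * X.R) * X.W := by
      have := mul_le_mul_of_nonneg_left hAW (by positivity : 0 ≤ ε * (X.r * X.R))
      linarith
    exact le_of_mul_le_mul_right h1 hW
  have hP2 : X.P ≤ 4 * G ^ 2 * ε * X.A := by
    have := mul_le_mul_of_nonneg_left hrR (by positivity : 0 ≤ 2 * G * ε)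
    linarith
  rcases lt_or_ge X.Δ 0 with hΔ | hΔ
  · have hy := y_pos_of_Δ_neg h.alg hΔ
    have hyr : X.y ≤ 2 * G * ε * X.r := by
      have : X.y * X.R ≤ 2 * G * ε * X.r * X.R := by
        have := mul_pos hY hr
        simp only [P] at hP1; linarith
      exact le_of_mul_le_mul_right this hR
    have hrl : X.r ≤ 2 * G * X.l := by
      have h1 : X.c ≤ G * X.l := by
        have h2 := mul_le_mul_of_nonneg_right hb' hc.le
        have h3 : G * (X.b * X.c) ≤ G * X.l := by
          apply mul_le_mul_of_nonneg_left _ (by linarith)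
          simp only [y] at hy; linarith
        linarith
      have h2 := mul_le_mul_of_nonneg_right ha hl.le
      simp only [r]; linarith
    have hyl : X.y ≤ 4 * G ^ 2 * ε * X.l := by
      have := mul_le_mul_of_nonneg_left hrl (by positivity : 0 ≤ 2 * G * ε)
      linarith
    have hYL : X.Y ≤ 4 * G ^ 2 * ε * X.L := by
      have h1 := X.b_mul_Δ
      have h2 := mul_pos h.alg.b_pos (neg_pos.2 hΔ)
      have h3 := mul_le_mul_of_nonneg_left hyl hL.le
      have : X.l * X.Y ≤ X.l * (4 * G ^ 2 * ε * X.L) := by linarith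
      exact le_of_mul_le_mul_left this hl
    have p1 : 0 ≤ G ^ 2 * ε * X.l := by positivity
    have p2 : 0 ≤ G ^ 2 * ε * X.L := by positivity
    have p3 : G * ε * X.r ≤ G ^ 2 * ε * X.r := mul_le_mul_of_nonneg_right hGε hr.le
    have p4 : 0 ≤ G ^ 2 * ε * X.r := by positivity
    rw [abs_of_pos hy]
    refine ⟨by linarith, by linarith, by linarith⟩
  rcases h.small_Δ hΔ with h1 | h1
  · have hbΔ : X.b * X.Δ ≤ G * (ε * (X.l * X.L)) := mul_le_mul hb h1 hΔ (by linarith)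
    have hbΔ0 := mul_nonneg h.alg.b_pos.le hΔ
    have eY := X.Y_mul_A
    have ey := X.y_mul_A
    have p1 : G * ε * (X.l * X.A) ≤ G ^ 2 * ε * (X.l * X.A) :=
      mul_le_mul_of_nonneg_right hGε (by positivity)
    have p2 : G * ε * (X.L * X.A) ≤ G ^ 2 * ε * (X.L * X.A) :=
      mul_le_mul_of_nonneg_right hGε (by positivity)
    have p3 : G * ε * (X.r * X.A) ≤ G ^ 2 * ε * (X.r * X.A) :=
      mul_le_mul_of_nonneg_right hGε (by positivity)
    have q1 : 0 ≤ G ^ 2 * ε * (X.l * X.A) := by positivity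
    have q3 : 0 ≤ G ^ 2 * ε * (X.r * X.A) := by positivity
    have hPl := mul_le_mul_of_nonneg_right hP2 hl.le
    have hPL := mul_le_mul_of_nonneg_right hP2 hL.le
    have hbr := mul_le_mul_of_nonneg_right hbΔ hr.le
    have hbR := mul_le_mul_of_nonneg_right hbΔ hR.le
    have hbr0 := mul_nonneg hbΔ0 hr.le
    have hPl1 := mul_le_mul_of_nonneg_right hP1 hl.le
    have hLrA : X.L * X.r ≤ X.A := by simp only [A]; linarith
    have hlRA : X.l * X.R ≤ X.A := by simp only [A]; linarith
    have s1 : G * ε * X.l * (X.L * X.r) ≤ G * ε * X.l * X.A :=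
      mul_le_mul_of_nonneg_left hLrA (by positivity)
    have s2 : G * ε * X.L * (X.l * X.R) ≤ G * ε * X.L * X.A :=
      mul_le_mul_of_nonneg_left hlRA (by positivity)
    have s3 : G * ε * X.r * (X.l * X.R) ≤ G * ε * X.r * X.A :=
      mul_le_mul_of_nonneg_left hlRA (by positivity)
    have hPl0 := mul_nonneg hP hl.le
    refine ⟨?_, ?_, ?_⟩
    · rw [abs_le]
      constructor
      · apply le_of_mul_le_mul_right _ hA
        rw [ey]; linarith
      · apply le_of_mul_le_mul_right _ hA
        rw [ey]; linarith
    · apply le_of_mul_le_mul_right _ hA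
      rw [eY]; linarith
    · apply le_of_mul_le_mul_right _ hA
      rw [ey]; linarith
  · exfalso
    have h2 : X.Z ≤ ε * X.L := by
      have : X.l * X.Z ≤ X.l * (ε * X.L) := by
        have := mul_pos hL h.alg.z_pos
        simp only [Q] at h1; linarith
      exact le_of_mul_le_mul_left this hl
    have h3 : X.W ≤ ε * X.A := by
      have h4 := mul_le_mul_of_nonneg_left h2 hr.le
      have h5 := mul_pos h.alg.z_pos hR
      have h6 := mul_pos hε hlR
      rw [W_eq]; simp only [A]; linarith
    have h4 : 2 * G * X.W ≤ 2 * G * (ε * X.A) := mul_le_mul_of_nonneg_left h3 (by linarith)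
    have h5 := mul_le_mul_of_nonneg_right hε' hA.le
    linarith

end Cell

namespace Cell

/-- Two cells with the same left branch and the same break. -/
structure SameLeft (X X' : Cell) : Prop where
  l : X'.l = X.l
  c : X'.c = X.c
  b : X'.b = X.b
  L : X'.L = X.L
  C : X'.C = X.C

namespace SameLeft

variable {X X' X'' : Cell}

theorem y (h : SameLeft X X') : X'.y = X.y := by simp only [Cell.y, h.l, h.b, h.c]

theorem trans (h : SameLeft X X') (h' : SameLeft X' X'') : SameLeft X X'' :=
  ⟨h'.l.trans h.l, h'.c.trans h.c, h'.b.trans h.b, h'.L.trans h.L, h'.C.trans h.C⟩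

end SameLeft

variable {σ K ε : ℝ} {X : ℕ → Cell}

theorem exists_sameLeft_lt (hX : ∀ n, (X n).Tight σ K ε) (hs : ∀ n, X (n + 1) = (X n).step)
    (hK : 1 ≤ K) (hε : 0 < ε) (hε' : 2 * K ^ 2 * ε ≤ 1) (n : ℕ) :
    ∃ m, n ≤ m ∧ SameLeft (X n) (X m) ∧ (X m).z < (X m).a * (X m).l := by
  by_contra! hcon
  have key : ∀ k : ℕ, SameLeft (X n) (X (n + k)) ∧
      (X (n + k)).r ≤ (X n).r - k * ((X n).l / (2 * K)) := by
    intro k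
    induction k with
    | zero => exact ⟨⟨rfl, rfl, rfl, rfl, rfl⟩, by simp⟩
    | succ k ih =>
      have h1 : (X (n + k)).a * (X (n + k)).l < (X (n + k)).z :=
        lt_of_le_of_ne (hcon _ (by omega) ih.1) (hX _).gen.ne_z
      have h2 : X (n + (k + 1)) = (X (n + k)).moveOne := by
        rw [← add_assoc, hs, step_eq_moveOne (hX _).alg h1]
      rw [h2]
      refine ⟨ih.1.trans ⟨rfl, rfl, rfl, rfl, rfl⟩, ?_⟩
      rw [moveOne_r]
      have h3 := ((hX (n + k)).a_bounds hK hε hε').2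
      have h4 : (X n).l / (2 * K) ≤ (X (n + k)).a * (X (n + k)).l := by
        rw [div_le_iff₀ (by linarith), ih.1.l]
        have := mul_le_mul_of_nonneg_right h3 (hX n).alg.l_pos.le
        linarith
      have := ih.2
      push_cast
      linarith
  have hpos : 0 < (X n).l / (2 * K) := div_pos (hX n).alg.l_pos (by linarith)
  obtain ⟨k, hk⟩ := Archimedean.arch (X n).r hpos
  have h1 := (key k).2
  have h2 := r_pos (hX (n + k)).alg
  rw [nsmul_eq_mul] at hk
  linarith

theorem exists_moveThree (hX : ∀ n, (X n).Tight σ K ε) (hs : ∀ n, X (n + 1) = (X n).step)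
    (hK : 1 ≤ K) (hε : 0 < ε) (hε' : 2 * K ^ 2 * ε ≤ 1) (n : ℕ) :
    ∃ m, n ≤ m ∧ (X m).z < (X m).a * (X m).l ∧ (X m).a * (X m).l < (X m).r := by
  obtain ⟨G, hG, hgG⟩ : ∃ G, 2 * K ^ 2 ≤ G ∧ ∀ m, (X m).g ≤ G ∧ 1 ≤ G * (X m).g := by
    have hg0 := (hX 0).alg.g_pos
    refine ⟨max (2 * K ^ 2) (max (X 0).g (1 / (X 0).g)), le_max_left _ _, fun m => ?_⟩
    induction m with
    | zero =>
      refine ⟨(le_max_left _ _).trans (le_max_right _ _), ?_⟩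
      rw [← div_le_iff₀ hg0]
      exact (le_max_right _ _).trans (le_max_right _ _)
    | succ m ih =>
      have h1 := hX (m + 1)
      rw [hs] at h1 ⊢
      exact (hX m).g_bounds_step h1 hK hε hε' (le_max_left _ _) fun _ => ih
  by_contra! hcon
  have hKG : 0 < K * G := by nlinarith
  have hb : ∀ m, 1 / (K * G) ≤ (X m).b := fun m => by
    rw [div_le_iff₀ hKG]
    have h1 := (hgG m).2
    have h2 := mul_le_mul_of_nonneg_left (hX m).g_le (by nlinarith : 0 ≤ G)
    linarith
  have hc : ∀ k : ℕ, (X (n + k)).c = (X n).c := by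
    intro k
    induction k with
    | zero => rfl
    | succ k ih =>
      rw [← add_assoc, hs]
      rcases step_cases (hX (n + k)).alg (hX (n + k)).gen with ⟨_, h2⟩ | ⟨_, h2⟩ | ⟨h1, h3, _⟩
      · rw [h2]; exact ih
      · rw [h2]; exact ih
      · exact absurd h3 (hcon _ (by omega) h1).not_gt
  have hpos : 0 < 1 / (K * G) * (X n).c :=
    mul_pos (div_pos one_pos hKG) (hX n).alg.c_pos
  have key : ∀ k : ℕ, ∃ m, n ≤ m ∧ (X m).l ≤ (X n).l - k * (1 / (K * G) * (X n).c) := by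
    intro k
    induction k with
    | zero => exact ⟨n, le_rfl, by simp⟩
    | succ k ih =>
      obtain ⟨m, hm, hl⟩ := ih
      obtain ⟨m', hm', hsame, hz⟩ := exists_sameLeft_lt hX hs hK hε hε' m
      have hr := lt_of_le_of_ne (hcon m' (by omega) hz) (hX m').gen.ne_r.symm
      refine ⟨m' + 1, by omega, ?_⟩
      rw [hs, step_eq_moveTwo hr]
      have h1 := moveTwo_cut (hX m').alg.rel
      have h2 := mul_pos (hX m').alg.g_pos (hX m').alg.z_pos
      have h3 : 1 / (K * G) * (X n).c ≤ (X m').b * (X m').c := by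
        obtain ⟨i, rfl⟩ := Nat.exists_eq_add_of_le (hm.trans hm')
        rw [hc i]
        exact mul_le_mul_of_nonneg_right (hb _) (hX n).alg.c_pos.le
      rw [hsame.l] at h1
      push_cast
      linarith
  obtain ⟨k, hk⟩ := Archimedean.arch (X n).l hpos
  obtain ⟨m, _, h1⟩ := key k
  have h2 := (hX m).alg.l_pos
  rw [nsmul_eq_mul] at hk
  linarith

theorem false_of_tight_of_bounds {G : ℝ} (hX : ∀ n, (X n).Tight σ K ε)
    (hs : ∀ n, X (n + 1) = (X n).step)
    (hK : 1 ≤ K) (hKG : 2 * K ^ 3 ≤ G) (hε : 0 < ε) (hε' : 100 * G ^ 3 * ε ≤ 1)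
    (hbG : ∀ n, (X n).b ≤ G) (hbG' : ∀ n, 1 ≤ G * (X n).b) : False := by
  have hK2 : K ≤ K ^ 2 := by nlinarith
  have hK3 : K ^ 2 ≤ K ^ 3 := by nlinarith [sq_nonneg K]
  have hG2 : 2 ≤ G := by linarith
  have hGG : 2 * G ≤ G ^ 2 := by nlinarith
  have hGGG : 2 * G ^ 2 ≤ G ^ 3 := by nlinarith [sq_nonneg G]
  have hGε2 : 2 * (G ^ 2 * ε) ≤ G ^ 3 * ε := by nlinarith
  have hGε1 : 2 * (G * ε) ≤ G ^ 2 * ε := by nlinarith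
  have hGε0 : 2 * ε ≤ G * ε := by nlinarith
  have hεK : 2 * K ^ 2 * ε ≤ 1 := by nlinarith
  have haG : ∀ n, (X n).a ≤ G := fun n => ((hX n).a_bounds hK hε hεK).1.trans (by linarith)
  have haG' : ∀ n, 1 ≤ G * (X n).a := fun n => by
    have h1 := ((hX n).a_bounds hK hε hεK).2
    have := mul_le_mul_of_nonneg_right (by linarith : 2 * K ≤ G) (hX n).alg.a_pos.le
    linarith
  have dich : ∀ n, (X n).z < (X n).a * (X n).l →
      ((X n).c ≤ 2 * ε * (X n).r ∧ (X n).C ≤ 2 * ε * (X n).R) ∨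
      (|(X n).y| ≤ 5 * G ^ 2 * ε * (X n).l ∧ (X n).Y ≤ 5 * G ^ 2 * ε * (X n).L ∧
        (X n).y ≤ 5 * G ^ 2 * ε * (X n).r) := fun n hn =>
    (hX n).dichotomy hK (by linarith) hε (by linarith) (haG n) (hbG n) (hbG' n) hn
  have next := exists_sameLeft_lt hX hs hK hε hεK
  -- the first alternative of the dichotomy forces the second move
  have first_two : ∀ n, (X n).z < (X n).a * (X n).l →
      (X n).c ≤ 2 * ε * (X n).r → (X n).r < (X n).a * (X n).l := by
    intro n hz hc
    by_contra! hr
    have hr := lt_of_le_of_ne hr (hX n).gen.ne_r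
    have hstep : X (n + 1) = (X n).moveThree := by rw [hs, step_eq_moveThree hz hr]
    obtain ⟨m, -, hm, hmz⟩ := next (n + 1)
    have hl : (X m).l ≤ 2 * ε * (X n).r := by
      rw [hm.l, hstep]; simp only [moveThree]; simp only [r] at hc ⊢; linarith
    have hrpos := r_pos (hX n).alg
    have hcm : 3 / 4 * (X n).r ≤ G * (X m).c := by
      rw [hm.c, hstep]; simp only [moveThree]
      have h1 : 3 / 4 * (X n).r ≤ (X n).z := by
        have : ε * (X n).r ≤ 1 / 8 * (X n).r :=
          mul_le_mul_of_nonneg_right (by linarith) hrpos.le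
        simp only [r] at *; linarith
      have h2 : (X n).z ≤ G * ((X n).z / (X n).a) := by
        rw [← mul_div_assoc, le_div_iff₀ (hX n).alg.a_pos, mul_comm G]
        exact mul_le_mul_of_nonneg_left (haG n) (hX n).alg.z_pos.le
      linarith
    have hlpos := (hX m).alg.l_pos
    have hcpos := (hX m).alg.c_pos
    have hGl : G ^ 2 * (X m).l ≤ 2 * (G ^ 2 * ε) * (X n).r := by
      have := mul_le_mul_of_nonneg_left hl (by positivity : 0 ≤ G ^ 2)
      linarith
    have hsmall : 2 * (G ^ 2 * ε) * (X n).r ≤ 1 / 8 * (X n).r :=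
      mul_le_mul_of_nonneg_right (by linarith) hrpos.le
    rcases dich m hmz with ⟨h1, -⟩ | ⟨h1, -, -⟩
    · have h2 : (X m).z ≤ G * (X m).l :=
        hmz.le.trans (mul_le_mul_of_nonneg_right (haG m) hlpos.le)
      have h3 : (X m).c ≤ G * (X m).l := by
        have h4 : ε * (X m).r ≤ 1 / 4 * (X m).r :=
          mul_le_mul_of_nonneg_right (by linarith) (r_pos (hX m).alg).le
        simp only [r] at h1 h4; linarith
      have h4 := mul_le_mul_of_nonneg_left h3 (by linarith : 0 ≤ G)
      linarith
    · have h2 := (abs_le.1 h1).1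
      have h3 : 5 * G ^ 2 * ε * (X m).l ≤ 1 * (X m).l :=
        mul_le_mul_of_nonneg_right (by linarith) hlpos.le
      have h4 : (X m).b * (X m).c ≤ 2 * (X m).l := by simp only [y] at h2; linarith
      have h5 := mul_le_mul_of_nonneg_right (hbG' m) hcpos.le
      have h6 := mul_le_mul_of_nonneg_left h4 (by positivity : 0 ≤ G ^ 2)
      have h7 := mul_le_mul_of_nonneg_left h5 (by positivity : 0 ≤ G)
      linarith
  -- hence the first alternative never holds
  have second : ∀ n, (X n).z < (X n).a * (X n).l →
      (|(X n).y| ≤ 5 * G ^ 2 * ε * (X n).l ∧ (X n).y ≤ 5 * G ^ 2 * ε * (X n).r) := by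
    intro n hz
    rcases dich n hz with ⟨h1, h2⟩ | ⟨h1, h2, h3⟩
    swap
    · exact ⟨h1, h3⟩
    exfalso
    have after : ∀ k, (X k).r < (X k).a * (X k).l → (X k).C ≤ 2 * ε * (X k).R →
        (X (k + 1)).C ≤ 2 * ε * (X (k + 1)).L := by
      intro k hk hC
      rw [hs, step_eq_moveTwo hk]
      simp only [moveTwo]
      have := mul_pos hε (mul_pos (hX k).alg.a_pos (hX k).alg.L_pos)
      linarith
    have key : ∀ k : ℕ, (X (n + 1 + k)).C ≤ 2 * ε * (X (n + 1 + k)).L := by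
      intro k
      induction k with
      | zero => exact after n (first_two n hz h1) h2
      | succ k ih =>
        rw [← add_assoc]
        rcases lt_or_gt_of_ne (hX (n + 1 + k)).gen.ne_z with h3 | h3
        · rw [hs, step_eq_moveOne (hX _).alg h3]; exact ih
        · rcases dich _ h3 with ⟨h4, h5⟩ | ⟨-, h4, -⟩
          · exact after _ (first_two _ h3 h4) h5
          · exfalso
            have hL := (hX (n + 1 + k)).alg.L_pos
            have h5 := mul_le_mul (hbG (n + 1 + k)) ih (hX _).alg.C_nonneg (by linarith)
            have h6 : 5 * G ^ 2 * ε * (X (n + 1 + k)).L ≤ 1 / 4 * (X (n + 1 + k)).L :=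
              mul_le_mul_of_nonneg_right (by linarith) hL.le
            have h7 : 2 * (G * ε) * (X (n + 1 + k)).L ≤ 1 / 4 * (X (n + 1 + k)).L :=
              mul_le_mul_of_nonneg_right (by linarith) hL.le
            simp only [Y] at h4
            linarith
    obtain ⟨m, hm, hm1, hm2⟩ := exists_moveThree hX hs hK hε hεK (n + 1)
    obtain ⟨k, rfl⟩ := Nat.exists_eq_add_of_le hm
    rcases dich _ hm1 with ⟨h4, h5⟩ | ⟨-, h4, -⟩
    · exact (first_two _ hm1 h4).not_gt hm2
    · have ih := key k
      have hL := (hX (n + 1 + k)).alg.L_pos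
      have h5 := mul_le_mul (hbG (n + 1 + k)) ih (hX _).alg.C_nonneg (by linarith)
      have h6 : 5 * G ^ 2 * ε * (X (n + 1 + k)).L ≤ 1 / 4 * (X (n + 1 + k)).L :=
        mul_le_mul_of_nonneg_right (by linarith) hL.le
      have h7 : 2 * (G * ε) * (X (n + 1 + k)).L ≤ 1 / 4 * (X (n + 1 + k)).L :=
        mul_le_mul_of_nonneg_right (by linarith) hL.le
      simp only [Y] at h4
      linarith
  have y_small : ∀ n, |(X n).y| ≤ 5 * G ^ 2 * ε * (X n).l := by
    intro n
    obtain ⟨m, -, hm, hmz⟩ := next n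
    have := (second m hmz).1
    rwa [hm.y, hm.l] at this
  -- the second move never occurs
  have no_two : ∀ n, (X n).a * (X n).l < (X n).r := by
    intro n
    by_contra! hr
    have hr := lt_of_le_of_ne hr (hX n).gen.ne_r.symm
    have hz : (X n).z < (X n).a * (X n).l := by
      by_contra! h0
      exact (lt_r_of_lt_z (hX n).alg (lt_of_le_of_ne h0 (hX n).gen.ne_z)).not_gt hr
    have hrpos := r_pos (hX n).alg
    have key : ∀ k : ℕ, (X (n + 1 + k)).y ≤ -((X (n + 1 + k)).r / 2) := by
      intro k
      induction k with
      | zero =>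
        rw [add_zero, hs, step_eq_moveTwo hr, moveTwo_y, moveTwo_r]
        have h1 := (second n hz).2
        have h2 := mul_le_mul_of_nonneg_left h1 (hX n).alg.a_pos.le
        have h3 : (X n).a * (5 * G ^ 2 * ε * (X n).r) ≤ G * (5 * G ^ 2 * ε * (X n).r) :=
          mul_le_mul_of_nonneg_right (haG n) (by positivity)
        have h4 : 5 * (G ^ 3 * ε) * (X n).r ≤ 1 / 2 * (X n).r :=
          mul_le_mul_of_nonneg_right (by linarith) hrpos.le
        linarith
      | succ k ih =>
        have hrk := r_pos (hX (n + 1 + k)).alg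
        rcases lt_or_gt_of_ne (hX (n + 1 + k)).gen.ne_r with h2 | h2
        · exfalso
          have h3 := y_small (n + 1 + k)
          have h4 := (abs_le.1 h3).1
          have hl := (hX (n + 1 + k)).alg.l_pos
          have h5 := mul_le_mul_of_nonneg_right (haG' (n + 1 + k)) hl.le
          have h6 := mul_lt_mul_of_pos_left h2 (by linarith : 0 < G)
          have h7 := mul_le_mul_of_nonneg_left (by linarith : (X (n + 1 + k)).r ≤
            10 * G ^ 2 * ε * (X (n + 1 + k)).l) (by linarith : 0 ≤ G)
          have h8 : 10 * (G ^ 3 * ε) * (X (n + 1 + k)).l ≤ 1 * (X (n + 1 + k)).l :=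
            mul_le_mul_of_nonneg_right (by linarith) hl.le
          linarith
        · rw [← add_assoc, hs, step_eq_moveTwo h2, moveTwo_y, moveTwo_r]
          have := mul_pos (hX (n + 1 + k)).alg.a_pos (by linarith : 0 < -(X (n + 1 + k)).y)
          linarith
    obtain ⟨m, hm, hm1, hm2⟩ := exists_moveThree hX hs hK hε hεK (n + 1)
    obtain ⟨k, rfl⟩ := Nat.exists_eq_add_of_le hm
    have hrk := r_pos (hX (n + 1 + k)).alg
    have ih := key k
    have h3 := y_small (n + 1 + k)
    have h4 := (abs_le.1 h3).1
    have hl := (hX (n + 1 + k)).alg.l_pos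
    have h5 := mul_le_mul_of_nonneg_right (haG' (n + 1 + k)) hl.le
    have h6 := mul_lt_mul_of_pos_left hm2 (by linarith : 0 < G)
    have h7 := mul_le_mul_of_nonneg_left (by linarith : (X (n + 1 + k)).r ≤
      10 * G ^ 2 * ε * (X (n + 1 + k)).l) (by linarith : 0 ≤ G)
    have h8 : 10 * (G ^ 3 * ε) * (X (n + 1 + k)).l ≤ 1 * (X (n + 1 + k)).l :=
      mul_le_mul_of_nonneg_right (by linarith) hl.le
    linarith
  -- so the total length decreases at least linearly
  have hy0 : 0 < |(X 0).y| := abs_pos.2 (hX 0).gen.y_ne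
  have key : ∀ k : ℕ, |(X k).y| = |(X 0).y| ∧
      (X k).l + (X k).r ≤ (X 0).l + (X 0).r - k * (|(X 0).y| / G) := by
    intro k
    induction k with
    | zero => simp
    | succ k ih =>
      have hcut : |(X 0).y| / G ≤ (X k).a * (X k).l := by
        have hl := (hX k).alg.l_pos
        have h1 := y_small k
        rw [ih.1] at h1
        have h2 : 5 * G ^ 2 * ε * (X k).l ≤ 1 * (X k).l :=
          mul_le_mul_of_nonneg_right (by linarith) hl.le
        have h3 := mul_le_mul_of_nonneg_right (haG' k) hl.le
        rw [div_le_iff₀ (by linarith)]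
        linarith
      rw [hs]
      have := ih.2
      rcases step_cases (hX k).alg (hX k).gen with ⟨_, h2⟩ | ⟨h1, _⟩ | ⟨_, _, h2⟩
      · rw [h2, moveOne_r, moveOne_y]
        refine ⟨ih.1, ?_⟩
        simp only [moveOne]
        push_cast
        linarith
      · exact absurd h1 (no_two k).not_gt
      · rw [h2, moveThree_r, moveThree_y (hX k).alg.a_pos.ne' (hX k).alg.rel, abs_neg]
        refine ⟨ih.1, ?_⟩
        simp only [moveThree]
        push_cast
        linarith
  obtain ⟨k, hk⟩ := Archimedean.arch ((X 0).l + (X 0).r)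
    (div_pos hy0 (by linarith : 0 < G))
  have h1 := (key k).2
  have h2 := (hX k).alg.l_pos
  have h3 := r_pos (hX k).alg
  rw [nsmul_eq_mul] at hk
  linarith

theorem false_of_tight (hX : ∀ n, (X n).Tight σ K ε) (hs : ∀ n, X (n + 1) = (X n).step)
    (hK : 1 ≤ K) (hε : 0 < ε) (hε' : 100 * (2 * K ^ 3) ^ 3 * ε ≤ 1) : False := by
  have hK2 : K ≤ K ^ 2 := by nlinarith
  have hεK : 2 * K ^ 2 * ε ≤ 1 := by
    have : K ^ 2 ≤ K ^ 9 := pow_le_pow_right₀ hK (by norm_num)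
    nlinarith
  obtain ⟨m, -, hz, hr⟩ := exists_moveThree hX hs hK hε hεK 0
  have hg : ∀ k : ℕ, (X (m + 1 + k)).g ≤ 2 * K ^ 2 ∧ 1 ≤ 2 * K ^ 2 * (X (m + 1 + k)).g := by
    intro k
    induction k with
    | zero =>
      have h1 := hX (m + 1)
      rw [add_zero]
      rw [hs] at h1 ⊢
      refine (hX m).g_bounds_step h1 hK hε hεK le_rfl fun h => ?_
      rcases h with h | h
      · exact absurd h hz.not_gt
      · exact absurd h hr.not_gt
    | succ k ih =>
      have h1 := hX (m + 1 + k + 1)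
      rw [← add_assoc]
      rw [hs] at h1 ⊢
      exact (hX _).g_bounds_step h1 hK hε hεK le_rfl fun _ => ih
  refine false_of_tight_of_bounds (X := fun k => X (m + 1 + k)) (G := 2 * K ^ 3)
    (fun k => hX _) (fun k => hs _) hK le_rfl hε hε' (fun k => ?_) (fun k => ?_)
  · have := mul_le_mul_of_nonneg_left (hg k).1 (by linarith : 0 ≤ K)
    have := (hX (m + 1 + k)).b_le
    linarith
  · have := mul_le_mul_of_nonneg_left (hX (m + 1 + k)).g_le (by positivity : 0 ≤ 2 * K ^ 2)
    have := (hg k).2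
    linarith

/-- There is a size `η` such that no infinite renormalization sequence is bad for `η`. -/
theorem exists_not_bad (hσ : 0 < σ) (hσ1 : σ ≠ 1) :
    ∃ η : ℝ, 0 < η ∧ η < 1 ∧ ∀ X : ℕ → Cell, (∀ n, (X n).Alg σ) → (∀ n, (X n).Gen) →
      (∀ n, 0 < (X n).R) → (∀ n, X (n + 1) = (X n).step) → ∃ n, ¬ (X n).Bad η := by
  obtain ⟨K, hK, hσK, hσK'⟩ : ∃ K : ℝ, 1 ≤ K ∧ σ ≤ K ∧ 1 ≤ K * σ := by
    refine ⟨max 1 (max σ (1 / σ)), le_max_left _ _,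
      (le_max_left _ _).trans (le_max_right _ _), ?_⟩
    rw [← div_le_iff₀ hσ]
    exact (le_max_right _ _).trans (le_max_right _ _)
  have hκ : 0 < |1 - σ| / K := div_pos (abs_pos.2 (sub_ne_zero.2 hσ1.symm)) (by linarith)
  set κ := |1 - σ| / K with hκdef
  set ε : ℝ := 1 / (100 * (2 * K ^ 3) ^ 3) with hεdef
  have hε : 0 < ε := by positivity
  obtain ⟨η, hη, hη2, hη3, hη4⟩ :
      ∃ η : ℝ, 0 < η ∧ η ≤ 1 / 2 ∧ 2 * η * K ≤ κ * ε ∧ 2 * η ≤ κ * ε := by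
    refine ⟨min (1 / 2) (κ * ε / (2 * K)), by positivity, min_le_left _ _, ?_, ?_⟩
    · have := min_le_right (1 / 2) (κ * ε / (2 * K))
      rw [le_div_iff₀ (by linarith)] at this
      linarith
    · have h1 : κ * ε / (2 * K) ≤ κ * ε / 2 := by
        apply div_le_div_of_nonneg_left (by positivity) (by norm_num) (by linarith)
      have := min_le_right (1 / 2) (κ * ε / (2 * K))
      linarith
  refine ⟨η, hη, by linarith, fun X hA hG hR hs => ?_⟩
  by_contra! hbad
  refine false_of_tight (X := X) (σ := σ) (K := K) (ε := ε) (fun n => ?_) hs hK hε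
    (by rw [hεdef]; field_simp; exact le_rfl)
  have alg := hA n
  have hb := alg.b_pos
  have hg := alg.g_pos
  have g_le : (X n).g ≤ K * (X n).b := by
    rcases alg.slope with h | h
    · rw [h]; exact mul_le_mul_of_nonneg_right hσK hb.le
    · rw [h]; nlinarith
  have b_le : (X n).b ≤ K * (X n).g := by
    rcases alg.slope with h | h
    · rw [h]; nlinarith
    · rw [h]; exact mul_le_mul_of_nonneg_right hσK hg.le
  have hdiff : κ * (X n).b ≤ |(X n).b - (X n).g| ∧ κ * (X n).g ≤ |(X n).b - (X n).g| := by
    have hσ0 := abs_nonneg (1 - σ)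
    rw [hκdef, div_mul_eq_mul_div, div_mul_eq_mul_div, div_le_iff₀ (by linarith),
      div_le_iff₀ (by linarith)]
    rcases alg.slope with h | h
    · have h1 : |(X n).b - (X n).g| = |1 - σ| * (X n).b := by
        rw [h, ← abs_of_pos hb, ← abs_mul, abs_of_pos hb]; ring_nf
      rw [h1]
      constructor
      · nlinarith [mul_nonneg hσ0 hb.le]
      · nlinarith [mul_le_mul_of_nonneg_left g_le hσ0]
    · have h1 : |(X n).b - (X n).g| = |1 - σ| * (X n).g := by
        rw [abs_sub_comm, h, ← abs_of_pos hg, ← abs_mul, abs_of_pos hg]; ring_nf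
      rw [h1]
      constructor
      · nlinarith [mul_le_mul_of_nonneg_left b_le hσ0]
      · nlinarith [mul_nonneg hσ0 hg.le]
  have hne : (X n).b ≠ (X n).g := by
    intro h
    rw [h, sub_self, abs_zero] at hdiff
    nlinarith [hdiff.2]
  have hl := alg.l_pos
  have hL := alg.L_pos
  refine ⟨alg, hG n, hR n, g_le, b_le, hne, fun hΔ => ?_, fun hP => ?_⟩
  · have h1 := (hbad n).1 hΔ
    have hQ := Q_pos alg
    have hid := b_sub_one_mul_Δ alg
    have hslopes := slopes_of_Δ_nonneg alg hΔ
    have hbK : 1 ≤ K * (X n).b := by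
      rcases hslopes with ⟨h2, h3⟩ | ⟨h2, h3⟩
      · nlinarith
      · linarith
    have hYC : (X n).Y + (X n).C ≤ K * (X n).L := by
      have hY := alg.Y_pos
      have hC := alg.C_nonneg
      have h2 := mul_le_mul_of_nonneg_right hbK hC
      have h3 := mul_nonneg (by linarith : 0 ≤ K - 1) hY.le
      simp only [Y] at *
      linarith
    have h2 : η * ((X n).Y + (X n).C) * (X n).l ≤ η * K * ((X n).l * (X n).L) := by
      have := mul_le_mul_of_nonneg_left hYC (mul_pos hη hl).le
      linarith
    have hQ' : |(X n).b - 1| * (X n).Δ = |1 - (X n).g| * (X n).Q := by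
      have h3 := congrArg abs hid
      rwa [abs_mul, abs_mul, abs_of_nonneg hΔ, abs_of_pos hQ] at h3
    have hsum : κ ≤ |(X n).b - 1| + |1 - (X n).g| := by
      have h3 := abs_add_le ((X n).b - 1) (1 - (X n).g)
      have h4 : (X n).b - 1 + (1 - (X n).g) = (X n).b - (X n).g := by ring
      rw [h4] at h3
      rcases hslopes with ⟨h5, -⟩ | ⟨-, h5⟩
      · nlinarith [hdiff.1]
      · nlinarith [hdiff.2]
    have hlL := mul_pos hl hL
    have h3 : 2 * (η * K * ((X n).l * (X n).L)) ≤ κ * (ε * ((X n).l * (X n).L)) := by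
      have := mul_le_mul_of_nonneg_right hη3 hlL.le
      linarith
    by_contra! hcon
    rcases le_total (κ / 2) |(X n).b - 1| with h4 | h4
    · have := mul_le_mul_of_nonneg_right h4 hΔ
      nlinarith [hcon.1]
    · have h5 : κ / 2 ≤ |1 - (X n).g| := by linarith
      have := mul_le_mul_of_nonneg_right h5 hQ.le
      nlinarith [hcon.2]
  · have h1 := (hbad n).2 hP
    have hApos := A_pos alg
    have hW := W_nonneg alg
    have hr := r_pos alg
    have hid := one_sub_ratio alg hApos.ne'
    set ρ := 1 - (X n).a * (X n).b / (X n).g with hρ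
    have h2 : η * (X n).r * ((X n).R + ρ * (X n).C) ≤
        η * (X n).r * (X n).R + 1 / 2 * (|ρ| * (X n).W) := by
      have h3 : (X n).r * (X n).C ≤ (X n).W := by
        have := mul_pos alg.c_pos (hR n)
        simp only [W]; linarith
      have h4 : ρ * ((X n).r * (X n).C) ≤ |ρ| * (X n).W :=
        mul_le_mul (le_abs_self ρ) h3 (mul_nonneg hr.le alg.C_nonneg) (abs_nonneg _)
      have h5 := mul_nonneg (abs_nonneg ρ) hW
      have h6 := mul_le_mul_of_nonneg_left h4 hη.le
      have h7 := mul_le_mul_of_nonneg_right hη2 h5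
      linarith
    have h3 : |ρ| * (X n).W ≤ 2 * η * ((X n).r * (X n).R) := by linarith
    have h4 : κ * (X n).P ≤ |ρ| * (X n).A := by
      have h5 : κ ≤ |1 - (X n).b / (X n).g| := by
        have h6 : 1 - (X n).b / (X n).g = -((X n).b - (X n).g) / (X n).g := by
          field_simp; ring
        rw [h6, abs_div, abs_neg, abs_of_pos hg, le_div_iff₀ hg]
        exact hdiff.2
      rw [hid, abs_div, abs_mul, abs_of_nonneg hP, abs_of_pos hApos,
        div_mul_cancel₀ _ hApos.ne']
      exact mul_le_mul_of_nonneg_right h5 hP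
    have h5 := mul_le_mul_of_nonneg_right h4 hW
    have h6 := mul_le_mul_of_nonneg_right h3 hApos.le
    have h7 := mul_le_mul_of_nonneg_right hη4
      (mul_nonneg (mul_pos hr (hR n)).le hApos.le)
    have h8 : κ * ((X n).P * (X n).W) ≤ κ * (ε * ((X n).r * (X n).R) * (X n).A) := by
      linarith
    exact le_of_mul_le_mul_left h8 hκ

end Cell

section Equivariant

variable {h : ℝ → ℝ}

theorem map_add_int_of_map_add_one (hper : ∀ x, h (x + 1) = h x + 1) (x : ℝ) (p : ℤ) :
    h (x + p) = h x + p := by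
  have h1 : Function.Periodic (fun x => h x - x) 1 := fun x => by simp only [hper]; ring
  have h2 := h1.int_mul p x
  simp only [mul_one] at h2
  linarith

theorem iterate_add_int (hper : ∀ x, h (x + 1) = h x + 1) (n : ℕ) (x : ℝ) (p : ℤ) :
    h^[n] (x + p) = h^[n] x + p := by
  induction n with
  | zero => rfl
  | succ n ih =>
    rw [Function.iterate_succ_apply', Function.iterate_succ_apply', ih,
      map_add_int_of_map_add_one hper]

theorem iterate_int_add (hper : ∀ x, h (x + 1) = h x + 1) (n : ℕ) (x : ℝ) (p : ℤ) :
    h^[n] (p + x) = p + h^[n] x := by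
  rw [add_comm, iterate_add_int hper, add_comm]

theorem iterate_neg_conj (h : ℝ → ℝ) (n : ℕ) (x : ℝ) :
    (fun x => -h (-x))^[n] x = -h^[n] (-x) := by
  induction n generalizing x with
  | zero => simp
  | succ n ih => rw [Function.iterate_succ_apply, ih, Function.iterate_succ_apply, neg_neg]

end Equivariant

/-- No rational rotation number `p / q` is realized by a map with a transversal crossing: every
displacement function `h^[q] - id - p` has a constant sign. -/
def NoLock (h : ℝ → ℝ) : Prop :=
  ∀ q : ℕ, 1 ≤ q → ∀ p : ℤ, (∀ x, x + p ≤ h^[q] x) ∨ (∀ x, h^[q] x ≤ x + p)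

/-- There are no periodic breaks and no connections between the breaks `0` and `ξ`. -/
structure Irr (h : ℝ → ℝ) (ξ : ℝ) : Prop where
  noLock : NoLock h
  zero_ne : ∀ q : ℕ, 1 ≤ q → ∀ p : ℤ, h^[q] 0 ≠ p
  zero_ne_break : ∀ (n : ℕ) (p : ℤ), h^[n] 0 ≠ ξ + p
  break_ne_zero : ∀ (n : ℕ) (p : ℤ), h^[n] ξ ≠ p
  break_ne : ∀ q : ℕ, 1 ≤ q → ∀ p : ℤ, h^[q] ξ ≠ ξ + p

theorem NoLock.neg_conj {h : ℝ → ℝ} (hh : NoLock h) : NoLock (fun x => -h (-x)) := by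
  intro q hq p
  simp only [iterate_neg_conj]
  rcases hh q hq (-p) with h1 | h1
  · right; intro x; have := h1 (-x); push_cast at this; linarith
  · left; intro x; have := h1 (-x); push_cast at this; linarith

theorem Irr.neg_conj {h : ℝ → ℝ} {ξ : ℝ} (hh : Irr h ξ) : Irr (fun x => -h (-x)) (-ξ) where
  noLock := hh.noLock.neg_conj
  zero_ne q hq p e := by
    rw [iterate_neg_conj, neg_zero] at e
    exact hh.zero_ne q hq (-p) (by push_cast; linarith)
  zero_ne_break n p e := by
    rw [iterate_neg_conj, neg_zero] at e
    exact hh.zero_ne_break n (-p) (by push_cast; linarith)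
  break_ne_zero n p e := by
    rw [iterate_neg_conj, neg_neg] at e
    exact hh.break_ne_zero n (-p) (by push_cast; linarith)
  break_ne q hq p e := by
    rw [iterate_neg_conj, neg_neg] at e
    exact hh.break_ne q hq (-p) (by push_cast; linarith)

/-- Combinatorial and metric data of a pair of return branches near the break `0`: the branch
`h^[qu] - pu` on the right of `0`, the branch `h^[qw] - pw` on the left, and the times `k`, `j`
before and after the passage through the other break. -/
structure ReturnPair where
  flipped : Bool
  qu : ℕ
  qw : ℕ
  k : ℕ
  j : ℕ
  pu : ℤ
  pw : ℤ
  m : ℤ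
  X : Cell

namespace Cell

/-- The cell after the translation parameter has moved by `τ`. -/
def at' (X : Cell) (τ : ℝ) : Cell :=
  ⟨X.l - X.L * τ, X.c - X.C * τ, X.z + X.Z * τ, X.a, X.b, X.g, X.L, X.C, X.R⟩

variable (X : Cell) (τ : ℝ)

theorem at'_zero : X.at' 0 = X := by simp [at']
theorem at'_y : (X.at' τ).y = X.y - X.Y * τ := by simp only [y, Y, at']; ring
theorem at'_r : (X.at' τ).r = X.r + X.R * τ := by simp only [r, Z, at']; ring

theorem moveOne_at' : X.moveOne.at' τ = (X.at' τ).moveOne := by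
  ext <;> simp only [moveOne, at', Z]; ring

theorem moveTwo_at' : X.moveTwo.at' τ = (X.at' τ).moveTwo := by
  ext <;> simp only [moveTwo, at', Z, r]; ring

theorem moveThree_at' : X.moveThree.at' τ = (X.at' (-τ)).moveThree := by
  ext <;> simp only [moveThree, at', Z, r] <;> ring

variable {X} {σ : ℝ}

theorem at'_rel (h : X.Alg σ) : (X.at' τ).a * (X.at' τ).l =
    (X.at' τ).c + (X.at' τ).y + (1 - (X.at' τ).g) * (X.at' τ).z := by
  have h1 := h.rel
  have h2 := h.rel_rate
  rw [at'_y]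
  simp only [at']
  linear_combination h1 - τ * h2

end Cell

namespace ReturnPair

/-- The return branches of `h` are affine with the metric data `X`. -/
structure Rect (h : ℝ → ℝ) (ξ : ℝ) (S : ReturnPair) (X : Cell) : Prop where
  left : ∀ x, -X.l ≤ x → x ≤ 0 → h^[S.qw] x = S.pw + (X.r + X.a * x)
  right : ∀ x, 0 ≤ x → x ≤ X.c → h^[S.qu] x = S.pu + (-X.l + X.b * x)
  right' : ∀ x, X.c ≤ x → x ≤ X.r → h^[S.qu] x = S.pu + (-X.y + X.g * (x - X.c))
  pass : h^[S.k] X.c = ξ + S.m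

def moveOne (S : ReturnPair) : ReturnPair :=
  { S with qw := S.qu + S.qw, pw := S.pu + S.pw, X := S.X.moveOne }

def moveTwo (S : ReturnPair) : ReturnPair :=
  { S with qu := S.qw + S.qu, pu := S.pu + S.pw, j := S.qw + S.j, X := S.X.moveTwo }

noncomputable def moveThree (S : ReturnPair) : ReturnPair where
  flipped := !S.flipped
  qu := S.qu + S.qw
  qw := S.qu
  k := S.k + S.qw
  j := S.j
  pu := -(S.pu + S.pw)
  pw := -S.pu
  m := -(S.m + S.pw)
  X := S.X.moveThree

open Classical in
/-- One step of the renormalization of return pairs. -/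
noncomputable def step (S : ReturnPair) : ReturnPair :=
  if S.X.r < S.X.a * S.X.l then S.moveTwo
  else if S.X.a * S.X.l < S.X.z then S.moveOne else S.moveThree

theorem step_X (S : ReturnPair) : S.step.X = S.X.step := by
  unfold step Cell.step
  split_ifs <;> rfl

variable {h : ℝ → ℝ} {ξ : ℝ} {S : ReturnPair} {X : Cell}

namespace Rect

theorem moveOne (hper : ∀ x, h (x + 1) = h x + 1) (H : Rect h ξ S X)
    (rel : X.a * X.l = X.c + X.y + (1 - X.g) * X.z) (ha : 0 ≤ X.a)
    (hl : 0 ≤ X.l) (hz : 0 ≤ X.z - X.a * X.l) :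
    Rect h ξ S.moveOne X.moveOne where
  left x h1 h2 := by
    simp only [Cell.moveOne] at h1
    have h3 : 0 ≤ X.a * (x + X.l) := mul_nonneg ha (by linarith)
    have h4 : X.a * x ≤ 0 := mul_nonpos_of_nonneg_of_nonpos ha h2
    simp only [ReturnPair.moveOne]
    rw [Function.iterate_add_apply, H.left x h1 h2, iterate_int_add hper,
      H.right' _ (by simp only [Cell.r]; linarith) (by linarith), Cell.moveOne_r]
    simp only [Cell.moveOne, Cell.r]
    push_cast
    linear_combination rel
  right x h1 h2 := H.right x h1 h2
  right' x h1 h2 := by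
    refine H.right' x h1 (h2.trans ?_)
    rw [Cell.moveOne_r]
    have := mul_nonneg ha hl
    linarith
  pass := H.pass

theorem moveTwo (hper : ∀ x, h (x + 1) = h x + 1) (H : Rect h ξ S X)
    (rel : X.a * X.l = X.c + X.y + (1 - X.g) * X.z) (hb : 0 ≤ X.b)
    (hg : 0 ≤ X.g) (hc : 0 ≤ X.c) (hz : 0 ≤ X.z) (hl : 0 ≤ X.a * X.l - X.r) :
    Rect h ξ S.moveTwo X.moveTwo where
  left x h1 h2 := by
    refine H.left x ?_ h2
    have h3 := Cell.moveTwo_cut rel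
    have := mul_nonneg hb hc
    have := mul_nonneg hg hz
    linarith
  right x h1 h2 := by
    simp only [Cell.moveTwo] at h2
    have h3 := mul_nonneg hb h1
    have h4 := mul_nonneg hb (sub_nonneg.2 h2)
    have h5 := mul_nonneg hg hz
    simp only [ReturnPair.moveTwo]
    rw [Function.iterate_add_apply, H.right x h1 h2, iterate_int_add hper,
      H.left _ (by linarith) (by simp only [Cell.y, Cell.r] at *; linarith)]
    simp only [Cell.moveTwo, Cell.r]
    push_cast
    ring
  right' x h1 h2 := by
    simp only [Cell.moveTwo] at h1
    rw [Cell.moveTwo_r] at h2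
    have h3 := mul_nonneg hg (sub_nonneg.2 h1)
    have h4 := mul_nonneg hg (sub_nonneg.2 h2)
    have h5 := mul_nonneg hg hz
    have h6 := mul_nonneg hb hc
    rw [Cell.moveTwo_y]
    simp only [ReturnPair.moveTwo]
    rw [Function.iterate_add_apply, H.right' x h1 h2, iterate_int_add hper,
      H.left _ (by simp only [Cell.y]; linarith) (by simp only [Cell.r] at *; linarith)]
    simp only [Cell.moveTwo, Cell.r]
    push_cast
    ring
  pass := H.pass

theorem moveThree (hper : ∀ x, h (x + 1) = h x + 1) (H : Rect h ξ S X)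
    (rel : X.a * X.l = X.c + X.y + (1 - X.g) * X.z) (ha : 0 < X.a)
    (hl : 0 ≤ X.r - X.a * X.l) (hc : 0 ≤ X.z / X.a) (hz : 0 ≤ X.l - X.z / X.a) :
    Rect (fun x => -h (-x)) (-ξ) S.moveThree X.moveThree where
  left x h1 h2 := by
    simp only [Cell.moveThree] at h1
    rw [Cell.moveThree_r]
    have h3 : X.a * (X.l - X.z / X.a) = X.a * X.l - X.z := by field_simp
    have h4 := mul_nonneg ha.le hz
    simp only [ReturnPair.moveThree]
    rw [iterate_neg_conj, H.right _ (by linarith) (by simp only [Cell.r] at *; linarith)]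
    simp only [Cell.moveThree]
    push_cast
    ring
  right x h1 h2 := by
    simp only [Cell.moveThree] at h2
    have h3 := mul_nonneg ha.le h1
    have h4 := mul_nonneg ha.le (sub_nonneg.2 h2)
    have h5 : X.a * (X.z / X.a) = X.z := by field_simp
    simp only [ReturnPair.moveThree]
    rw [iterate_neg_conj, Function.iterate_add_apply, H.left _ (by linarith) (by linarith),
      iterate_int_add hper, H.right' _ (by simp only [Cell.r]; linarith) (by linarith)]
    simp only [Cell.moveThree, Cell.r]
    push_cast
    linear_combination -rel
  right' x h1 h2 := by
    rw [Cell.moveThree_r] at h2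
    simp only [Cell.moveThree] at h1
    have h3 := mul_nonneg ha.le (sub_nonneg.2 h1)
    have h4 := mul_nonneg ha.le (sub_nonneg.2 h2)
    have h5 : X.a * (X.z / X.a) = X.z := by field_simp
    rw [Cell.moveThree_y ha.ne' rel]
    simp only [ReturnPair.moveThree]
    rw [iterate_neg_conj, Function.iterate_add_apply, H.left _ (by linarith) (by linarith),
      iterate_int_add hper, H.right _ (by linarith) (by simp only [Cell.r]; linarith)]
    simp only [Cell.moveThree, Cell.r, Cell.y]
    push_cast
    linear_combination X.b * h5
  pass := by
    have h5 : X.a * (X.z / X.a) = X.z := by field_simp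
    have h6 : X.r + X.a * -(X.z / X.a) = X.c := by simp only [Cell.r]; linarith
    simp only [ReturnPair.moveThree, Cell.moveThree]
    rw [iterate_neg_conj, Function.iterate_add_apply, H.left _ (by linarith) (by linarith),
      iterate_int_add hper, h6, H.pass]
    push_cast
    ring

/-- If the image of the break under the right branch is sent back to the break by the left
branch, then the other break is periodic. -/
theorem break_periodic (hper : ∀ x, h (x + 1) = h x + 1) (H : Rect h ξ S X)
    (hq : S.qu = S.k + S.j) (hb : 0 ≤ X.b) (hc : 0 ≤ X.c) (hy : 0 ≤ X.y)
    (hay : X.a * X.y = X.z) : h^[S.qu + S.qw] ξ = ξ + (S.pu + S.pw : ℤ) := by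
  have h1 := H.right X.c hc le_rfl
  rw [hq, add_comm S.k, Function.iterate_add_apply, H.pass, iterate_add_int hper] at h1
  have h2 : h^[S.j] ξ = (S.pu - S.m : ℤ) + -X.y := by
    push_cast; simp only [Cell.y]; linarith
  have h3 := mul_nonneg hb hc
  have h4 : X.r + X.a * -X.y = X.c := by simp only [Cell.r]; linarith
  have h5 : S.qu + S.qw = S.k + (S.qw + S.j) := by omega
  rw [h5, Function.iterate_add_apply, Function.iterate_add_apply, h2, iterate_int_add hper,
    H.left _ (by simp only [Cell.y]; linarith) (by linarith), h4, iterate_int_add hper,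
    iterate_int_add hper, H.pass]
  push_cast
  ring

theorem right_neg (H : Rect h ξ S X) (hl : 0 < X.l) (hc : 0 ≤ X.c) (hirr : NoLock h)
    (hq : 1 ≤ S.qu) (x : ℝ) : h^[S.qu] x ≤ x + S.pu := by
  refine (hirr S.qu hq S.pu).resolve_left (fun h1 => ?_) x
  have h2 := h1 0
  rw [H.right 0 le_rfl hc] at h2
  linarith

theorem left_pos (H : Rect h ξ S X) (hl : 0 ≤ X.l) (hr : 0 < X.r) (hirr : NoLock h)
    (hq : 1 ≤ S.qw) (x : ℝ) : x + S.pw ≤ h^[S.qw] x := by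
  refine (hirr S.qw hq S.pw).resolve_right (fun h1 => ?_) x
  have h2 := h1 0
  rw [H.left 0 (by linarith) le_rfl] at h2
  linarith

theorem gen (hper : ∀ x, h (x + 1) = h x + 1) (hmono : StrictMono h) (H : Rect h ξ S X)
    (hirr : Irr h ξ) (hq : S.qu = S.k + S.j) (hq1 : 1 ≤ S.qu)
    (hl : 0 < X.l) (hc : 0 < X.c) (hz : 0 < X.z) : X.Gen where
  y_ne hy := by
    have h1 := H.right X.c hc.le le_rfl
    rw [hq, add_comm S.k, Function.iterate_add_apply, H.pass, iterate_add_int hper] at h1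
    refine hirr.break_ne_zero S.j (S.pu - S.m) ?_
    push_cast
    simp only [Cell.y] at hy
    linarith
  y_add_c_pos := by
    by_contra! hcon
    have h1 := H.right_neg hl hc.le hirr.noLock hq1 ξ
    have h1 := lt_of_le_of_ne h1 (hirr.break_ne _ hq1 _)
    have h2 := H.right' X.c le_rfl (by simp only [Cell.r]; linarith)
    have h3 : h^[S.k] (h^[S.qu] X.c) = h^[S.qu] (h^[S.k] X.c) := by
      rw [← Function.iterate_add_apply, add_comm, Function.iterate_add_apply]
    rw [h2, sub_self, mul_zero, add_zero, iterate_int_add hper, H.pass,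
      iterate_add_int hper] at h3
    have h4 := (hmono.iterate S.k).monotone (by linarith : X.c ≤ -X.y)
    rw [H.pass] at h4
    linarith
  ne_r he := by
    have h1 := H.left (-X.l) le_rfl (by linarith)
    have h2 : h^[S.qw + S.qu] 0 = (S.pu + S.pw : ℤ) := by
      rw [Function.iterate_add_apply, H.right 0 le_rfl hc.le, iterate_int_add hper, mul_zero,
        add_zero, h1]
      push_cast
      linarith
    exact hirr.zero_ne _ (by omega) _ h2
  ne_z he := by
    have h1 := H.left (-X.l) le_rfl (by linarith)
    have h3 : X.r + X.a * -X.l = X.c := by simp only [Cell.r]; linarith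
    rw [h3] at h1
    refine hirr.zero_ne_break (S.k + (S.qw + S.qu)) (S.pu + S.pw + S.m) ?_
    rw [Function.iterate_add_apply, Function.iterate_add_apply, H.right 0 le_rfl hc.le,
      iterate_int_add hper, mul_zero, add_zero, h1, iterate_int_add hper, iterate_int_add hper,
      H.pass]
    push_cast
    ring

end Rect

end ReturnPair

/-- A family of lifts obtained from one lift by adding the parameter. -/
structure TranslationFamily (H : ℝ → ℝ → ℝ) : Prop where
  mono : ∀ τ, StrictMono (H τ)
  map_add_one : ∀ τ x, H τ (x + 1) = H τ x + 1
  shift : ∀ τ x, H τ x = H 0 x + τ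

/-- Conjugation of a family by the reflection of the line and of the parameter. -/
def reflect (H : ℝ → ℝ → ℝ) : ℝ → ℝ → ℝ := fun τ x => -H (-τ) (-x)

theorem reflect_reflect (H : ℝ → ℝ → ℝ) : reflect (reflect H) = H := by
  funext τ x; simp [reflect]

theorem iterate_reflect (H : ℝ → ℝ → ℝ) (τ : ℝ) (n : ℕ) (x : ℝ) :
    (reflect H τ)^[n] x = -(H (-τ))^[n] (-x) :=
  iterate_neg_conj (H (-τ)) n x

namespace TranslationFamily

variable {H : ℝ → ℝ → ℝ}

theorem reflect (hH : TranslationFamily H) : TranslationFamily (reflect H) where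
  mono τ x y hxy := neg_lt_neg (hH.mono _ (neg_lt_neg hxy))
  map_add_one τ x := by
    have := hH.map_add_one (-τ) (-(x + 1))
    simp only [_root_.reflect]
    rw [show -(x + 1) + 1 = -x by ring] at this
    linarith
  shift τ x := by
    have h1 := hH.shift (-τ) (-x)
    simp only [_root_.reflect, neg_zero]
    linarith

theorem shift' (hH : TranslationFamily H) (s t x : ℝ) : H t x = H s x + (t - s) := by
  rw [hH.shift t, hH.shift s]; ring

theorem iterate_le (hH : TranslationFamily H) {s t : ℝ} (hst : s ≤ t) (n : ℕ) (x : ℝ) :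
    (H s)^[n] x ≤ (H t)^[n] x := by
  induction n with
  | zero => exact le_rfl
  | succ n ih =>
    rw [Function.iterate_succ_apply', Function.iterate_succ_apply', hH.shift' s t]
    have := (hH.mono s).monotone ih
    linarith

theorem iterate_add_le (hH : TranslationFamily H) {s t : ℝ} (hst : s ≤ t) {n : ℕ} (hn : 1 ≤ n)
    (x : ℝ) : (H s)^[n] x + (t - s) ≤ (H t)^[n] x := by
  obtain ⟨n, rfl⟩ := Nat.exists_eq_add_of_le' hn
  rw [Function.iterate_succ_apply', Function.iterate_succ_apply', hH.shift' s t]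
  have := (hH.mono s).monotone (hH.iterate_le hst n x)
  linarith

theorem iterate_lt (hH : TranslationFamily H) {s t : ℝ} (hst : s < t) {n : ℕ} (hn : 1 ≤ n)
    (x : ℝ) : (H s)^[n] x < (H t)^[n] x := by
  have := hH.iterate_add_le hst.le hn x
  linarith

theorem le_of_iterate_le (hH : TranslationFamily H) {s t : ℝ} {n : ℕ} (hn : 1 ≤ n) {x : ℝ}
    (h : (H s)^[n] x ≤ (H t)^[n] x) : s ≤ t := by
  by_contra! hst
  exact (hH.iterate_lt hst hn x).not_ge h

end TranslationFamily

namespace ReturnPair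

open Cell

/-- The return pair `S` describes the family `H` near the parameter `0`. -/
structure Describes (σ : ℝ) (H : ℝ → ℝ → ℝ) (ξ : ℝ) (S : ReturnPair) : Prop where
  alg : S.X.Alg σ
  gen : S.X.Gen
  qu_eq : S.qu = S.k + S.j
  qu_pos : 1 ≤ S.qu
  qw_pos : 0 < S.X.R → 1 ≤ S.qw
  rect : ∀ τ, 0 ≤ (S.X.at' τ).l → 0 ≤ (S.X.at' τ).c → 0 ≤ (S.X.at' τ).z →
    Rect (H τ) ξ S (S.X.at' τ)
  right_break : 0 ≤ S.X.Δ → (H ((S.X.y + S.X.c) / (S.X.Y + S.X.C)))^[S.qu] ξ = ξ + S.pu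
  left_zero : 0 < S.X.R → 0 ≤ S.X.P → (H (-(S.X.r / S.X.R)))^[S.qw] 0 = S.pw
  left_break : 0 < S.X.R → 0 ≤ S.X.P →
    (H (-((S.X.r - (1 - S.X.a * S.X.b / S.X.g) * S.X.c) /
      (S.X.R + (1 - S.X.a * S.X.b / S.X.g) * S.X.C))))^[S.qw] ξ = ξ + S.pw

variable {σ ξ : ℝ} {H : ℝ → ℝ → ℝ} {S : ReturnPair}

namespace Describes

theorem rect_zero (D : Describes σ H ξ S) : Rect (H 0) ξ S S.X := by
  have h := D.rect 0
  rw [at'_zero] at h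
  exact h D.alg.l_pos.le D.alg.c_pos.le D.alg.z_pos.le

theorem right_zero (D : Describes σ H ξ S) (hΔ : 0 ≤ S.X.Δ) :
    (H (S.X.l / S.X.L))^[S.qu] 0 = S.pu := by
  have hL := D.alg.L_pos
  have hl0 : (S.X.at' (S.X.l / S.X.L)).l = 0 := by simp only [at']; field_simp; ring
  have hc0 : 0 ≤ (S.X.at' (S.X.l / S.X.L)).c := by
    have : (S.X.at' (S.X.l / S.X.L)).c = S.X.Δ / S.X.L := by
      simp only [at', Δ, Y, y]; field_simp; ring
    rw [this]; positivity
  have hz0 : 0 ≤ (S.X.at' (S.X.l / S.X.L)).z :=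
    add_nonneg D.alg.z_pos.le (mul_nonneg (Z_nonneg D.alg) (div_nonneg D.alg.l_pos.le hL.le))
  have h1 := (D.rect _ hl0.ge hc0 hz0).right 0 le_rfl hc0
  rw [h1, hl0]; ring

theorem moveOne (hH : TranslationFamily H) (hirr : Irr (H 0) ξ) (D : Describes σ H ξ S)
    (hz : S.X.a * S.X.l < S.X.z) : Describes σ H ξ S.moveOne := by
  have alg := moveOne_alg D.alg hz
  have ha := D.alg.a_pos
  have hg := D.alg.g_pos
  have rect : ∀ τ, 0 ≤ (S.moveOne.X.at' τ).l → 0 ≤ (S.moveOne.X.at' τ).c →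
      0 ≤ (S.moveOne.X.at' τ).z → Rect (H τ) ξ S.moveOne (S.moveOne.X.at' τ) := by
    intro τ h1 h2 h3
    change 0 ≤ (S.X.moveOne.at' τ).z at h3
    change Rect _ _ _ (S.X.moveOne.at' τ)
    rw [moveOne_at'] at h3 ⊢
    have h4 : 0 ≤ (S.X.at' τ).l := h1
    have h5 : 0 ≤ (S.X.at' τ).a * (S.X.at' τ).l := mul_nonneg ha.le h4
    have h6 : 0 ≤ (S.X.at' τ).z - (S.X.at' τ).a * (S.X.at' τ).l := h3
    exact (D.rect τ h1 h2 (by linarith)).moveOne (hH.map_add_one τ) (at'_rel τ D.alg) ha.le h1 h3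
  have r0 := rect 0
  rw [at'_zero] at r0
  have r0 := r0 alg.l_pos.le alg.c_pos.le alg.z_pos.le
  have hR : 0 < S.X.moveOne.R :=
    add_pos_of_nonneg_of_pos D.alg.R_nonneg (mul_pos ha D.alg.L_pos)
  have hP' : S.X.moveOne.P = S.X.g * (S.X.y * S.X.Z + S.X.Y * S.X.z) := by
    have h1 := D.alg.rel
    have h2 := D.alg.rel_rate
    simp only [P, moveOne_y, moveOne_Y, moveOne_r]
    simp only [Cell.moveOne, r, Z] at *
    linear_combination S.X.y * h2 - S.X.Y * h1
  refine ⟨alg, r0.gen (hH.map_add_one 0) (hH.mono 0) hirr D.qu_eq D.qu_pos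
    alg.l_pos alg.c_pos alg.z_pos, D.qu_eq, D.qu_pos,
    fun _ => le_add_right D.qu_pos, rect, fun hΔ => D.right_break hΔ, fun _ hP => ?_,
    fun _ hP => ?_⟩
  · change 0 ≤ S.X.moveOne.P at hP
    change (H (-(S.X.moveOne.r / S.X.moveOne.R)))^[S.qu + S.qw] 0 = ((S.pu + S.pw : ℤ) : ℝ)
    have hr := r_pos alg
    have e0 : -(S.X.moveOne.r / S.X.moveOne.R) ≤ 0 := neg_nonpos.2 (div_pos hr hR).le
    have hy : (S.X.at' (-(S.X.moveOne.r / S.X.moveOne.R))).y =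
        S.X.moveOne.P / S.X.moveOne.R := by
      rw [at'_y]; simp only [P, moveOne_y, moveOne_Y]; field_simp; ring
    have hral : (S.X.at' (-(S.X.moveOne.r / S.X.moveOne.R))).r =
        (S.X.at' (-(S.X.moveOne.r / S.X.moveOne.R))).a *
          (S.X.at' (-(S.X.moveOne.r / S.X.moveOne.R))).l := by
      have h1 : S.X.moveOne.R * (S.X.moveOne.r / S.X.moveOne.R) = S.X.r - S.X.a * S.X.l := by
        rw [mul_div_cancel₀ _ hR.ne', moveOne_r]
      rw [at'_r]
      simp only [at']
      have h2 : S.X.moveOne.R = S.X.R + S.X.a * S.X.L := rfl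
      generalize S.X.moveOne.r / S.X.moveOne.R = t at *
      rw [h2] at h1
      linear_combination -h1
    have rel := at'_rel (-(S.X.moveOne.r / S.X.moveOne.R)) D.alg
    have hy0 : 0 ≤ (S.X.at' (-(S.X.moveOne.r / S.X.moveOne.R))).y := by
      rw [hy]; exact div_nonneg hP hR.le
    have hR' := D.rect (-(S.X.moveOne.r / S.X.moveOne.R))
    have hl0 : 0 ≤ (S.X.at' (-(S.X.moveOne.r / S.X.moveOne.R))).l := by
      have := mul_nonneg D.alg.L_pos.le (neg_nonneg.2 e0)
      have := D.alg.l_pos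
      simp only [at']; linarith
    have hc0 : 0 ≤ (S.X.at' (-(S.X.moveOne.r / S.X.moveOne.R))).c := by
      have := mul_nonneg D.alg.C_nonneg (neg_nonneg.2 e0)
      have := D.alg.c_pos
      simp only [at']; linarith
    have hg' : 0 < (S.X.at' (-(S.X.moveOne.r / S.X.moveOne.R))).g := hg
    generalize S.X.at' (-(S.X.moveOne.r / S.X.moveOne.R)) = X at *
    have hgz : X.g * X.z = X.y := by simp only [r] at hral; linarith
    have hz0 : 0 ≤ X.z := by
      by_contra! h0
      have := mul_pos hg' (neg_pos.2 h0)
      linarith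
    have hrect := hR' hl0 hc0 hz0
    rw [Function.iterate_add_apply, hrect.left 0 (by linarith) le_rfl,
      iterate_int_add (hH.map_add_one _), mul_zero, add_zero,
      hrect.right' X.r (by simp only [r]; linarith) le_rfl]
    simp only [r]
    push_cast
    linear_combination hgz
  · change 0 ≤ S.X.moveOne.P at hP
    have hκ : S.X.moveOne.a * S.X.moveOne.b / S.X.moveOne.g = S.X.a * S.X.b := by
      simp only [Cell.moveOne]; field_simp
    have e1 : (S.X.moveOne.r - (1 - S.X.moveOne.a * S.X.moveOne.b / S.X.moveOne.g) *
        S.X.moveOne.c) = S.X.z - S.X.a * S.X.y := by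
      rw [hκ, moveOne_r]; simp only [Cell.moveOne, r, y]; ring
    have e2 : (S.X.moveOne.R + (1 - S.X.moveOne.a * S.X.moveOne.b / S.X.moveOne.g) *
        S.X.moveOne.C) = S.X.Z + S.X.a * S.X.Y := by
      rw [hκ]; simp only [Cell.moveOne, Z, Y]; ring
    change (H (-((S.X.moveOne.r - (1 - S.X.moveOne.a * S.X.moveOne.b / S.X.moveOne.g) *
      S.X.moveOne.c) / (S.X.moveOne.R + (1 - S.X.moveOne.a * S.X.moveOne.b / S.X.moveOne.g) *
      S.X.moveOne.C))))^[S.qu + S.qw] ξ = ξ + ((S.pu + S.pw : ℤ) : ℝ)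
    have hD := alg.rate_pos hR
    rw [e2] at hD
    rw [e1, e2]
    have hzay : 0 < S.X.z - S.X.a * S.X.y := by
      have := mul_pos ha (mul_pos D.alg.b_pos D.alg.c_pos)
      simp only [y]; linarith
    set t := (S.X.z - S.X.a * S.X.y) / (S.X.Z + S.X.a * S.X.Y) with ht
    have ht0 : 0 ≤ t := (div_pos hzay hD).le
    have htD : t * (S.X.Z + S.X.a * S.X.Y) = S.X.z - S.X.a * S.X.y := div_mul_cancel₀ _ hD.ne'
    have hy0 : 0 ≤ (S.X.at' (-t)).y := by
      have : (S.X.at' (-t)).y = S.X.moveOne.P / S.X.g / (S.X.Z + S.X.a * S.X.Y) := by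
        rw [at'_y, hP', mul_div_cancel_left₀ _ hg.ne', eq_div_iff hD.ne']
        linear_combination S.X.Y * htD
      rw [this]; positivity
    have hay : (S.X.at' (-t)).a * (S.X.at' (-t)).y = (S.X.at' (-t)).z := by
      rw [at'_y]; simp only [at']
      linear_combination htD
    have hc0 : 0 ≤ (S.X.at' (-t)).c := by
      have := mul_nonneg D.alg.C_nonneg ht0
      have := D.alg.c_pos
      simp only [at']; linarith
    have hl0 : 0 ≤ (S.X.at' (-t)).l := by
      have := mul_nonneg D.alg.L_pos.le ht0
      have := D.alg.l_pos
      simp only [at']; linarith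
    exact (D.rect (-t) hl0 hc0 (hay ▸ mul_nonneg ha.le hy0)).break_periodic
      (hH.map_add_one _) D.qu_eq D.alg.b_pos.le hc0 hy0 hay

theorem moveTwo (hH : TranslationFamily H) (hirr : Irr (H 0) ξ) (D : Describes σ H ξ S)
    (hr : S.X.r < S.X.a * S.X.l) : Describes σ H ξ S.moveTwo := by
  have alg := moveTwo_alg D.alg hr
  have ha := D.alg.a_pos
  have hb := D.alg.b_pos
  have hg := D.alg.g_pos
  have qu_eq : S.moveTwo.qu = S.moveTwo.k + S.moveTwo.j := by
    have := D.qu_eq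
    simp only [ReturnPair.moveTwo]; omega
  have qu_pos : 1 ≤ S.moveTwo.qu := le_add_left D.qu_pos
  have rect : ∀ τ, 0 ≤ (S.moveTwo.X.at' τ).l → 0 ≤ (S.moveTwo.X.at' τ).c →
      0 ≤ (S.moveTwo.X.at' τ).z → Rect (H τ) ξ S.moveTwo (S.moveTwo.X.at' τ) := by
    intro τ h1 h2 h3
    change 0 ≤ (S.X.moveTwo.at' τ).l at h1
    change Rect _ _ _ (S.X.moveTwo.at' τ)
    rw [moveTwo_at'] at h1 ⊢
    have h4 : 0 ≤ (S.X.at' τ).c := h2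
    have h5 : 0 ≤ (S.X.at' τ).z := h3
    have hl : 0 ≤ (S.X.at' τ).l := by
      have h6 := moveTwo_cut (at'_rel τ D.alg)
      have h7 : 0 ≤ (S.X.at' τ).b * (S.X.at' τ).c := mul_nonneg hb.le h4
      have h8 : 0 ≤ (S.X.at' τ).g * (S.X.at' τ).z := mul_nonneg hg.le h5
      linarith
    exact (D.rect τ hl h4 h5).moveTwo (hH.map_add_one τ) (at'_rel τ D.alg) hb.le hg.le h4 h5 h1
  have r0 := rect 0
  rw [at'_zero] at r0
  have r0 := r0 alg.l_pos.le alg.c_pos.le alg.z_pos.le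
  have gen := r0.gen (hH.map_add_one 0) (hH.mono 0) hirr qu_eq qu_pos
    alg.l_pos alg.c_pos alg.z_pos
  have hP' : S.X.moveTwo.P = S.X.a * S.X.P := by
    simp only [P, moveTwo_y, moveTwo_Y, moveTwo_r]
    simp only [Cell.moveTwo]
    ring
  have hκ : S.X.moveTwo.a * S.X.moveTwo.b / S.X.moveTwo.g = S.X.a * S.X.b / S.X.g := by
    simp only [Cell.moveTwo]; field_simp
  have hP : 0 ≤ S.X.moveTwo.P → 0 ≤ S.X.P := fun h => by
    rw [hP'] at h; exact nonneg_of_mul_nonneg_right h ha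
  refine ⟨alg, gen, qu_eq, qu_pos, D.qw_pos, rect, fun hΔ => ?_,
    fun h1 h2 => D.left_zero h1 (hP h2), fun h1 h2 => ?_⟩
  · change 0 ≤ S.X.moveTwo.Δ at hΔ
    change (H ((S.X.moveTwo.y + S.X.moveTwo.c) / (S.X.moveTwo.Y + S.X.moveTwo.C)))^[S.qw + S.qu]
      ξ = ξ + ((S.pu + S.pw : ℤ) : ℝ)
    have hD : 0 < S.X.moveTwo.Y + S.X.moveTwo.C := add_pos_of_pos_of_nonneg alg.Y_pos alg.C_nonneg
    have hyc : 0 < S.X.moveTwo.y + S.X.moveTwo.c := gen.y_add_c_pos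
    set t := (S.X.moveTwo.y + S.X.moveTwo.c) / (S.X.moveTwo.Y + S.X.moveTwo.C) with ht
    have ht0 : 0 ≤ t := (div_pos hyc hD).le
    have hc0 : 0 ≤ (S.X.at' t).c := by
      have : (S.X.at' t).c = S.X.moveTwo.Δ / (S.X.moveTwo.Y + S.X.moveTwo.C) := by
        change S.X.moveTwo.c - S.X.moveTwo.C * t = _
        rw [ht]; simp only [Δ]; field_simp; ring
      rw [this]; positivity
    have hz0 : 0 ≤ (S.X.at' t).z :=
      add_nonneg D.alg.z_pos.le (mul_nonneg (Z_nonneg D.alg) ht0)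
    have hay : (S.X.at' t).a * (S.X.at' t).y = (S.X.at' t).z := by
      have h1 : t * (S.X.moveTwo.Y + S.X.moveTwo.C) = S.X.moveTwo.y + S.X.moveTwo.c := by
        rw [ht]; field_simp
      rw [moveTwo_Y, moveTwo_y] at h1
      rw [at'_y]
      simp only [at', Cell.moveTwo, Z, r] at h1 ⊢
      linear_combination -h1
    have hy0 : 0 ≤ (S.X.at' t).y := by
      rw [← hay] at hz0; exact nonneg_of_mul_nonneg_right hz0 ha
    have hl0 : 0 ≤ (S.X.at' t).l := by
      have h1 : 0 ≤ (S.X.at' t).b * (S.X.at' t).c := mul_nonneg hb.le hc0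
      simp only [y] at hy0; linarith
    rw [add_comm S.qw]
    exact (D.rect t hl0 hc0 hz0).break_periodic
      (hH.map_add_one _) D.qu_eq hb.le hc0 hy0 hay
  · have := D.left_break h1 (hP h2)
    rw [← hκ] at this
    exact this

theorem moveThree (hH : TranslationFamily H) (hirr : Irr (H 0) ξ) (D : Describes σ H ξ S)
    (hz : S.X.z < S.X.a * S.X.l) (hr : S.X.a * S.X.l < S.X.r) :
    Describes σ (reflect H) (-ξ) S.moveThree := by
  have alg := moveThree_alg D.alg hz hr
  have ha := D.alg.a_pos
  have hb := D.alg.b_pos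
  have qu_eq : S.moveThree.qu = S.moveThree.k + S.moveThree.j := by
    have := D.qu_eq
    simp only [ReturnPair.moveThree]; omega
  have qu_pos : 1 ≤ S.moveThree.qu := le_add_right D.qu_pos
  have rect : ∀ τ, 0 ≤ (S.moveThree.X.at' τ).l → 0 ≤ (S.moveThree.X.at' τ).c →
      0 ≤ (S.moveThree.X.at' τ).z →
      Rect (reflect H τ) (-ξ) S.moveThree (S.moveThree.X.at' τ) := by
    intro τ h1 h2 h3
    change 0 ≤ (S.X.moveThree.at' τ).l at h1
    change 0 ≤ (S.X.moveThree.at' τ).c at h2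
    change 0 ≤ (S.X.moveThree.at' τ).z at h3
    change Rect _ _ _ (S.X.moveThree.at' τ)
    rw [moveThree_at'] at h1 h2 h3 ⊢
    have ha' : 0 < (S.X.at' (-τ)).a := ha
    have hzz : 0 ≤ (S.X.at' (-τ)).z := by
      have h4 : 0 ≤ (S.X.at' (-τ)).z / (S.X.at' (-τ)).a := h2
      have := mul_nonneg h4 ha'.le
      rwa [div_mul_cancel₀ _ ha'.ne'] at this
    have h5 : (S.X.at' (-τ)).z ≤ (S.X.at' (-τ)).a * (S.X.at' (-τ)).l := by
      have h6 : 0 ≤ (S.X.at' (-τ)).l - (S.X.at' (-τ)).z / (S.X.at' (-τ)).a := h3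
      have h7 := sub_nonneg.1 h6
      rw [div_le_iff₀ ha'] at h7
      linarith
    have h7 : 0 ≤ (S.X.at' (-τ)).r - (S.X.at' (-τ)).a * (S.X.at' (-τ)).l := h1
    have hl : 0 ≤ (S.X.at' (-τ)).l := nonneg_of_mul_nonneg_right (hzz.trans h5) ha'
    have hc : 0 ≤ (S.X.at' (-τ)).c := by simp only [r] at h7; linarith
    exact (D.rect (-τ) hl hc hzz).moveThree (hH.map_add_one _) (at'_rel _ D.alg) ha h1 h2 h3
  have r0 := rect 0
  rw [at'_zero] at r0
  have r0 := r0 alg.l_pos.le alg.c_pos.le alg.z_pos.le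
  have hirr' : Irr (reflect H 0) (-ξ) := by
    have h1 : reflect H 0 = fun x => -H 0 (-x) := by funext x; simp [reflect]
    rw [h1]; exact hirr.neg_conj
  have gen := r0.gen (hH.reflect.map_add_one 0) (hH.reflect.mono 0) hirr' qu_eq qu_pos
    alg.l_pos alg.c_pos alg.z_pos
  have ey := moveThree_y ha.ne' D.alg.rel
  have eY := moveThree_Y ha.ne' D.alg.rel_rate
  have hP : 0 ≤ S.X.moveThree.P → 0 ≤ S.X.Δ := fun h => by
    have h1 : S.X.moveThree.P = S.X.b * S.X.Δ := by
      rw [b_mul_Δ]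
      simp only [P, ey, eY, moveThree_r]; simp only [Cell.moveThree]; ring
    rw [h1] at h; exact nonneg_of_mul_nonneg_right h hb
  refine ⟨alg, gen, qu_eq, qu_pos, fun _ => D.qu_pos, rect, fun hΔ => ?_,
    fun _ h2 => ?_, fun _ h2 => ?_⟩
  · change 0 ≤ S.X.moveThree.Δ at hΔ
    change (reflect H ((S.X.moveThree.y + S.X.moveThree.c) /
      (S.X.moveThree.Y + S.X.moveThree.C)))^[S.qu + S.qw] (-ξ) =
        -ξ + ((-(S.pu + S.pw) : ℤ) : ℝ)
    have hyc : 0 < S.X.moveThree.y + S.X.moveThree.c := gen.y_add_c_pos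
    have hD : 0 < S.X.moveThree.Y + S.X.moveThree.C :=
      add_pos_of_pos_of_nonneg alg.Y_pos alg.C_nonneg
    set t := (S.X.moveThree.y + S.X.moveThree.c) / (S.X.moveThree.Y + S.X.moveThree.C) with ht
    have ht0 : 0 ≤ t := (div_pos hyc hD).le
    have h1 : t * (S.X.moveThree.Y + S.X.moveThree.C) = S.X.moveThree.y + S.X.moveThree.c := by
      rw [ht]; field_simp
    have hy0 : 0 ≤ (S.X.at' (-t)).y := by
      have h2 : (S.X.at' (-t)).y = S.X.moveThree.Δ / (S.X.moveThree.Y + S.X.moveThree.C) := by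
        rw [at'_y, ← neg_neg S.X.y, ← ey, ← eY, eq_div_iff hD.ne']
        simp only [Δ]
        linear_combination S.X.moveThree.Y * h1
      rw [h2]; positivity
    have hay : (S.X.at' (-t)).a * (S.X.at' (-t)).y = (S.X.at' (-t)).z := by
      rw [ey, eY] at h1
      rw [at'_y]
      simp only [at', Cell.moveThree] at h1 ⊢
      field_simp at h1
      linear_combination h1
    have hc0 : 0 ≤ (S.X.at' (-t)).c := by
      have := mul_nonneg D.alg.C_nonneg ht0
      have := D.alg.c_pos
      simp only [at']; linarith
    have hl0 : 0 ≤ (S.X.at' (-t)).l := by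
      have := mul_nonneg D.alg.L_pos.le ht0
      have := D.alg.l_pos
      simp only [at']; linarith
    have h3 := (D.rect (-t) hl0 hc0 (hay ▸ mul_nonneg ha.le hy0)).break_periodic
      (hH.map_add_one _) D.qu_eq hb.le hc0 hy0 hay
    rw [iterate_reflect, neg_neg, h3]
    push_cast
    ring
  · change (reflect H (-(S.X.moveThree.r / S.X.moveThree.R)))^[S.qu] 0 = ((-S.pu : ℤ) : ℝ)
    rw [iterate_reflect, neg_neg, neg_zero, moveThree_r]
    change -(H (S.X.l / S.X.L))^[S.qu] 0 = _
    rw [D.right_zero (hP h2)]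
    push_cast
    ring
  · have e1 : (S.X.moveThree.r - (1 - S.X.moveThree.a * S.X.moveThree.b / S.X.moveThree.g) *
        S.X.moveThree.c) = (S.X.y + S.X.c) / S.X.a := by
      have := D.alg.rel
      rw [moveThree_r]; simp only [Cell.moveThree]
      field_simp
      linear_combination this
    have e2 : (S.X.moveThree.R + (1 - S.X.moveThree.a * S.X.moveThree.b / S.X.moveThree.g) *
        S.X.moveThree.C) = (S.X.Y + S.X.C) / S.X.a := by
      have := D.alg.rel_rate
      simp only [Cell.moveThree]
      field_simp
      linear_combination this
    change (reflect H (-((S.X.moveThree.r - (1 - S.X.moveThree.a * S.X.moveThree.b /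
      S.X.moveThree.g) * S.X.moveThree.c) / (S.X.moveThree.R + (1 - S.X.moveThree.a *
      S.X.moveThree.b / S.X.moveThree.g) * S.X.moveThree.C))))^[S.qu] (-ξ) =
        -ξ + ((-S.pu : ℤ) : ℝ)
    rw [e1, e2, iterate_reflect, neg_neg, neg_neg, div_div_div_cancel_right₀ ha.ne',
      D.right_break (hP h2)]
    push_cast
    ring

end Describes

end ReturnPair

/-- The family `H` seen in the orientation `s`. -/
def orient (s : Bool) (H : ℝ → ℝ → ℝ) : ℝ → ℝ → ℝ := cond s (reflect H) H

/-- The point `ξ` seen in the orientation `s`. -/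
def orientPoint (s : Bool) (ξ : ℝ) : ℝ := cond s (-ξ) ξ

theorem orient_not (s : Bool) (H : ℝ → ℝ → ℝ) : orient (!s) H = reflect (orient s H) := by
  cases s
  · rfl
  · exact (reflect_reflect H).symm

theorem orientPoint_not (s : Bool) (ξ : ℝ) : orientPoint (!s) ξ = -orientPoint s ξ := by
  cases s
  · rfl
  · exact (neg_neg ξ).symm

theorem TranslationFamily.orient {H : ℝ → ℝ → ℝ} (hH : TranslationFamily H) (s : Bool) :
    TranslationFamily (orient s H) := by
  cases s
  · exact hH
  · exact hH.reflect

theorem Irr.orient {H : ℝ → ℝ → ℝ} {ξ : ℝ} (h : Irr (H 0) ξ) (s : Bool) :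
    Irr (orient s H 0) (orientPoint s ξ) := by
  cases s
  · exact h
  · have h1 : reflect H 0 = fun x => -H 0 (-x) := by funext x; simp [reflect]
    change Irr (reflect H 0) (-ξ)
    rw [h1]
    exact h.neg_conj

theorem NoLock.reflect_neg {H : ℝ → ℝ → ℝ} {τ : ℝ} (h : NoLock (H τ)) :
    NoLock (reflect H (-τ)) := by
  have h1 : reflect H (-τ) = fun x => -H τ (-x) := by funext x; simp [reflect]
  rw [h1]
  exact h.neg_conj

theorem exists_lt_sub_nat_mul {u : ℕ → ℝ} {δ : ℝ} (hδ : 0 < δ)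
    (hu : ∀ n, u (n + 1) ≤ u n - δ) : ∃ n, u n < 0 := by
  have h : ∀ n : ℕ, u n ≤ u 0 - n * δ := by
    intro n
    induction n with
    | zero => simp
    | succ n ih => have := hu n; push_cast; linarith
  obtain ⟨n, hn⟩ := exists_nat_gt (u 0 / δ)
  rw [div_lt_iff₀ hδ] at hn
  exact ⟨n, by have := h n; linarith⟩

namespace Cell

variable {σ : ℝ} {X : ℕ → Cell}

theorem exists_not_moveTwo (hA : ∀ n, (X n).Alg σ) (hs : ∀ n, X (n + 1) = (X n).step) :
    ∃ n, ¬ (X n).r < (X n).a * (X n).l := by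
  by_contra! h
  have hs' : ∀ n, X (n + 1) = (X n).moveTwo := fun n => by rw [hs, step_eq_moveTwo (h n)]
  have ha : ∀ n, (X n).a = (X 0).a := fun n => by
    induction n with
    | zero => rfl
    | succ n ih => rw [hs']; exact ih
  have hr : ∀ n, (X n).r = (X 0).r := fun n => by
    induction n with
    | zero => rfl
    | succ n ih => rw [hs']; exact ih
  have hl : ∀ n, (X (n + 1)).l = (X 0).a * (X n).l - (X 0).r := fun n => by
    rw [hs', ← ha n, ← hr n]; rfl
  have hcut : ∀ n, (X (n + 1)).l < (X n).l := fun n => by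
    have h1 := moveTwo_cut (hA n).rel
    have := mul_pos (hA n).b_pos (hA n).c_pos
    have := mul_pos (hA n).g_pos (hA n).z_pos
    rw [hs']; linarith
  have hle : ∀ n, (X n).l ≤ (X 0).l := fun n => by
    induction n with
    | zero => exact le_rfl
    | succ n ih => exact (hcut n).le.trans ih
  have hr0 := r_pos (hA 0)
  have h0 := hcut 0
  rw [hl] at h0
  obtain ⟨n, hn⟩ := exists_lt_sub_nat_mul (u := fun n => (X n).l)
    (δ := min (X 0).r ((X 0).l - ((X 0).a * (X 0).l - (X 0).r)))
    (lt_min hr0 (by linarith)) (fun n => by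
      rw [hl]
      have hn := hle n
      have hp := (hA n).l_pos
      rcases le_total (X 0).a 1 with h1 | h1
      · have h2 := mul_nonneg (sub_nonneg.2 h1) hp.le
        have h3 := min_le_left (X 0).r ((X 0).l - ((X 0).a * (X 0).l - (X 0).r))
        linarith
      · have h2 := mul_nonneg (sub_nonneg.2 h1) (sub_nonneg.2 hn)
        have h3 := min_le_right (X 0).r ((X 0).l - ((X 0).a * (X 0).l - (X 0).r))
        linarith)
  exact hn.not_ge (hA n).l_pos.le

theorem exists_not_moveOne (hA : ∀ n, (X n).Alg σ) (hG : ∀ n, (X n).Gen)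
    (hs : ∀ n, X (n + 1) = (X n).step) : ∃ n, ¬ (X n).a * (X n).l < (X n).z := by
  by_contra! h
  have hs' : ∀ n, X (n + 1) = (X n).moveOne := fun n => by rw [hs, step_eq_moveOne (hA n) (h n)]
  have hc : ∀ n, (X n).c + (X n).y = (X 0).c + (X 0).y := fun n => by
    induction n with
    | zero => rfl
    | succ n ih => rw [hs']; exact ih
  have hg : ∀ n, (X n).g = (X 0).g := fun n => by
    induction n with
    | zero => rfl
    | succ n ih => rw [hs']; exact ih
  have hz : ∀ n, (X (n + 1)).z = (X n).z - (X n).a * (X n).l := fun n => by rw [hs']; rfl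
  have hal : ∀ n, 0 < (X n).a * (X n).l := fun n => mul_pos (hA n).a_pos (hA n).l_pos
  have hrel : ∀ n, (X n).a * (X n).l = (X 0).c + (X 0).y + (1 - (X 0).g) * (X n).z := fun n => by
    rw [(hA n).rel, hc, hg]
  have hle : ∀ n, (X n).z ≤ (X 0).z := fun n => by
    induction n with
    | zero => exact le_rfl
    | succ n ih => have := hal n; rw [hz]; linarith
  have hcy := (hG 0).y_add_c_pos
  have h0 := hal 0
  rw [hrel] at h0
  obtain ⟨n, hn⟩ := exists_lt_sub_nat_mul (u := fun n => (X n).z)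
    (δ := min ((X 0).c + (X 0).y) ((X 0).c + (X 0).y + (1 - (X 0).g) * (X 0).z))
    (lt_min (by linarith) h0) (fun n => by
      rw [hz, hrel]
      have hn := hle n
      have hp := (hA n).z_pos
      rcases le_total (X 0).g 1 with h1 | h1
      · have h2 := mul_nonneg (sub_nonneg.2 h1) hp.le
        have h3 := min_le_left ((X 0).c + (X 0).y)
          ((X 0).c + (X 0).y + (1 - (X 0).g) * (X 0).z)
        linarith
      · have h2 := mul_nonneg (sub_nonneg.2 h1) (sub_nonneg.2 hn)
        have h3 := min_le_right ((X 0).c + (X 0).y)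
          ((X 0).c + (X 0).y + (1 - (X 0).g) * (X 0).z)
        linarith)
  exact hn.not_ge (hA n).z_pos.le

end Cell

namespace ReturnPair

open Cell

variable {σ ξ τ : ℝ} {H : ℝ → ℝ → ℝ} {S : ReturnPair}

theorem step_cases (h : S.X.Alg σ) (hg : S.X.Gen) :
    (S.X.a * S.X.l < S.X.z ∧ S.step = S.moveOne) ∨ (S.X.r < S.X.a * S.X.l ∧ S.step = S.moveTwo) ∨
      (S.X.z < S.X.a * S.X.l ∧ S.X.a * S.X.l < S.X.r ∧ S.step = S.moveThree) := by
  rcases Cell.step_cases h hg with ⟨h1, -⟩ | ⟨h1, -⟩ | ⟨h1, h2, -⟩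
  · exact Or.inl ⟨h1, by rw [step, if_neg (lt_r_of_lt_z h h1).not_gt, if_pos h1]⟩
  · exact Or.inr (Or.inl ⟨h1, if_pos h1⟩)
  · exact Or.inr (Or.inr ⟨h1, h2, by rw [step, if_neg h2.not_gt, if_neg h1.not_gt]⟩)

/-- `S` describes the family `H` in its own orientation. -/
def Valid (σ : ℝ) (H : ℝ → ℝ → ℝ) (ξ : ℝ) (S : ReturnPair) : Prop :=
  S.Describes σ (orient S.flipped H) (orientPoint S.flipped ξ)

theorem Valid.step (hH : TranslationFamily H) (hirr : Irr (H 0) ξ) (V : S.Valid σ H ξ) :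
    S.step.Valid σ H ξ := by
  rcases step_cases V.alg V.gen with ⟨h1, h2⟩ | ⟨h1, h2⟩ | ⟨h1, h3, h2⟩
  · rw [h2]; exact V.moveOne (hH.orient _) (hirr.orient _) h1
  · rw [h2]; exact V.moveTwo (hH.orient _) (hirr.orient _) h1
  · rw [h2]
    change Describes σ (orient (!S.flipped) H) (orientPoint (!S.flipped) ξ) _
    rw [orient_not, orientPoint_not]
    exact V.moveThree (hH.orient _) (hirr.orient _) h1 h3

/-- At the parameter `τ` the right branch has become nonnegative. -/
def CrossedRight (H : ℝ → ℝ → ℝ) (S : ReturnPair) (τ : ℝ) : Prop :=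
  ∀ x, x + S.pu ≤ (H τ)^[S.qu] x

/-- At the parameter `-τ` the left branch has become nonpositive. -/
def CrossedLeft (H : ℝ → ℝ → ℝ) (S : ReturnPair) (τ : ℝ) : Prop :=
  ∀ x, (H (-τ))^[S.qw] x ≤ x + S.pw

/-- The branch which closes up when the parameter moves in the direction `d` has crossed the
diagonal after a displacement `τ`. -/
def Crossed (H : ℝ → ℝ → ℝ) (d : Bool) (τ : ℝ) (S : ReturnPair) : Prop :=
  if S.flipped = d then CrossedRight (orient S.flipped H) S τ
  else CrossedLeft (orient S.flipped H) S τ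

namespace Describes

theorem right_le (D : Describes σ H ξ S) (hirr : Irr (H 0) ξ) (x : ℝ) :
    (H 0)^[S.qu] x ≤ x + S.pu :=
  D.rect_zero.right_neg D.alg.l_pos D.alg.c_pos.le hirr.noLock D.qu_pos x

theorem le_left (D : Describes σ H ξ S) (hirr : Irr (H 0) ξ) (hR : 0 < S.X.R) (x : ℝ) :
    x + S.pw ≤ (H 0)^[S.qw] x :=
  D.rect_zero.left_pos D.alg.l_pos.le (r_pos D.alg) hirr.noLock (D.qw_pos hR) x

theorem crossedRight_moveTwo (hH : TranslationFamily H) (hirr : Irr (H 0) ξ)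
    (D : Describes σ H ξ S) (hR : 0 < S.X.R) (hτ : 0 ≤ τ) (h : CrossedRight H S τ) :
    CrossedRight H S.moveTwo τ := by
  intro x
  simp only [ReturnPair.moveTwo]
  rw [Function.iterate_add_apply]
  have h1 := h x
  have h2 := D.le_left hirr hR ((H τ)^[S.qu] x)
  have h3 := hH.iterate_le hτ S.qw ((H τ)^[S.qu] x)
  push_cast
  linarith

theorem iterate_le_of_crossedLeft (hH : TranslationFamily H) (hirr : Irr (H 0) ξ)
    (D : Describes σ H ξ S) (hτ : 0 ≤ τ) (h : CrossedLeft H S τ) (x : ℝ) :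
    (H (-τ))^[S.qu + S.qw] x ≤ x + (S.pu + S.pw : ℤ) := by
  rw [Function.iterate_add_apply]
  have h1 := h x
  have h2 := D.right_le hirr ((H (-τ))^[S.qw] x)
  have h3 := hH.iterate_le (neg_nonpos.2 hτ) S.qu ((H (-τ))^[S.qw] x)
  push_cast
  linarith

theorem crossedLeft_moveThree (h : CrossedRight H S τ) :
    CrossedLeft (reflect H) S.moveThree τ := by
  intro x
  simp only [ReturnPair.moveThree]
  rw [iterate_reflect, neg_neg]
  have h1 := h (-x)
  push_cast
  linarith

theorem crossedRight_moveThree (hH : TranslationFamily H) (hirr : Irr (H 0) ξ)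
    (D : Describes σ H ξ S) (hτ : 0 ≤ τ) (h : CrossedLeft H S τ) :
    CrossedRight (reflect H) S.moveThree τ := by
  intro x
  simp only [ReturnPair.moveThree]
  rw [iterate_reflect]
  have h1 := D.iterate_le_of_crossedLeft hH hirr hτ h (-x)
  push_cast at h1 ⊢
  linarith

theorem le_of_not_crossedRight (hH : TranslationFamily H) (D : Describes σ H ξ S) (hτ : 0 ≤ τ)
    (hN : NoLock (H τ)) (h : ¬ CrossedRight H S τ) : τ ≤ S.X.a * S.X.l := by
  have h1 := (hN S.qu D.qu_pos S.pu).resolve_left h S.X.r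
  have h2 := hH.iterate_add_le hτ D.qu_pos S.X.r
  rw [D.rect_zero.right' S.X.r (by have := D.alg.z_pos; simp only [r]; linarith) le_rfl] at h2
  have h3 := D.alg.rel
  simp only [r] at h1 h2
  linarith

theorem le_of_not_crossedLeft (hH : TranslationFamily H) (D : Describes σ H ξ S) (hτ : 0 ≤ τ)
    (hR : 0 < S.X.R) (hN : NoLock (H (-τ))) (h : ¬ CrossedLeft H S τ) :
    τ ≤ S.X.l - (S.X.a * S.X.l - S.X.r) := by
  have h1 := (hN S.qw (D.qw_pos hR) S.pw).resolve_right h (-S.X.l)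
  have h2 := hH.iterate_add_le (neg_nonpos.2 hτ) (D.qw_pos hR) (-S.X.l)
  rw [D.rect_zero.left _ le_rfl (by have := D.alg.l_pos; linarith)] at h2
  linarith

/-- A cell that is not bad opens a mode-locking interval of relative size at least `η`. -/
theorem exists_tongue (hH : TranslationFamily H) (D : Describes σ H ξ S) (hR : 0 < S.X.R)
    {η τ τ' : ℝ} (hτ : 0 ≤ τ) (hτ' : 0 ≤ τ') (hU : CrossedRight H S τ)
    (hW : CrossedLeft H S τ') (hB : ¬ S.X.Bad η) :
    ∃ q : ℕ, 1 ≤ q ∧ ∃ (p : ℤ) (t₁ t₂ : ℝ), (H t₁)^[q] 0 = p ∧ (H t₂)^[q] ξ = ξ + p ∧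
      t₁ ≠ 0 ∧ η * |t₁| ≤ |t₁ - t₂| ∧ -τ' ≤ t₁ ∧ t₁ ≤ τ := by
  have hL := D.alg.L_pos
  have hl := D.alg.l_pos
  have hr := r_pos D.alg
  have hYC : 0 < S.X.Y + S.X.C := add_pos_of_pos_of_nonneg D.alg.Y_pos D.alg.C_nonneg
  have hDw := D.alg.rate_pos hR
  rw [Bad, not_and_or] at hB
  rcases hB with hB | hB <;> push Not at hB <;> obtain ⟨hs, hB⟩ := hB
  · have h1 := D.right_zero hs
    have ht : 0 < S.X.l / S.X.L := div_pos hl hL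
    refine ⟨S.qu, D.qu_pos, S.pu, _, _, h1, D.right_break hs, ht.ne', ?_, by linarith, ?_⟩
    · have e : S.X.l / S.X.L - (S.X.y + S.X.c) / (S.X.Y + S.X.C) =
          (S.X.b - 1) * S.X.Δ / (S.X.L * (S.X.Y + S.X.C)) := by
        rw [div_sub_div _ _ hL.ne' hYC.ne']
        congr 1
        simp only [Δ, Y, y]
        ring
      rw [abs_of_pos ht, e, abs_div, abs_mul, abs_of_nonneg hs, abs_of_pos (mul_pos hL hYC),
        le_div_iff₀ (mul_pos hL hYC)]
      calc _ = η * (S.X.Y + S.X.C) * S.X.l := by field_simp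
        _ ≤ _ := hB
    · refine hH.le_of_iterate_le D.qu_pos (x := 0) ?_
      rw [h1]
      simpa using hU 0
  · have h1 := D.left_zero hR hs
    have ht : 0 < S.X.r / S.X.R := div_pos hr hR
    have hWn : 0 ≤ S.X.W := add_nonneg (mul_nonneg D.alg.c_pos.le hR.le)
      (mul_nonneg D.alg.C_nonneg hr.le)
    refine ⟨S.qw, D.qw_pos hR, S.pw, _, _, h1, D.left_break hR hs, neg_ne_zero.2 ht.ne', ?_, ?_,
      by linarith⟩
    · generalize hκ : 1 - S.X.a * S.X.b / S.X.g = κ at *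
      have e : -(S.X.r / S.X.R) - -((S.X.r - κ * S.X.c) / (S.X.R + κ * S.X.C)) =
          -(κ * S.X.W / (S.X.R * (S.X.R + κ * S.X.C))) := by
        rw [sub_neg_eq_add, neg_add_eq_sub, div_sub_div _ _ hDw.ne' hR.ne', ← neg_div,
          mul_comm S.X.R (S.X.R + κ * S.X.C)]
        congr 1
        simp only [W]
        ring
      rw [abs_neg, abs_of_pos ht, e, abs_neg, abs_div, abs_mul, abs_of_nonneg hWn,
        abs_of_pos (mul_pos hR hDw), le_div_iff₀ (mul_pos hR hDw)]
      calc _ = η * S.X.r * (S.X.R + κ * S.X.C) := by field_simp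
        _ ≤ _ := hB
    · refine hH.le_of_iterate_le (D.qw_pos hR) (x := 0) ?_
      rw [h1]
      simpa using hW 0

end Describes

namespace Valid

theorem crossed_step (hH : TranslationFamily H) (hirr : Irr (H 0) ξ) (V : S.Valid σ H ξ)
    (hR : 0 < S.X.R) {d : Bool} (hτ : 0 ≤ τ) (h : Crossed H d τ S) : Crossed H d τ S.step := by
  have hH' := hH.orient S.flipped
  have hirr' := hirr.orient S.flipped
  unfold Crossed at h
  rcases step_cases V.alg V.gen with ⟨h1, h2⟩ | ⟨h1, h2⟩ | ⟨h1, h3, h2⟩ <;> rw [h2] <;>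
    unfold Crossed
  · change if S.flipped = d then CrossedRight (orient S.flipped H) _ _
      else CrossedLeft (orient S.flipped H) _ _
    split_ifs at h ⊢ with hd
    · exact h
    · exact V.iterate_le_of_crossedLeft hH' hirr' hτ h
  · change if S.flipped = d then CrossedRight (orient S.flipped H) _ _
      else CrossedLeft (orient S.flipped H) _ _
    split_ifs at h ⊢ with hd
    · exact V.crossedRight_moveTwo hH' hirr' hR hτ h
    · exact h
  · change if (!S.flipped) = d then CrossedRight (orient (!S.flipped) H) _ _
      else CrossedLeft (orient (!S.flipped) H) _ _
    rw [orient_not]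
    by_cases hd : S.flipped = d
    · rw [if_pos hd] at h
      rw [if_neg (by revert hd; cases S.flipped <;> cases d <;> simp)]
      exact Describes.crossedLeft_moveThree h
    · rw [if_neg hd] at h
      rw [if_pos (by revert hd; cases S.flipped <;> cases d <;> simp)]
      exact V.crossedRight_moveThree hH' hirr' hτ h

theorem le_of_not_crossed_of_eq (hH : TranslationFamily H) (V : S.Valid σ H ξ) {d : Bool}
    (hτ : 0 ≤ τ) (hN : NoLock (orient d H τ)) (hd : S.flipped = d) (h : ¬ Crossed H d τ S) :
    τ ≤ S.X.a * S.X.l := by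
  rw [Crossed, if_pos hd] at h
  exact V.le_of_not_crossedRight (hH.orient _) hτ (hd ▸ hN) h

theorem le_of_not_crossed_of_ne (hH : TranslationFamily H) (V : S.Valid σ H ξ)
    (hR : 0 < S.X.R) {d : Bool} (hτ : 0 ≤ τ) (hN : NoLock (orient d H τ)) (hd : S.flipped ≠ d)
    (h : ¬ Crossed H d τ S) : τ ≤ S.X.l - (S.X.a * S.X.l - S.X.r) := by
  rw [Crossed, if_neg hd] at h
  have hd' : S.flipped = !d := by
    revert hd; cases S.flipped <;> cases d <;> simp
  refine V.le_of_not_crossedLeft (hH.orient _) hτ hR ?_ h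
  rw [hd', orient_not]
  exact hN.reflect_neg

end Valid

section Orbit

variable {S : ℕ → ReturnPair} {d : Bool}

theorem exists_crossed (hH : TranslationFamily H)
    (V : ∀ n, (S n).Valid σ H ξ) (hR : ∀ n, 0 < (S n).X.R) (hs : ∀ n, S (n + 1) = (S n).step)
    (hτ : 0 < τ) (hN : NoLock (orient d H τ)) : ∃ n, Crossed H d τ (S n) := by
  by_contra! hcon
  have hsX : ∀ n, (S (n + 1)).X = (S n).X.step := fun n => by rw [hs, step_X]
  let t : ℕ → ℝ := fun n => (S n).X.l + (S n).X.r
  have hone : ∀ n, S (n + 1) = (S n).moveOne → t (n + 1) = t n - (S n).X.a * (S n).X.l := by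
    intro n h
    simp only [t, h]
    change (S n).X.l + (S n).X.moveOne.r = _
    rw [moveOne_r]; ring
  have htwo : ∀ n, S (n + 1) = (S n).moveTwo →
      t (n + 1) = t n - ((S n).X.l - ((S n).X.a * (S n).X.l - (S n).X.r)) := by
    intro n h
    simp only [t, h]
    change ((S n).X.a * (S n).X.l - (S n).X.r) + (S n).X.r = _
    ring
  have hthree : ∀ n, S (n + 1) = (S n).moveThree → t (n + 1) = t n - (S n).X.a * (S n).X.l := by
    intro n h
    simp only [t, h]
    change ((S n).X.r - (S n).X.a * (S n).X.l) + (S n).X.moveThree.r = _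
    rw [moveThree_r]; ring
  have hal : ∀ n, 0 < (S n).X.a * (S n).X.l := fun n => mul_pos (V n).alg.a_pos (V n).alg.l_pos
  have hcut : ∀ n, 0 < (S n).X.l - ((S n).X.a * (S n).X.l - (S n).X.r) := fun n => by
    have h1 : _ = _ := moveTwo_cut (V n).alg.rel
    have := mul_pos (V n).alg.b_pos (V n).alg.c_pos
    have := mul_pos (V n).alg.g_pos (V n).alg.z_pos
    simp only [Cell.moveTwo] at h1
    linarith
  have key₁ : ∀ n, (S n).flipped = d → ∃ m, t m ≤ t n - τ := by
    intro n hn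
    by_contra! hm
    have hall : ∀ i, (S (n + i)).flipped = d ∧ t (n + i) ≤ t n ∧
        (S (n + i)).X.r < (S (n + i)).X.a * (S (n + i)).X.l := by
      have hstep : ∀ i, (S (n + i)).flipped = d → t (n + i) ≤ t n →
          (S (n + i)).X.r < (S (n + i)).X.a * (S (n + i)).X.l ∧
            S (n + i + 1) = (S (n + i)).moveTwo := by
        intro i h1 h2
        have h3 := (V (n + i)).le_of_not_crossed_of_eq hH hτ.le hN h1 (hcon _)
        have h4 := hm (n + i + 1)
        have h5 := hs (n + i)
        rcases step_cases (V (n + i)).alg (V (n + i)).gen with ⟨g1, g2⟩ | ⟨g1, g2⟩ | ⟨g1, g3, g2⟩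
        · have := hone _ (h5.trans g2); linarith
        · exact ⟨g1, h5.trans g2⟩
        · have := hthree _ (h5.trans g2); linarith
      intro i
      induction i with
      | zero => exact ⟨hn, le_rfl, (hstep 0 hn le_rfl).1⟩
      | succ i ih =>
        have h1 := (hstep i ih.1 ih.2.1).2
        have h2 : (S (n + (i + 1))).flipped = d := by rw [← add_assoc, h1]; exact ih.1
        have h3 : t (n + (i + 1)) ≤ t n := by
          have := htwo _ h1
          have := hcut (n + i)
          have := ih.2.1
          rw [← add_assoc]; linarith
        exact ⟨h2, h3, (hstep (i + 1) h2 h3).1⟩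
    obtain ⟨i, hi⟩ := exists_not_moveTwo (X := fun i => (S (n + i)).X) (fun i => (V _).alg)
      (fun i => hsX (n + i))
    exact hi (hall i).2.2
  have key₂ : ∀ n, (S n).flipped ≠ d → ∃ m, t m ≤ t n - τ := by
    intro n hn
    by_contra! hm
    have hall : ∀ i, (S (n + i)).flipped ≠ d ∧ t (n + i) ≤ t n ∧
        (S (n + i)).X.a * (S (n + i)).X.l < (S (n + i)).X.z := by
      have hstep : ∀ i, (S (n + i)).flipped ≠ d → t (n + i) ≤ t n →
          (S (n + i)).X.a * (S (n + i)).X.l < (S (n + i)).X.z ∧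
            S (n + i + 1) = (S (n + i)).moveOne := by
        intro i h1 h2
        have h3 := (V (n + i)).le_of_not_crossed_of_ne hH (hR _) hτ.le hN h1 (hcon _)
        have h4 := hm (n + i + 1)
        have h5 := hs (n + i)
        rcases step_cases (V (n + i)).alg (V (n + i)).gen with ⟨g1, g2⟩ | ⟨g1, g2⟩ | ⟨g1, g3, g2⟩
        · exact ⟨g1, h5.trans g2⟩
        · have := htwo _ (h5.trans g2); linarith
        · have h6 := hthree _ (h5.trans g2)
          have h7 := hal (n + i)
          have h8 : (S (n + i + 1)).flipped = d := by
            rw [h5.trans g2]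
            change (!(S (n + i)).flipped) = d
            revert h1
            cases (S (n + i)).flipped <;> cases d <;> simp
          obtain ⟨m, h9⟩ := key₁ _ h8
          have := hm m
          linarith
      intro i
      induction i with
      | zero => exact ⟨hn, le_rfl, (hstep 0 hn le_rfl).1⟩
      | succ i ih =>
        have h1 := (hstep i ih.1 ih.2.1).2
        have h2 : (S (n + (i + 1))).flipped ≠ d := by rw [← add_assoc, h1]; exact ih.1
        have h3 : t (n + (i + 1)) ≤ t n := by
          have := hone _ h1
          have := hal (n + i)
          have := ih.2.1
          rw [← add_assoc]; linarith
        exact ⟨h2, h3, (hstep (i + 1) h2 h3).1⟩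
    obtain ⟨i, hi⟩ := exists_not_moveOne (X := fun i => (S (n + i)).X) (fun i => (V _).alg)
      (fun i => (V _).gen) (fun i => hsX (n + i))
    exact hi (hall i).2.2
  have key : ∀ n, ∃ m, t m ≤ t n - τ := fun n => by
    by_cases h : (S n).flipped = d
    · exact key₁ n h
    · exact key₂ n h
  choose f hf using key
  obtain ⟨n, hn⟩ := exists_lt_sub_nat_mul (u := fun n => t (f^[n] 0)) hτ (fun n => by
    rw [Function.iterate_succ_apply']; exact hf _)
  have h1 : 0 < t (f^[n] 0) := add_pos (V _).alg.l_pos (r_pos (V _).alg)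
  exact hn.not_gt h1

theorem crossed_of_le (hH : TranslationFamily H) (hirr : Irr (H 0) ξ)
    (V : ∀ n, (S n).Valid σ H ξ) (hR : ∀ n, 0 < (S n).X.R) (hs : ∀ n, S (n + 1) = (S n).step)
    (hτ : 0 ≤ τ) {n m : ℕ} (hnm : n ≤ m) (h : Crossed H d τ (S n)) : Crossed H d τ (S m) := by
  induction m, hnm using Nat.le_induction with
  | base => exact h
  | succ m hm ih => rw [hs]; exact (V m).crossed_step hH hirr (hR m) hτ ih

end Orbit

/-- The return pair of a two-break map before any renormalization. -/
noncomputable def initial (H : ℝ → ℝ → ℝ) (ξ b g : ℝ) : ReturnPair where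
  flipped := false
  qu := 1
  qw := 0
  k := 0
  j := 1
  pu := ⌊H 0 0⌋ + 1
  pw := -1
  m := 0
  X := ⟨⌊H 0 0⌋ + 1 - H 0 0, ξ, 1 - ξ, 1, b, g, 1, 0, 0⟩

theorem initial_valid {b g : ℝ} (hH : TranslationFamily H) (hirr : Irr (H 0) ξ)
    (hξ : 0 < ξ) (hξ1 : ξ < 1) (hb : 0 < b) (hg : 0 < g) (hbg : b * ξ + g * (1 - ξ) = 1)
    (hσ : g = σ * b) (h₁ : ∀ x, 0 ≤ x → x ≤ ξ → H 0 x = H 0 0 + b * x)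
    (h₂ : ∀ x, ξ ≤ x → x ≤ 1 → H 0 x = H 0 0 + b * ξ + g * (x - ξ)) :
    (initial H ξ b g).Valid σ H ξ := by
  have hl : 0 < (⌊H 0 0⌋ : ℝ) + 1 - H 0 0 := by have := Int.lt_floor_add_one (H 0 0); linarith
  have alg : (initial H ξ b g).X.Alg σ := by
    refine ⟨hl, hξ, sub_pos.2 hξ1, one_pos, hb, hg, one_pos, le_rfl, ?_, le_rfl, ?_, ?_,
      Or.inl hσ, fun h => absurd h (lt_irrefl _)⟩
    · simp [initial, Y]
    · simp only [initial, y]; linear_combination hbg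
    · simp only [initial, Y, Z]; ring
  have rect : ∀ τ, Rect (H τ) ξ (initial H ξ b g) ((initial H ξ b g).X.at' τ) := by
    intro τ
    refine ⟨fun x h1 h2 => ?_, fun x h1 h2 => ?_, fun x h1 h2 => ?_, ?_⟩
    · simp only [initial, r, at', Z, Function.iterate_zero, id]; push_cast; ring
    · simp only [initial, at'] at h2
      rw [zero_mul, sub_zero] at h2
      simp only [initial, at', Function.iterate_one]
      rw [hH.shift, h₁ x h1 h2]; push_cast; ring
    · simp only [initial, at', r, Z] at h1 h2
      simp only [initial, at', y, Function.iterate_one]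
      rw [hH.shift, h₂ x (by linarith) (by linarith)]; push_cast; ring
    · simp [initial, at']
  have r0 := rect 0
  rw [at'_zero] at r0
  have gen := r0.gen (hH.map_add_one 0) (hH.mono 0) hirr rfl le_rfl alg.l_pos alg.c_pos alg.z_pos
  refine ⟨alg, gen, rfl, le_rfl, fun h => absurd h (lt_irrefl _), fun τ _ _ _ => rect τ,
    fun _ => ?_, fun h => absurd h (lt_irrefl _), fun h => absurd h (lt_irrefl _)⟩
  change (H _)^[1] ξ = ξ + ((⌊H 0 0⌋ + 1 : ℤ) : ℝ)
  rw [Function.iterate_one, hH.shift, h₁ ξ hξ.le le_rfl]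
  simp only [initial, y, Y]
  push_cast
  ring

theorem R_pos_step (V : S.Valid σ H ξ) (h : 0 < S.X.R ∨ ¬ S.X.r < S.X.a * S.X.l) :
    0 < S.step.X.R := by
  have hL := V.alg.L_pos
  have ha := V.alg.a_pos
  have hR := V.alg.R_nonneg
  rcases step_cases V.alg V.gen with ⟨h1, h2⟩ | ⟨h1, h2⟩ | ⟨h1, h3, h2⟩ <;> rw [h2]
  · exact add_pos_of_nonneg_of_pos hR (mul_pos ha hL)
  · exact h.resolve_right (not_not.2 h1)
  · exact hL

end ReturnPair

open ReturnPair in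
/-- Near every irrational parameter of a two-break family there is a mode-locking interval whose
length is comparable to its distance to that parameter. -/
theorem exists_tongue {σ : ℝ} (hσ : 0 < σ) (hσ1 : σ ≠ 1) :
    ∃ η : ℝ, 0 < η ∧ η < 1 ∧ ∀ (H : ℝ → ℝ → ℝ) (ξ b g : ℝ), TranslationFamily H →
      Irr (H 0) ξ → 0 < ξ → ξ < 1 → 0 < b → 0 < g → b * ξ + g * (1 - ξ) = 1 → g = σ * b →
      (∀ x, 0 ≤ x → x ≤ ξ → H 0 x = H 0 0 + b * x) →
      (∀ x, ξ ≤ x → x ≤ 1 → H 0 x = H 0 0 + b * ξ + g * (x - ξ)) →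
      ∀ τ τ', 0 < τ → 0 < τ' → NoLock (H τ) → NoLock (H (-τ')) →
      ∃ q : ℕ, 1 ≤ q ∧ ∃ (p : ℤ) (t₁ t₂ : ℝ), (H t₁)^[q] 0 = p ∧ (H t₂)^[q] ξ = ξ + p ∧
        t₁ ≠ 0 ∧ η * |t₁| ≤ |t₁ - t₂| ∧ -τ' ≤ t₁ ∧ t₁ ≤ τ := by
  obtain ⟨η, hη, hη1, hbad⟩ := Cell.exists_not_bad hσ hσ1
  refine ⟨η, hη, hη1, fun H ξ b g hH hirr hξ hξ1 hb hg hbg hgσ h₁ h₂ τ τ' hτ hτ' hN hN' => ?_⟩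
  let S : ℕ → ReturnPair := fun n => ReturnPair.step^[n + 1] (initial H ξ b g)
  have V₀ := initial_valid hH hirr hξ hξ1 hb hg hbg hgσ h₁ h₂
  have hs : ∀ n, S (n + 1) = (S n).step := fun n => Function.iterate_succ_apply' _ _ _
  have V : ∀ n, (S n).Valid σ H ξ := fun n => by
    induction n with
    | zero => exact V₀.step hH hirr
    | succ n ih => rw [hs]; exact ih.step hH hirr
  have hR : ∀ n, 0 < (S n).X.R := fun n => by
    induction n with
    | zero =>
      refine R_pos_step V₀ (Or.inr ?_)
      have := Int.floor_le (H 0 0)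
      simp only [initial, Cell.r]
      linarith
    | succ n ih => rw [hs]; exact R_pos_step (V n) (Or.inl ih)
  obtain ⟨n₁, hn₁⟩ := exists_crossed (d := false) hH V hR hs hτ hN
  have hN'' : NoLock (orient true H τ') := by
    have := hN'.reflect_neg
    rwa [neg_neg] at this
  obtain ⟨n₂, hn₂⟩ := exists_crossed (d := true) hH V hR hs hτ' hN''
  obtain ⟨n, hn⟩ := hbad (fun n => (S (max n₁ n₂ + n)).X) (fun n => (V _).alg)
    (fun n => (V _).gen) (fun n => hR _) (fun n => by rw [← step_X, ← hs, add_assoc])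
  generalize hi : max n₁ n₂ + n = i at *
  have c₁ := crossed_of_le hH hirr V hR hs hτ.le (show n₁ ≤ i by omega) hn₁
  have c₂ := crossed_of_le hH hirr V hR hs hτ'.le (show n₂ ≤ i by omega) hn₂
  have W := V i
  have hRi := hR i
  unfold Crossed at c₁ c₂
  unfold Valid at W
  cases hf : (S i).flipped <;> rw [hf] at c₁ c₂ W
  · simp only [if_true, Bool.false_eq_true, if_false] at c₁ c₂
    exact W.exists_tongue hH hRi hτ.le hτ'.le c₁ c₂ hn
  · simp only [Bool.true_eq_false, if_true, if_false] at c₁ c₂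
    obtain ⟨q, hq, p, t₁, t₂, h1, h2, h3, h4, h5, h6⟩ :=
      W.exists_tongue (hH.orient _) hRi hτ'.le hτ.le c₂ c₁ hn
    change (reflect H t₁)^[q] 0 = p at h1
    change (reflect H t₂)^[q] (-ξ) = -ξ + p at h2
    rw [iterate_reflect, neg_zero] at h1
    rw [iterate_reflect, neg_neg] at h2
    refine ⟨q, hq, -p, -t₁, -t₂, ?_, ?_, neg_ne_zero.2 h3, ?_, by linarith, by linarith⟩
    · push_cast; linarith
    · push_cast; linarith
    · rwa [abs_neg, neg_sub_neg, abs_sub_comm]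

/-- A measurable set of reals which has gaps of a fixed relative size at arbitrarily small scales
around all but countably many of its points is a null set. -/
theorem volume_eq_zero_of_porous {s E : Set ℝ} {κ : ℝ} (hs : MeasurableSet s) (hE : E.Countable)
    (hκ : 0 < κ) (h : ∀ t ∈ s, t ∉ E → ∀ ε > 0, ∃ r, 0 < r ∧ r ≤ ε ∧ ∃ u v, κ * r ≤ v - u ∧
      Set.Ioo u v ⊆ Metric.closedBall t r ∧ Disjoint s (Set.Ioo u v)) : volume s = 0 := by
  have hE0 : ∀ᵐ x ∂(volume.restrict s), x ∉ E :=
    ae_restrict_of_ae (compl_mem_ae_iff.2 (hE.measure_zero _))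
  have hfalse : ∀ᵐ _x ∂(volume.restrict s), False := by
    filter_upwards [Besicovitch.ae_tendsto_measure_inter_div volume s, ae_restrict_mem hs, hE0]
      with x hx hxs hxE
    have h1 : ENNReal.ofReal ((2 - κ) / 2) < 1 := by
      rw [ENNReal.ofReal_lt_one]; linarith
    have h2 := hx.eventually (lt_mem_nhds h1)
    rw [Filter.Eventually, mem_nhdsGT_iff_exists_Ioo_subset] at h2
    obtain ⟨δ, hδ, h3⟩ := h2
    obtain ⟨r, hr, hrδ, u, v, huv, hsub, hdisj⟩ := h x hxs hxE (δ / 2) (half_pos hδ)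
    have hδ' : (0 : ℝ) < δ := hδ
    have h4 : ENNReal.ofReal ((2 - κ) / 2) <
        volume (s ∩ Metric.closedBall x r) / volume (Metric.closedBall x r) :=
      h3 ⟨hr, by linarith⟩
    refine h4.not_ge ?_
    have h5 : s ∩ Metric.closedBall x r ⊆ Metric.closedBall x r \ Set.Ioo u v :=
      fun z hz => ⟨hz.2, fun hz' => Set.disjoint_left.1 hdisj hz.1 hz'⟩
    have h6 : volume (s ∩ Metric.closedBall x r) ≤ ENNReal.ofReal ((2 - κ) * r) := by
      refine (measure_mono h5).trans ?_
      rw [measure_sdiff hsub measurableSet_Ioo.nullMeasurableSet (by simp), Real.volume_closedBall,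
        Real.volume_Ioo, ← ENNReal.ofReal_sub _ ((mul_pos hκ hr).le.trans huv)]
      exact ENNReal.ofReal_le_ofReal (by linarith)
    rw [Real.volume_closedBall]
    refine ENNReal.div_le_of_le_mul (h6.trans ?_)
    rw [← ENNReal.ofReal_mul' (by positivity)]
    exact ENNReal.ofReal_le_ofReal (by linarith)
  rw [← Measure.restrict_apply_univ s]
  simpa [ae_iff] using hfalse

namespace TranslationFamily

variable {H : ℝ → ℝ → ℝ}

theorem translate (hH : TranslationFamily H) (t : ℝ) :
    TranslationFamily (fun τ => H (t + τ)) where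
  mono τ := hH.mono _
  map_add_one τ := hH.map_add_one _
  shift τ x := by rw [hH.shift' (t + 0) (t + τ)]; ring

theorem continuous_iterate (hH : TranslationFamily H) (hc : Continuous (H 0)) (n : ℕ) (x : ℝ) :
    Continuous fun t => (H t)^[n] x := by
  induction n with
  | zero => exact continuous_const
  | succ n ih =>
    simp only [Function.iterate_succ_apply']
    have : (fun t => H t ((H t)^[n] x)) = fun t => H 0 ((H t)^[n] x) + t := by
      funext t; exact hH.shift t _
    rw [this]
    exact (hc.comp ih).add continuous_id

theorem isClosed_noLock (hH : TranslationFamily H) (hc : Continuous (H 0)) :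
    IsClosed {t | NoLock (H t)} := by
  simp only [NoLock, Set.ofPred_forall]
  refine isClosed_iInter fun q => isClosed_iInter fun _ => isClosed_iInter fun p => ?_
  rw [Set.ofPred_or]
  simp only [Set.ofPred_forall]
  exact (isClosed_iInter fun x => isClosed_le continuous_const (hH.continuous_iterate hc q x)).union
    (isClosed_iInter fun x => isClosed_le (hH.continuous_iterate hc q x) continuous_const)

theorem subsingleton_iterate_eq (hH : TranslationFamily H) {q : ℕ} (hq : 1 ≤ q) (x y : ℝ) :
    {t | (H t)^[q] x = y}.Subsingleton := fun _ hs _ ht =>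
  le_antisymm (hH.le_of_iterate_le hq (hs.trans ht.symm).le)
    (hH.le_of_iterate_le hq (ht.trans hs.symm).le)

theorem countable_iterate_eq (hH : TranslationFamily H) (x y : ℝ) :
    {t | ∃ q : ℕ, 1 ≤ q ∧ ∃ p : ℤ, (H t)^[q] x = y + p}.Countable := by
  simp only [Set.ofPred_exists, Set.ofPred_and]
  refine Set.countable_iUnion fun q => ?_
  by_cases hq : 1 ≤ q
  · refine Set.Countable.mono Set.inter_subset_right ?_
    exact Set.countable_iUnion fun p => (hH.subsingleton_iterate_eq hq x _).countable
  · simp [hq]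

/-- No mode locking happens strictly between the parameters where the two breaks are periodic. -/
theorem not_noLock_of_between (hH : TranslationFamily H) {q : ℕ} (hq : 1 ≤ q) {p : ℤ}
    {x y s t u : ℝ} (hx : (H s)^[q] x = x + p) (hy : (H t)^[q] y = y + p)
    (hu : s < u ∧ u < t ∨ t < u ∧ u < s) : ¬ NoLock (H u) := by
  intro hN
  rcases hu with ⟨h1, h2⟩ | ⟨h1, h2⟩ <;> have h3 := hH.iterate_lt h1 hq <;>
    have h4 := hH.iterate_lt h2 hq <;> rcases hN q hq p with h | h
  · have := h y; have := h4 y; linarith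
  · have := h x; have := h3 x; linarith
  · have := h x; have := h4 x; linarith
  · have := h y; have := h3 y; linarith

end TranslationFamily

/-- In a two-break family with different slopes, almost every parameter is mode-locked. -/
theorem volume_noLock_eq_zero {H : ℝ → ℝ → ℝ} {ξ b g : ℝ} (hH : TranslationFamily H)
    (hc : Continuous (H 0)) (hξ : 0 < ξ) (hξ1 : ξ < 1) (hb : 0 < b) (hg : 0 < g)
    (hbg : b * ξ + g * (1 - ξ) = 1) (hne : g ≠ b)
    (h₁ : ∀ x, 0 ≤ x → x ≤ ξ → H 0 x = H 0 0 + b * x)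
    (h₂ : ∀ x, ξ ≤ x → x ≤ 1 → H 0 x = H 0 0 + b * ξ + g * (x - ξ)) :
    volume {t | NoLock (H t)} = 0 := by
  obtain ⟨η, hη, hη1, htongue⟩ :=
    exists_tongue (div_pos hg hb) (by rwa [Ne, div_eq_one_iff_eq hb.ne'])
  have hEc := ((hH.countable_iterate_eq 0 0).union (hH.countable_iterate_eq 0 ξ)).union
    ((hH.countable_iterate_eq ξ 0).union (hH.countable_iterate_eq ξ ξ))
  refine volume_eq_zero_of_porous (hH.isClosed_noLock hc).measurableSet hEc (half_pos hη) ?_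
  intro t ht htE ε hε
  simp only [Set.mem_union, Set.mem_ofPred_eq, not_or, not_exists, not_and] at htE
  obtain ⟨⟨e1, e2⟩, e3, e4⟩ := htE
  have hξp : ∀ p : ℤ, ξ ≠ p := by
    rintro p rfl
    have h1 : (0 : ℤ) < p := by exact_mod_cast hξ
    have h2 : p < (1 : ℤ) := by exact_mod_cast hξ1
    omega
  let K : ℝ → ℝ → ℝ := fun τ => H (t + τ)
  have hK : TranslationFamily K := hH.translate t
  have hK0 : ∀ x, K 0 x = H 0 x + t := fun x => by
    change H (t + 0) x = _; rw [add_zero]; exact hH.shift t x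
  have hirr : Irr (K 0) ξ := by
    have hKt : K 0 = H t := by simp only [K, add_zero]
    rw [hKt]
    refine ⟨ht, fun q hq p h => e1 q hq p (by rw [h, zero_add]), fun n p h => ?_,
      fun n p h => ?_, e4⟩
    · rcases Nat.eq_zero_or_pos n with rfl | hn
      · refine hξp (-p) ?_
        push_cast
        rw [Function.iterate_zero, id] at h
        linarith
      · exact e2 n hn p h
    · rcases Nat.eq_zero_or_pos n with rfl | hn
      · exact hξp p h
      · exact e3 n hn p (by rw [h, zero_add])
  by_cases hp : ∃ τ, 0 < τ ∧ τ < ε / 2 ∧ NoLock (K τ)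
  · by_cases hm : ∃ τ, 0 < τ ∧ τ < ε / 2 ∧ NoLock (K (-τ))
    · obtain ⟨τ, hτ, hτε, hN⟩ := hp
      obtain ⟨τ', hτ', hτε', hN'⟩ := hm
      obtain ⟨q, hq, p, t₁, t₂, f1, f2, f3, f4, f5, f6⟩ := htongue K ξ b g hK hirr hξ hξ1 hb hg hbg
        (by field_simp) (fun x hx hx' => by rw [hK0, hK0, h₁ x hx hx']; ring)
        (fun x hx hx' => by rw [hK0, hK0, h₂ x hx hx']; ring) τ τ' hτ hτ' hN hN'
      have ht1 : 0 < |t₁| := abs_pos.2 f3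
      have ht1ε : |t₁| ≤ ε / 2 := abs_le.2 ⟨by linarith, by linarith⟩
      have hηt : η * |t₁| ≤ |t₁| := by nlinarith
      have f1' : (K t₁)^[q] 0 = 0 + p := by rw [f1, zero_add]
      have habs := abs_le.1 (le_refl |t₁|)
      refine ⟨2 * |t₁|, by linarith, by linarith, ?_⟩
      rcases le_total t₁ t₂ with h12 | h12
      · rw [abs_of_nonpos (sub_nonpos.2 h12)] at f4
        refine ⟨t + t₁, t + t₁ + η * |t₁|, by linarith, fun z hz => ?_,
          Set.disjoint_right.2 fun z hz hzN => ?_⟩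
        · rw [Real.closedBall_eq_Icc]; constructor <;> linarith [hz.1, hz.2]
        · refine hK.not_noLock_of_between (u := z - t) hq f1' f2
            (Or.inl ⟨by linarith [hz.1], by linarith [hz.2]⟩) ?_
          simpa [K] using hzN
      · rw [abs_of_nonneg (sub_nonneg.2 h12)] at f4
        refine ⟨t + t₁ - η * |t₁|, t + t₁, by linarith, fun z hz => ?_,
          Set.disjoint_right.2 fun z hz hzN => ?_⟩
        · rw [Real.closedBall_eq_Icc]; constructor <;> linarith [hz.1, hz.2]
        · refine hK.not_noLock_of_between (u := z - t) hq f1' f2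
            (Or.inr ⟨by linarith [hz.1], by linarith [hz.2]⟩) ?_
          simpa [K] using hzN
    · refine ⟨ε / 2, by linarith, by linarith, t - ε / 2, t, by nlinarith, fun z hz => ?_,
        Set.disjoint_right.2 fun z hz hzN => hm ⟨t - z, by linarith [hz.2], by linarith [hz.1], ?_⟩⟩
      · rw [Real.closedBall_eq_Icc]; constructor <;> linarith [hz.1, hz.2]
      · simpa [K] using hzN
  · refine ⟨ε / 2, by linarith, by linarith, t, t + ε / 2, by nlinarith, fun z hz => ?_,
      Set.disjoint_right.2 fun z hz hzN => hp ⟨z - t, by linarith [hz.1], by linarith [hz.2], ?_⟩⟩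
    · rw [Real.closedBall_eq_Icc]; constructor <;> linarith [hz.1, hz.2]
    · simpa [K] using hzN

open scoped Topology

/-- The map `F` is affine and increasing near `x`. -/
def AffineNear (F : ℝ → ℝ) (x : ℝ) : Prop :=
  ∃ m, 0 < m ∧ ∀ᶠ z in 𝓝 x, F z = F x + m * (z - x)

theorem AffineNear.iterate {F : ℝ → ℝ} (hF : Continuous F) {x : ℝ} {n : ℕ}
    (h : ∀ i < n, AffineNear F (F^[i] x)) : AffineNear (F^[n]) x := by
  induction n with
  | zero => exact ⟨1, one_pos, Eventually.of_forall fun z => by simp⟩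
  | succ n ih =>
    obtain ⟨m, hm, h1⟩ := ih fun i hi => h i (hi.trans n.lt_succ_self)
    obtain ⟨m', hm', h2⟩ := h n n.lt_succ_self
    refine ⟨m' * m, mul_pos hm' hm, ?_⟩
    filter_upwards [h1, ((hF.iterate n).tendsto x).eventually h2] with z hz hz'
    rw [Function.iterate_succ_apply', Function.iterate_succ_apply', hz', hz]
    ring

theorem AffineNear.of_mem_Ioo {F : ℝ → ℝ} (hF : StrictMono F) {u v x : ℝ}
    (h : ∃ a b : ℝ, ∀ z ∈ Set.Icc u v, F z = a * z + b) (hx : x ∈ Set.Ioo u v) :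
    AffineNear F x := by
  obtain ⟨a, b, h⟩ := h
  have huv : u < v := hx.1.trans hx.2
  have h1 := hF huv
  rw [h u ⟨le_rfl, huv.le⟩, h v ⟨huv.le, le_rfl⟩] at h1
  refine ⟨a, ?_, ?_⟩
  · by_contra! ha
    have := mul_nonneg (neg_nonneg.2 ha) (sub_nonneg.2 huv.le)
    linarith
  · filter_upwards [Ioo_mem_nhds hx.1 hx.2] with z hz
    rw [h z ⟨hz.1.le, hz.2.le⟩, h x ⟨hx.1.le, hx.2.le⟩]
    ring

theorem AffineNear.add_int {F : ℝ → ℝ} (hper : ∀ x, F (x + 1) = F x + 1) {x : ℝ}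
    (h : AffineNear F x) (k : ℤ) : AffineNear F (x + k) := by
  obtain ⟨m, hm, h⟩ := h
  refine ⟨m, hm, ?_⟩
  have h1 : Tendsto (fun z : ℝ => z - k) (𝓝 (x + k)) (𝓝 x) := by
    have : Continuous fun z : ℝ => z - k := by fun_prop
    simpa using this.tendsto (x + k)
  filter_upwards [h1.eventually h] with z hz
  have h2 := map_add_int_of_map_add_one hper (z - k) k
  rw [sub_add_cancel, hz] at h2
  rw [h2, map_add_int_of_map_add_one hper x k]
  ring

theorem IsPiecewiseAffineTwoBreakLift.affineNear {x₁ x₂ y₁ y₂ : ℝ} {F : ℝ → ℝ}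
    (h : IsPiecewiseAffineTwoBreakLift x₁ x₂ y₁ y₂ F) {x : ℝ} (h₁ : ∀ k : ℤ, x ≠ x₁ + k)
    (h₂ : ∀ k : ℤ, x ≠ x₂ + k) : AffineNear F x := by
  obtain ⟨⟨-, hmono, hper⟩, -, -, ha, hb⟩ := h
  have hx : x = x₁ + Int.fract (x - x₁) + ⌊x - x₁⌋ := by
    have := Int.fract_add_floor (x - x₁); linarith
  have hf0 := Int.fract_nonneg (x - x₁)
  have hf1 := Int.fract_lt_one (x - x₁)
  have h1 : Int.fract (x - x₁) ≠ 0 := fun h => h₁ ⌊x - x₁⌋ (by rw [h] at hx; linarith)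
  have h2 : x₁ + Int.fract (x - x₁) ≠ x₂ := fun h => h₂ ⌊x - x₁⌋ (by rw [h] at hx; exact hx)
  rw [hx]
  refine AffineNear.add_int hper ?_ _
  have h3 := lt_of_le_of_ne hf0 h1.symm
  rcases lt_or_gt_of_ne h2 with h4 | h4
  · exact AffineNear.of_mem_Ioo hmono ha ⟨by linarith, h4⟩
  · exact AffineNear.of_mem_Ioo hmono hb ⟨h4, by linarith⟩

theorem circle_coe_eq_coe_iff {x y : ℝ} :
    (x : Circle1) = (y : Circle1) ↔ ∃ k : ℤ, x = y + k := by
  rw [← sub_eq_zero, ← AddCircle.coe_sub, AddCircle.coe_eq_zero_iff]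
  simp only [zsmul_eq_mul, mul_one]
  exact ⟨fun ⟨k, hk⟩ => ⟨k, by linarith⟩, fun ⟨k, hk⟩ => ⟨k, by linarith⟩⟩

theorem Induces.iterate {F : ℝ → ℝ} {f : Circle1 → Circle1} (h : Induces F f) (n : ℕ) :
    Induces F^[n] f^[n] := fun x => by
  induction n with
  | zero => rfl
  | succ n ih => rw [Function.iterate_succ_apply', Function.iterate_succ_apply', ih, h]

theorem topAttracting_of_contraction {φ : Circle1 → Circle1} {q : ℕ} (hq : 1 ≤ q) {x m ε : ℝ}
    (hε : 0 < ε) (hm0 : 0 ≤ m) (hm1 : m < 1)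
    (h : ∀ u : ℝ, |u| < ε → φ^[q] ((x + u : ℝ) : Circle1) = ((x + m * u : ℝ) : Circle1)) :
    TopAttracting φ (x : Circle1) := by
  refine ⟨q, hq, by simpa using h 0 (by simpa using hε),
    (fun z : ℝ => (z : Circle1)) '' Metric.ball x ε, ?_, ⟨x, Metric.mem_ball_self hε, rfl⟩, ?_⟩
  · exact QuotientAddGroup.isOpenMap_coe _ Metric.isOpen_ball
  · rintro _ ⟨z, hz, rfl⟩
    rw [Metric.mem_ball, Real.dist_eq] at hz
    have key : ∀ n : ℕ, φ^[q * n] (z : Circle1) = ((x + m ^ n * (z - x) : ℝ) : Circle1) := by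
      intro n
      induction n with
      | zero => simp
      | succ n ih =>
        rw [mul_add, mul_one, add_comm, Function.iterate_add_apply, ih, h, pow_succ']
        · ring_nf
        · rw [abs_mul, abs_of_nonneg (pow_nonneg hm0 n)]
          exact (mul_le_of_le_one_left (abs_nonneg _) (pow_le_one₀ hm0 hm1.le)).trans_lt hz
    simp only [key]
    have h1 : Tendsto (fun n : ℕ => x + m ^ n * (z - x)) atTop (𝓝 x) := by
      simpa using ((tendsto_pow_atTop_nhds_zero_of_lt_one hm0 hm1).mul_const (z - x)).const_add x
    exact ((AddCircle.continuous_mk' 1).tendsto x).comp h1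

namespace IsLift

variable {F : ℝ → ℝ} {f : Circle1 → Circle1}

theorem surjective (hF : IsLift F) : Function.Surjective F := by
  refine hF.1.surjective ?_ ?_
  · refine tendsto_atTop.2 fun b => ?_
    filter_upwards [eventually_ge_atTop (⌈b - F 0⌉ : ℝ)] with x hx
    have h1 := hF.2.1.monotone hx
    have h2 := map_add_int_of_map_add_one hF.2.2 0 ⌈b - F 0⌉
    have h3 := Int.le_ceil (b - F 0)
    rw [zero_add] at h2
    linarith
  · refine tendsto_atBot.2 fun b => ?_
    filter_upwards [eventually_le_atBot (⌊b - F 0⌋ : ℝ)] with x hx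
    have h1 := hF.2.1.monotone hx
    have h2 := map_add_int_of_map_add_one hF.2.2 0 ⌊b - F 0⌋
    have h3 := Int.floor_le (b - F 0)
    rw [zero_add] at h2
    linarith

theorem bijective (hF : IsLift F) (hf : Induces F f) : Function.Bijective f := by
  constructor
  · intro u v
    induction u using QuotientAddGroup.induction_on with | _ x
    induction v using QuotientAddGroup.induction_on with | _ y
    intro h
    rw [hf, hf, circle_coe_eq_coe_iff] at h
    obtain ⟨k, hk⟩ := h
    rw [← map_add_int_of_map_add_one hF.2.2] at hk
    exact circle_coe_eq_coe_iff.2 ⟨k, hF.2.1.injective hk⟩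
  · intro v
    induction v using QuotientAddGroup.induction_on with | _ y
    obtain ⟨x, rfl⟩ := hF.surjective y
    exact ⟨x, hf x⟩

/-- All periodic points have the same rotation number and hence the same period. -/
theorem iterate_eq_of_iterate_eq (hF : IsLift F) {q q' : ℕ} (hq : 1 ≤ q) (hq' : 1 ≤ q') {p p' : ℤ}
    {x x' : ℝ} (h : F^[q] x = x + p) (h' : F^[q'] x' = x' + p') : F^[q] x' = x' + p := by
  let φ : CircleDeg1Lift := ⟨⟨F, hF.2.1.monotone⟩, hF.2.2⟩
  have hφ : ∀ n z, (φ ^ n) z = F^[n] z := fun n z => by rw [CircleDeg1Lift.coe_pow]; rfl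
  have h1 := φ.translationNumber_of_map_pow_eq_add_int ((hφ q x).trans h) hq
  have h2 := φ.translationNumber_of_map_pow_eq_add_int ((hφ q' x').trans h') hq'
  have hq0 : (0 : ℝ) < q := by exact_mod_cast hq
  have hq0' : (0 : ℝ) < q' := by exact_mod_cast hq'
  rw [h1, div_eq_div_iff hq0.ne' hq0'.ne'] at h2
  rw [← hφ, ← CircleDeg1Lift.iterate_pos_eq_iff (φ ^ q) hq', ← CircleDeg1Lift.coe_pow, ← pow_mul,
    mul_comm q, pow_mul, CircleDeg1Lift.coe_pow, mul_comm, h2, mul_comm,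
    CircleDeg1Lift.iterate_pos_eq_iff _ hq, hφ, h']

theorem exists_periodic_of_not_noLock (hF : IsLift F) (h : ¬ NoLock F) :
    ∃ q : ℕ, 1 ≤ q ∧ ∃ (p : ℤ) (x : ℝ), F^[q] x = x + p := by
  simp only [NoLock, not_forall, not_or, not_le] at h
  obtain ⟨q, hq, p, ⟨x, hx⟩, y, hy⟩ := h
  obtain ⟨z, -, hz⟩ := intermediate_value_uIcc (a := x) (b := y) (f := fun z => F^[q] z - z - p)
    (((hF.1.iterate q).sub continuous_id).sub continuous_const).continuousOn
    (show (0 : ℝ) ∈ _ by rw [Set.mem_uIcc]; left; constructor <;> linarith)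
  exact ⟨q, hq, p, z, by simp only at hz; linarith⟩

end IsLift

/-- A periodic two-break map whose breaks are not periodic is Morse–Smale. -/
theorem IsPiecewiseAffineTwoBreakLift.morseSmale {x₁ x₂ y₁ y₂ : ℝ} {F : ℝ → ℝ}
    {f : Circle1 → Circle1} (h : IsPiecewiseAffineTwoBreakLift x₁ x₂ y₁ y₂ F) (hf : Induces F f)
    (h₁ : ∀ q : ℕ, 1 ≤ q → ∀ p : ℤ, F^[q] x₁ ≠ x₁ + p)
    (h₂ : ∀ q : ℕ, 1 ≤ q → ∀ p : ℤ, F^[q] x₂ ≠ x₂ + p) (hN : ¬ NoLock F) : MorseSmale f := by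
  have hF : IsLift F := h.1
  obtain ⟨q, hq, p, x₀, hx₀⟩ := hF.exists_periodic_of_not_noLock hN
  have hcont : Continuous F^[q] := hF.1.iterate q
  have hne : ∀ b : ℝ, (∀ q : ℕ, 1 ≤ q → ∀ p : ℤ, F^[q] b ≠ b + p) → ∀ x, F^[q] x = x + p →
      ∀ (i : ℕ) (k : ℤ), F^[i] x ≠ b + k := by
    intro b hb x hx i k hi
    have h3 : F^[q] (F^[i] x) = F^[i] x + p := by
      rw [← Function.iterate_add_apply, add_comm, Function.iterate_add_apply, hx,
        iterate_add_int hF.2.2]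
    rw [hi, iterate_add_int hF.2.2] at h3
    exact hb q hq p (by linarith)
  have haff : ∀ x, F^[q] x = x + p → ∃ m, 0 < m ∧ ∀ᶠ z in 𝓝 x, F^[q] z = x + p + m * (z - x) := by
    intro x hx
    obtain ⟨m, hm, h3⟩ := AffineNear.iterate (n := q) hF.1
      fun i _ => h.affineNear (hne x₁ h₁ x hx i) (hne x₂ h₂ x hx i)
    exact ⟨m, hm, by rwa [hx] at h3⟩
  have hisol : ∀ x m, m ≠ 1 → (∀ᶠ z in 𝓝 x, F^[q] z = x + p + m * (z - x)) →
      ∀ᶠ z in 𝓝 x, F^[q] z = z + p → z = x := by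
    intro x m hm h3
    filter_upwards [h3] with z hz hz'
    have h4 : (m - 1) * (z - x) = 0 := by linarith
    rcases mul_eq_zero.1 h4 with h5 | h5
    · exact absurd (by linarith) hm
    · linarith
  have hclosed : IsClosed {x | F^[q] x = x + p} :=
    isClosed_eq hcont (continuous_id.add continuous_const)
  have hA : {x | ∀ᶠ z in 𝓝 x, F^[q] z = z + p} = ∅ := by
    have hopen : IsOpen {x | ∀ᶠ z in 𝓝 x, F^[q] z = z + p} := isOpen_setOfPred_eventually_nhds
    have hclo : IsClosed {x | ∀ᶠ z in 𝓝 x, F^[q] z = z + p} := by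
      refine isClosed_of_closure_subset fun x hx => ?_
      have hxF : F^[q] x = x + p :=
        closure_minimal (fun z hz => Eventually.self_of_nhds hz) hclosed hx
      obtain ⟨m, hm, h3⟩ := haff x hxF
      by_cases hm1 : m = 1
      · subst hm1
        change ∀ᶠ z in 𝓝 x, F^[q] z = z + p
        filter_upwards [h3] with z hz
        rw [hz]; ring
      · obtain ⟨U, hU, hUo, hxU⟩ := eventually_nhds_iff.1 (hisol x m hm1 h3)
        obtain ⟨z, hzU, hz⟩ := mem_closure_iff.1 hx U hUo hxU
        have hz' : ∀ᶠ w in 𝓝 z, F^[q] w = w + p := hz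
        have h4 : z = x := hU z hzU hz'.self_of_nhds
        exact h4 ▸ hz
    rcases isClopen_iff.1 ⟨hclo, hopen⟩ with h3 | h3
    · exact h3
    · have h4 : x₁ ∈ {x | ∀ᶠ z in 𝓝 x, F^[q] z = z + p} := h3 ▸ Set.mem_univ _
      exact absurd (Eventually.self_of_nhds h4) (h₁ q hq p)
  have hslope : ∀ x, F^[q] x = x + p → ∃ m, 0 < m ∧ m ≠ 1 ∧
      ∀ᶠ z in 𝓝 x, F^[q] z = x + p + m * (z - x) := by
    intro x hx
    obtain ⟨m, hm, h3⟩ := haff x hx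
    refine ⟨m, hm, ?_, h3⟩
    rintro rfl
    have h4 : x ∈ {x | ∀ᶠ z in 𝓝 x, F^[q] z = z + p} := by
      change ∀ᶠ z in 𝓝 x, F^[q] z = z + p
      filter_upwards [h3] with z hz
      rw [hz]; ring
    rw [hA] at h4
    exact h4
  have hfix : ∀ x : ℝ, (∃ n : ℕ, 1 ≤ n ∧ f^[n] (x : Circle1) = x) → F^[q] x = x + p := by
    rintro x ⟨n, hn, h3⟩
    rw [hf.iterate n, circle_coe_eq_coe_iff] at h3
    obtain ⟨k, hk⟩ := h3
    exact hF.iterate_eq_of_iterate_eq hq hn hx₀ hk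
  refine ⟨⟨(x₀ : Circle1), q, hq, ?_⟩, ?_, ?_⟩
  · rw [hf.iterate q, hx₀]
    exact circle_coe_eq_coe_iff.2 ⟨p, rfl⟩
  · have hfin : ({x | F^[q] x = x + p} ∩ Set.Icc 0 1).Finite := by
      by_contra hinf
      obtain ⟨x, -, hx⟩ := Set.Infinite.exists_accPt_of_subset_isCompact hinf
        (isCompact_Icc (a := (0 : ℝ)) (b := 1)) Set.inter_subset_right
      rw [accPt_iff_frequently] at hx
      have hxF : F^[q] x = x + p :=
        hclosed.closure_subset (mem_closure_iff_frequently.2 (hx.mono fun z hz => hz.2.1))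
      obtain ⟨m, -, hm, h3⟩ := hslope x hxF
      obtain ⟨z, hz, hz'⟩ := (hx.and_eventually (hisol x m hm h3)).exists
      exact hz.1 (hz' hz.2.1)
    refine (hfin.image fun x : ℝ => (x : Circle1)).subset ?_
    intro u hu
    induction u using QuotientAddGroup.induction_on with | _ x
    have hx := hfix x hu
    refine ⟨Int.fract x, ⟨?_, Int.fract_nonneg x, (Int.fract_lt_one x).le⟩, ?_⟩
    · change F^[q] (Int.fract x) = Int.fract x + p
      have h3 := iterate_add_int hF.2.2 q (Int.fract x) ⌊x⌋
      rw [Int.fract_add_floor, hx] at h3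
      have := Int.fract_add_floor x
      linarith
    · exact circle_coe_eq_coe_iff.2 ⟨-⌊x⌋, by push_cast; rw [Int.fract]; ring⟩
  · intro u hu
    induction u using QuotientAddGroup.induction_on with | _ x
    obtain ⟨m, hm0, hm1, h3⟩ := hslope x (hfix x hu)
    obtain ⟨ε, hε, h4⟩ := Metric.eventually_nhds_iff.1 h3
    have h5 : ∀ u : ℝ, |u| < ε → f^[q] ((x + u : ℝ) : Circle1) = ((x + m * u : ℝ) : Circle1) := by
      intro u hu
      rw [hf.iterate q, h4 (by rw [Real.dist_eq]; simpa using hu)]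
      exact circle_coe_eq_coe_iff.2 ⟨p, by ring⟩
    rcases lt_or_gt_of_ne hm1 with hm | hm
    · exact Or.inl (topAttracting_of_contraction hq hε hm0.le hm h5)
    · right
      let e : Circle1 ≃ Circle1 := Equiv.ofBijective f (hF.bijective hf)
      refine ⟨e.symm, e.symm_apply_apply, e.apply_symm_apply,
        topAttracting_of_contraction hq hε (inv_nonneg.2 hm0.le) (inv_lt_one_of_one_lt₀ hm) ?_⟩
      intro u hu
      have hu' : |m⁻¹ * u| < ε := by
        rw [abs_mul, abs_of_pos (inv_pos.2 hm0)]
        exact (mul_le_of_le_one_left (abs_nonneg _) (inv_le_one_of_one_le₀ hm.le)).trans_lt hu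
      have h6 := h5 _ hu'
      rw [mul_inv_cancel_left₀ hm0.ne'] at h6
      have h7 : Function.LeftInverse e.symm f := e.symm_apply_apply
      rw [← h6]
      exact h7.iterate q _

/-- The lift with breaks `0` and `ξ` that fixes `0` and sends `ξ` to `η`. -/
noncomputable def unitTwoBreak (ξ η u : ℝ) : ℝ :=
  ⌊u⌋ + (η / ξ * min (Int.fract u) ξ + (1 - η) / (1 - ξ) * max (Int.fract u - ξ) 0)

section UnitTwoBreak

variable {ξ η : ℝ}

theorem unitTwoBreak_add_one (ξ η u : ℝ) : unitTwoBreak ξ η (u + 1) = unitTwoBreak ξ η u + 1 := by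
  simp only [unitTwoBreak, Int.fract_add_one, Int.floor_add_one]
  push_cast
  ring

theorem continuous_unitTwoBreak (hξ : 0 < ξ) (hξ1 : ξ < 1) : Continuous (unitTwoBreak ξ η) := by
  have h1 : (1 : ℝ) - ξ ≠ 0 := by linarith
  have h : Continuous ((fun s => η / ξ * min s ξ + (1 - η) / (1 - ξ) * max (s - ξ) 0 - s) ∘
      (Int.fract : ℝ → ℝ)) := by
    refine ContinuousOn.comp_fract'' (Continuous.continuousOn (by fun_prop)) ?_
    rw [min_eq_left hξ.le, max_eq_right (by linarith), min_eq_right hξ1.le,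
      max_eq_left (by linarith)]
    field_simp
    ring
  refine (continuous_id.add h).congr fun u => ?_
  simp only [unitTwoBreak, Pi.add_apply, Function.comp, id]
  linarith [Int.floor_add_fract u]

theorem unitTwoBreak_of_le (hξ1 : ξ < 1) {u : ℝ} (hu : 0 ≤ u) (hu1 : u ≤ ξ) :
    unitTwoBreak ξ η u = η / ξ * u := by
  have hf : Int.fract u = u := Int.fract_eq_self.2 ⟨hu, by linarith⟩
  have hfl : ⌊u⌋ = 0 := Int.floor_eq_zero_iff.2 ⟨hu, by linarith⟩
  simp [unitTwoBreak, hf, hfl, hu1]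

theorem unitTwoBreak_of_ge (hξ : 0 < ξ) (hξ1 : ξ < 1) {u : ℝ} (hu : ξ ≤ u) (hu1 : u ≤ 1) :
    unitTwoBreak ξ η u = η / ξ * ξ + (1 - η) / (1 - ξ) * (u - ξ) := by
  have h1 : (1 : ℝ) - ξ ≠ 0 := by linarith
  rcases hu1.eq_or_lt with rfl | hu1
  · have := unitTwoBreak_add_one ξ η 0
    rw [zero_add, unitTwoBreak_of_le hξ1 le_rfl hξ.le] at this
    rw [this]
    field_simp
    ring
  · have hf : Int.fract u = u := Int.fract_eq_self.2 ⟨by linarith, by linarith⟩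
    have hfl : ⌊u⌋ = 0 := Int.floor_eq_zero_iff.2 ⟨by linarith, by linarith⟩
    simp [unitTwoBreak, hf, hfl, hu]

theorem strictMono_unitTwoBreak (hξ : 0 < ξ) (hξ1 : ξ < 1) (hη : 0 < η) (hη1 : η < 1) :
    StrictMono (unitTwoBreak ξ η) := by
  have hb : 0 < η / ξ := div_pos hη hξ
  have hg : 0 < (1 - η) / (1 - ξ) := div_pos (by linarith) (by linarith)
  have hmono : ∀ s t : ℝ, s < t →
      η / ξ * min s ξ + (1 - η) / (1 - ξ) * max (s - ξ) 0 <
        η / ξ * min t ξ + (1 - η) / (1 - ξ) * max (t - ξ) 0 := by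
    intro s t hst
    rcases lt_or_ge s ξ with h | h
    · have h1 : min s ξ < min t ξ := by rw [min_eq_left h.le]; exact lt_min hst h
      have h2 : max (s - ξ) 0 ≤ max (t - ξ) 0 := max_le_max (by linarith) le_rfl
      exact add_lt_add_of_lt_of_le (mul_lt_mul_of_pos_left h1 hb)
        (mul_le_mul_of_nonneg_left h2 hg.le)
    · rw [min_eq_right h, min_eq_right (by linarith), max_eq_left (by linarith),
        max_eq_left (by linarith)]
      exact add_lt_add_right (mul_lt_mul_of_pos_left (by linarith) hg) _
  intro u v huv
  rcases (Int.floor_mono huv.le).eq_or_lt with h | h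
  · have : Int.fract u < Int.fract v := by
      have h' : (⌊u⌋ : ℝ) = ⌊v⌋ := by exact_mod_cast h
      linarith [Int.floor_add_fract u, Int.floor_add_fract v]
    simp only [unitTwoBreak, h]
    exact add_lt_add_right (hmono _ _ this) _
  · have h' : (⌊u⌋ : ℝ) + 1 ≤ ⌊v⌋ := by exact_mod_cast h
    have h1 := hmono _ _ (Int.fract_lt_one u)
    have h2 : 0 ≤ η / ξ * min (Int.fract v) ξ + (1 - η) / (1 - ξ) * max (Int.fract v - ξ) 0 :=
      add_nonneg (mul_nonneg hb.le (le_min (Int.fract_nonneg v) hξ.le))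
        (mul_nonneg hg.le (le_max_right _ _))
    have h3 : η / ξ * min 1 ξ + (1 - η) / (1 - ξ) * max (1 - ξ) 0 = 1 := by
      have h4 : (1 : ℝ) - ξ ≠ 0 := by linarith
      rw [min_eq_right hξ1.le, max_eq_left (by linarith)]
      field_simp
      ring
    simp only [unitTwoBreak]
    linarith

theorem measurable_unitTwoBreak :
    Measurable fun z : ℝ × ℝ × ℝ => unitTwoBreak z.1 z.2.1 z.2.2 := by
  unfold unitTwoBreak
  have h1 : Measurable fun z : ℝ × ℝ × ℝ => Int.fract z.2.2 :=
    measurable_fract.comp measurable_snd.snd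
  have h2 : Measurable fun z : ℝ × ℝ × ℝ => (⌊z.2.2⌋ : ℝ) := by
    have : Measurable fun n : ℤ => (n : ℝ) := measurable_from_top
    exact this.comp (Int.measurable_floor.comp measurable_snd.snd)
  fun_prop

end UnitTwoBreak

/-- The two-break lift with parameter `p`, conjugated so that its first break is at `0`. -/
noncomputable def centeredTwoBreak (p : ℝ × ℝ × ℝ × ℝ) (u : ℝ) : ℝ :=
  p.2.2.1 - p.1 + unitTwoBreak (p.2.1 - p.1) (p.2.2.2 - p.2.2.1) u

theorem centeredTwoBreak_shift (p : ℝ × ℝ × ℝ × ℝ) (t u : ℝ) :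
    centeredTwoBreak (p + (0, 0, t, t)) u = centeredTwoBreak p u + t := by
  simp only [centeredTwoBreak, Prod.fst_add, Prod.snd_add, add_zero, add_sub_add_right_eq_sub]
  ring

theorem measurable_iterate_centeredTwoBreak (n : ℕ) {c : ℝ × ℝ × ℝ × ℝ → ℝ} (hc : Measurable c) :
    Measurable fun p => (centeredTwoBreak p)^[n] (c p) := by
  induction n with
  | zero => exact hc
  | succ n ih =>
    simp only [Function.iterate_succ_apply']
    have h : Measurable fun p : ℝ × ℝ × ℝ × ℝ =>
        (p.2.1 - p.1, p.2.2.2 - p.2.2.1, (centeredTwoBreak p)^[n] (c p)) := by fun_prop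
    exact (measurable_snd.snd.fst.sub measurable_fst).add (measurable_unitTwoBreak.comp h)

theorem IsPiecewiseAffineTwoBreakLift.eq_unitTwoBreak {x₁ x₂ y₁ y₂ : ℝ} {F : ℝ → ℝ}
    (h : IsPiecewiseAffineTwoBreakLift x₁ x₂ y₁ y₂ F) (h₁₂ : x₁ < x₂) (h₂₁ : x₂ < x₁ + 1) (x : ℝ) :
    F x = y₁ + unitTwoBreak (x₂ - x₁) (y₂ - y₁) (x - x₁) := by
  obtain ⟨⟨-, -, hper⟩, hF₁, hF₂, ⟨a, b, hab⟩, c, d, hcd⟩ := h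
  have hξ : 0 < x₂ - x₁ := by linarith
  have hξ' : (1 : ℝ) - (x₂ - x₁) ≠ 0 := by linarith
  have e1 := hab x₁ ⟨le_rfl, h₁₂.le⟩
  have e2 := hab x₂ ⟨h₁₂.le, le_rfl⟩
  have e3 := hcd x₂ ⟨le_rfl, h₂₁.le⟩
  have e4 := hcd (x₁ + 1) ⟨h₂₁.le, le_rfl⟩
  rw [hper] at e4
  have ha : (y₂ - y₁) / (x₂ - x₁) = a := by
    rw [div_eq_iff hξ.ne']; linarith
  have hc : (1 - (y₂ - y₁)) / (1 - (x₂ - x₁)) = c := by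
    rw [div_eq_iff hξ']; linarith
  have hs0 := Int.fract_nonneg (x - x₁)
  have hs1 := Int.fract_lt_one (x - x₁)
  have hx : F x = F (x₁ + Int.fract (x - x₁)) + ⌊x - x₁⌋ := by
    rw [← map_add_int_of_map_add_one hper]
    congr 1
    linarith [Int.floor_add_fract (x - x₁)]
  rw [hx, unitTwoBreak, ha, hc]
  rcases le_total (Int.fract (x - x₁)) (x₂ - x₁) with hs | hs
  · rw [hab _ ⟨by linarith, by linarith⟩, min_eq_left hs, max_eq_right (by linarith)]
    linarith
  · rw [hcd _ ⟨by linarith, by linarith⟩, min_eq_right hs, max_eq_left (by linarith)]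
    linarith

theorem iterate_eq_of_translate {F h : ℝ → ℝ} {c : ℝ} (hF : ∀ x, F x = h (x - c) + c) (n : ℕ)
    (x : ℝ) : F^[n] x = h^[n] (x - c) + c := by
  induction n with
  | zero => simp
  | succ n ih => rw [Function.iterate_succ_apply', Function.iterate_succ_apply', ih, hF]; simp

theorem noLock_of_translate {F h : ℝ → ℝ} {c : ℝ} (hF : ∀ x, F x = h (x - c) + c) (hN : NoLock F) :
    NoLock h := by
  intro q hq p
  refine (hN q hq p).imp (fun H x => ?_) (fun H x => ?_) <;>
    · have := H (x + c)
      rw [iterate_eq_of_translate hF, add_sub_cancel_right] at this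
      linarith

theorem noLock_of_forall_rat {h : ℝ → ℝ} (hc : Continuous h)
    (H : ∀ q : ℕ, 1 ≤ q → ∀ p : ℤ, (∀ x : ℚ, (x : ℝ) + p ≤ h^[q] x) ∨
      (∀ x : ℚ, h^[q] (x : ℝ) ≤ x + p)) : NoLock h := by
  have hd : DenseRange ((↑) : ℚ → ℝ) := Rat.denseRange_cast
  intro q hq p
  have hcq := hc.iterate q
  refine (H q hq p).imp (fun H x => ?_) (fun H x => ?_)
  · exact hd.induction_on x (isClosed_le (by fun_prop) hcq) H
  · exact hd.induction_on x (isClosed_le hcq (by fun_prop)) H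

/-- The admissible parameters with different slopes for which a break is periodic or the lift is
not mode-locked. -/
def exceptionalParameters : Set (ℝ × ℝ × ℝ × ℝ) :=
  {p | ((p.1 < p.2.1 ∧ p.2.1 < p.1 + 1) ∧ (p.2.2.1 < p.2.2.2 ∧ p.2.2.2 < p.2.2.1 + 1) ∧
      p.2.2.2 - p.2.2.1 ≠ p.2.1 - p.1) ∧
    ((∃ q : ℕ, 1 ≤ q ∧ ∃ n : ℤ, (centeredTwoBreak p)^[q] 0 = 0 + n) ∨
      (∃ q : ℕ, 1 ≤ q ∧ ∃ n : ℤ, (centeredTwoBreak p)^[q] (p.2.1 - p.1) = p.2.1 - p.1 + n) ∨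
      ∀ q : ℕ, 1 ≤ q → ∀ n : ℤ, (∀ x : ℚ, (x : ℝ) + n ≤ (centeredTwoBreak p)^[q] x) ∨
        (∀ x : ℚ, (centeredTwoBreak p)^[q] (x : ℝ) ≤ x + n))}

theorem measurableSet_exceptionalParameters : MeasurableSet exceptionalParameters := by
  have hit (n : ℕ) (x : ℝ) := measurable_iterate_centeredTwoBreak n (measurable_const (a := x))
  have hξ : Measurable fun p : ℝ × ℝ × ℝ × ℝ => p.2.1 - p.1 := by fun_prop
  simp only [exceptionalParameters, Set.ofPred_and, Set.ofPred_or, Set.ofPred_exists,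
    Set.ofPred_forall]
  refine .inter (.inter (.inter ?_ ?_) (.inter (.inter ?_ ?_) ?_)) (.union ?_ (.union ?_ ?_))
  · exact measurableSet_lt (by fun_prop) (by fun_prop)
  · exact measurableSet_lt (by fun_prop) (by fun_prop)
  · exact measurableSet_lt (by fun_prop) (by fun_prop)
  · exact measurableSet_lt (by fun_prop) (by fun_prop)
  · exact (measurableSet_eq_fun (by fun_prop) hξ).compl
  · exact .iUnion fun q => .inter (.const _) (.iUnion fun n =>
      measurableSet_eq_fun (hit q 0) measurable_const)
  · exact .iUnion fun q => .inter (.const _) (.iUnion fun n =>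
      measurableSet_eq_fun (measurable_iterate_centeredTwoBreak q hξ) (hξ.add_const _))
  · exact .iInter fun q => .iInter fun _ => .iInter fun n => .union
      (.iInter fun x => measurableSet_le measurable_const (hit q x))
      (.iInter fun x => measurableSet_le (hit q x) measurable_const)

/-- The exceptional parameters are negligible along every line on which the lift varies by
translations. -/
theorem volume_slice_exceptionalParameters (p : ℝ × ℝ × ℝ × ℝ) :
    volume {t : ℝ | p + (0, 0, t, t) ∈ exceptionalParameters} = 0 := by
  by_cases hp : (p.1 < p.2.1 ∧ p.2.1 < p.1 + 1) ∧ (p.2.2.1 < p.2.2.2 ∧ p.2.2.2 < p.2.2.1 + 1) ∧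
      p.2.2.2 - p.2.2.1 ≠ p.2.1 - p.1
  swap
  · refine measure_mono_null (fun t ht => hp ?_) measure_empty
    obtain ⟨⟨⟨h1, h2⟩, ⟨h3, h4⟩, h5⟩, -⟩ := ht
    simp only [Prod.fst_add, Prod.snd_add, add_zero, add_sub_add_right_eq_sub] at h1 h2 h3 h4 h5
    exact ⟨⟨h1, h2⟩, ⟨by linarith, by linarith⟩, h5⟩
  obtain ⟨⟨h1, h2⟩, ⟨h3, h4⟩, h5⟩ := hp
  set ξ := p.2.1 - p.1 with hξdef
  set η := p.2.2.2 - p.2.2.1 with hηdef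
  have hξ : 0 < ξ := by linarith
  have hξ1 : ξ < 1 := by linarith
  have hξ' : (1 : ℝ) - ξ ≠ 0 := by linarith
  have hη : 0 < η := by linarith
  have hη1 : η < 1 := by linarith
  let H : ℝ → ℝ → ℝ := fun t => centeredTwoBreak (p + (0, 0, t, t))
  have hH0 : ∀ t u, H t u = p.2.2.1 - p.1 + unitTwoBreak ξ η u + t := fun t u =>
    centeredTwoBreak_shift p t u
  have hcont : ∀ t, Continuous (H t) := fun t =>
    ((continuous_const.add (continuous_unitTwoBreak hξ hξ1)).add continuous_const).congr
      fun u => (hH0 t u).symm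
  have hH : TranslationFamily H := by
    refine ⟨fun t u v huv => ?_, fun t u => ?_, fun t u => ?_⟩
    · rw [hH0, hH0]
      linarith [strictMono_unitTwoBreak hξ hξ1 hη hη1 huv]
    · rw [hH0, hH0, unitTwoBreak_add_one]
      ring
    · rw [hH0, hH0]
      ring
  have hN : volume {t | NoLock (H t)} = 0 := by
    have hz : unitTwoBreak ξ η 0 = 0 := by
      rw [unitTwoBreak_of_le hξ1 le_rfl hξ.le, mul_zero]
    refine volume_noLock_eq_zero (b := η / ξ) (g := (1 - η) / (1 - ξ)) hH (hcont 0) hξ hξ1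
      (div_pos hη hξ) (div_pos (by linarith) (by linarith)) ?_ ?_ ?_ ?_
    · field_simp
      ring
    · rw [Ne, div_eq_div_iff hξ' hξ.ne']
      intro h
      exact h5 (by linarith)
    · intro u hu hu1
      rw [hH0, hH0, hz, unitTwoBreak_of_le hξ1 hu hu1]
      ring
    · intro u hu hu1
      rw [hH0, hH0, hz, unitTwoBreak_of_ge hξ hξ1 hu hu1]
      ring
  refine measure_mono_null (fun t ht => ?_) (measure_union_null (measure_union_null
    ((hH.countable_iterate_eq 0 0).measure_zero volume)
    ((hH.countable_iterate_eq ξ ξ).measure_zero volume)) hN)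
  obtain ⟨-, h | h | h⟩ := ht
  · exact Or.inl (Or.inl h)
  · refine Or.inl (Or.inr ?_)
    simp only [Prod.fst_add, Prod.snd_add, add_zero] at h
    exact h
  · exact Or.inr (noLock_of_forall_rat (hcont t) h)

/-- A measurable set of parameters is negligible if all its slices in a given direction are. -/
theorem volume_eq_zero_of_slices {S : Set (ℝ × ℝ × ℝ × ℝ)} (hS : MeasurableSet S)
    (v : ℝ × ℝ × ℝ × ℝ) (h : ∀ p, volume {t : ℝ | p + t • v ∈ S} = 0) : volume S = 0 := by
  have h₂ : (volume : Measure (ℝ × ℝ)).IsAddHaarMeasure :=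
    Measure.prod.instIsAddHaarMeasure volume volume
  have h₃ : (volume : Measure (ℝ × ℝ × ℝ)).IsAddHaarMeasure :=
    Measure.prod.instIsAddHaarMeasure volume volume
  have h₄ : (volume : Measure (ℝ × ℝ × ℝ × ℝ)).IsAddHaarMeasure :=
    Measure.prod.instIsAddHaarMeasure volume volume
  exact measure_eq_zero_iff_ae_notMem.2 (ae_mem_of_ae_add_linearMap_mem
    (LinearMap.toSpanSingleton ℝ _ v) volume volume hS.compl fun p =>
      measure_eq_zero_iff_ae_notMem.1 (h p))

theorem volume_exceptionalParameters : volume exceptionalParameters = 0 :=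
  volume_eq_zero_of_slices measurableSet_exceptionalParameters (0, 0, 1, 1) fun p => by
    simpa using volume_slice_exceptionalParameters p

theorem volume_equal_slopes :
    volume {p : ℝ × ℝ × ℝ × ℝ | p.2.2.2 - p.2.2.1 = p.2.1 - p.1} = 0 := by
  refine volume_eq_zero_of_slices (measurableSet_eq_fun (by fun_prop) (by fun_prop)) (0, 0, 0, 1)
    fun p => Set.Subsingleton.measure_zero (fun s hs t ht => ?_) _
  simp only [Set.mem_ofPred_eq, Prod.smul_mk, smul_eq_mul, mul_one, Prod.fst_add,
    Prod.snd_add] at hs ht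
  linarith

/-- For Lebesgue-almost every parameter `(x₁, x₂, y₁, y₂)` with `0 ≤ x₁ < x₂ < 1` and
`y₁ < y₂ < y₁ + 1`, the piecewise affine circle homeomorphism with break points `x₁, x₂`
and images `y₁, y₂` is Morse–Smale. -/
theorem almost_every_two_break_is_morse_smale :
    volume {p : ℝ × ℝ × ℝ × ℝ |
      (0 ≤ p.1 ∧ p.1 < p.2.1 ∧ p.2.1 < 1 ∧ p.2.2.1 < p.2.2.2 ∧ p.2.2.2 < p.2.2.1 + 1) ∧
      ∃ F : ℝ → ℝ, ∃ f : Circle1 → Circle1,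
        IsPiecewiseAffineTwoBreakLift p.1 p.2.1 p.2.2.1 p.2.2.2 F ∧ Induces F f ∧
          ¬ MorseSmale f} = 0 := by
  refine measure_mono_null (fun p hp => ?_)
    (measure_union_null volume_equal_slopes volume_exceptionalParameters)
  obtain ⟨⟨h0, h1, h2, h3, h4⟩, F, f, hF, hf, hM⟩ := hp
  refine or_iff_not_imp_left.2 fun hne => ⟨⟨⟨h1, by linarith⟩, ⟨h3, h4⟩, hne⟩, ?_⟩
  have hconj : ∀ x, F x = centeredTwoBreak p (x - p.1) + p.1 := fun x => by
    rw [hF.eq_unitTwoBreak h1 (by linarith), centeredTwoBreak]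
    ring
  have hit := iterate_eq_of_translate hconj
  by_contra! hcon
  obtain ⟨hc1, hc2, q₀, hq₀, n₀, ⟨x, hx⟩, ⟨y, hy⟩⟩ := hcon
  refine hM (hF.morseSmale hf (fun q hq n h => hc1 q hq n ?_) (fun q hq n h => hc2 q hq n ?_)
    fun hN => ?_)
  · rw [hit, sub_self] at h
    linarith
  · rw [hit] at h
    linarith
  · rcases noLock_of_translate hconj hN q₀ hq₀ n₀ with h | h
    · exact absurd (h x) (not_le.2 hx)
    · exact absurd (h y) (not_le.2 hy)
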